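/- Let F_q be a finite field of odd cardinality q, and let F be a monic polynomial in F_q[t] of degree n ≥ 2. If q > 8(n+6)^(2n²), then F has a Goldbach representation in F_q[t]: there exist monic irreducible F₁, F₂ ∈ F_q[t] with deg F₁ = n−1, deg F₂ = n, and F = F₁ + F₂. -/

import Mathlib

open Polynomial

section LocalOrder

variable {k R : Type*} [Field k] [CommRing R] [Algebra k R]

/-- The elements of `R` vanishing to order at least `j` at the point `P`, measured with respect to
the parameter `z`. -/
def vanishingIdeal (P : R →ₐ[k] k) (z : R) (j : ℕ) : Ideal R where
  carrier := {r | ∃ t, P t ≠ 0 ∧ z ^ j ∣ t * r}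
  zero_mem' := ⟨1, by simp, by simp⟩
  add_mem' := by
    rintro a b ⟨t, ht, hta⟩ ⟨u, hu, hub⟩
    refine ⟨t * u, by simp [ht, hu], ?_⟩
    have : t * u * (a + b) = u * (t * a) + t * (u * b) := by ring
    rw [this]
    exact dvd_add (hta.mul_left _) (hub.mul_left _)
  smul_mem' := by
    rintro c a ⟨t, ht, hta⟩
    refine ⟨t, ht, ?_⟩
    have : t * (c • a) = c * (t * a) := by simp only [smul_eq_mul]; ring
    rw [this]
    exact hta.mul_left _

lemma mem_vanishingIdeal_zero (P : R →ₐ[k] k) (z r : R) : r ∈ vanishingIdeal P z 0 :=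
  ⟨1, by simp, by simp⟩

lemma vanishingIdeal_antitone (P : R →ₐ[k] k) (z : R) : Antitone (vanishingIdeal P z) := by
  rintro i j hij r ⟨t, ht, h⟩
  exact ⟨t, ht, (pow_dvd_pow z hij).trans h⟩

lemma mul_mem_vanishingIdeal {P : R →ₐ[k] k} {z : R} {i j : ℕ} {r r' : R}
    (h : r ∈ vanishingIdeal P z i) (h' : r' ∈ vanishingIdeal P z j) :
    r * r' ∈ vanishingIdeal P z (i + j) := by
  obtain ⟨t, ht, hr⟩ := h
  obtain ⟨u, hu, hr'⟩ := h'
  refine ⟨t * u, by simp [ht, hu], ?_⟩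
  rw [pow_add, mul_mul_mul_comm]
  exact mul_dvd_mul hr hr'

lemma pow_mem_vanishingIdeal {P : R →ₐ[k] k} {z : R} {i : ℕ} {r : R}
    (h : r ∈ vanishingIdeal P z i) (m : ℕ) : r ^ m ∈ vanishingIdeal P z (m * i) := by
  induction m with
  | zero => rw [zero_mul]; exact mem_vanishingIdeal_zero P z _
  | succ m ih => rw [pow_succ, Nat.succ_mul]; exact mul_mem_vanishingIdeal ih h

lemma prod_mem_vanishingIdeal {ι : Type*} {P : R →ₐ[k] k} {z : R} (S : Finset ι) (m : ι → ℕ)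
    (f : ι → R) (h : ∀ i ∈ S, f i ∈ vanishingIdeal P z (m i)) :
    ∏ i ∈ S, f i ∈ vanishingIdeal P z (∑ i ∈ S, m i) := by
  classical
  induction S using Finset.induction_on with
  | empty => exact mem_vanishingIdeal_zero P z _
  | insert i S hi ih =>
    rw [Finset.prod_insert hi, Finset.sum_insert hi]
    exact mul_mem_vanishingIdeal (h _ (Finset.mem_insert_self _ _))
      (ih fun j hj => h _ (Finset.mem_insert_of_mem hj))

/-- The point `P` is unramified with parameter `z`: `z` generates the maximal ideal of the local
ring at `P`. -/
structure IsUnramifiedPoint (P : R →ₐ[k] k) (z : R) : Prop where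
  map_eq_zero : P z = 0
  ne_zero : z ≠ 0
  mem_one : ∀ r, P r = 0 → r ∈ vanishingIdeal P z 1

variable {P : R →ₐ[k] k} {z : R}

namespace IsUnramifiedPoint

lemma mem_succ (hP : IsUnramifiedPoint P z) {j : ℕ} {r t r' : R} (ht : P t ≠ 0)
    (h : t * r = z ^ j * r') (h0 : P r' = 0) : r ∈ vanishingIdeal P z (j + 1) := by
  obtain ⟨u, hu, w, hw⟩ := hP.mem_one r' h0
  refine ⟨u * t, by simp [hu, ht], w, ?_⟩
  rw [mul_assoc, h, mul_left_comm, hw, pow_succ]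
  ring

lemma exists_eq (hP : IsUnramifiedPoint P z) {j : ℕ} {r : R} (h : r ∈ vanishingIdeal P z j)
    (h' : r ∉ vanishingIdeal P z (j + 1)) :
    ∃ t r', P t ≠ 0 ∧ P r' ≠ 0 ∧ t * r = z ^ j * r' := by
  obtain ⟨t, ht, r', hr'⟩ := h
  exact ⟨t, r', ht, fun h0 => h' (hP.mem_succ ht hr' h0), hr'⟩

lemma exists_sub_smul_mem (hP : IsUnramifiedPoint P z) {j : ℕ} {r r₂ : R}
    (h : r ∈ vanishingIdeal P z j) (h' : r ∉ vanishingIdeal P z (j + 1))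
    (h₂ : r₂ ∈ vanishingIdeal P z j) : ∃ c : k, r₂ - c • r ∈ vanishingIdeal P z (j + 1) := by
  obtain ⟨t, r', ht, hr', e⟩ := hP.exists_eq h h'
  obtain ⟨u, hu, w, e₂⟩ := h₂
  refine ⟨P w * P t / (P u * P r'), hP.mem_succ (t := t * u) (by simp [ht, hu])
    (r' := t * w - (P w * P t / (P u * P r')) • (u * r')) ?_ ?_⟩
  · rw [mul_sub, mul_sub, mul_smul_comm, mul_smul_comm]
    congr 1
    · rw [mul_assoc, e₂]; ring
    · congr 1
      linear_combination u * e
  · simp only [map_sub, map_mul, map_smul, smul_eq_mul]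
    field_simp
    ring

lemma exists_functional (hP : IsUnramifiedPoint P z) (j : ℕ) :
    ∃ l : R →ₗ[k] k, ∀ r ∈ vanishingIdeal P z j, l r = 0 → r ∈ vanishingIdeal P z (j + 1) := by
  by_cases hj : ∀ r ∈ vanishingIdeal P z j, r ∈ vanishingIdeal P z (j + 1)
  · exact ⟨0, fun r hr _ => hj r hr⟩
  push Not at hj
  obtain ⟨r, hr, hr'⟩ := hj
  let W : Submodule k R := (vanishingIdeal P z (j + 1)).restrictScalars k
  have hW : W.mkQ r ≠ 0 := by
    simpa [W, Submodule.Quotient.mk_eq_zero] using hr'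
  obtain ⟨f, hf⟩ : ∃ f : (R ⧸ W) →ₗ[k] k, f (W.mkQ r) ≠ 0 := by
    by_contra! H
    exact hW ((Module.forall_dual_apply_eq_zero_iff k _).1 H)
  refine ⟨f ∘ₗ W.mkQ, fun r₂ hr₂ h0 => ?_⟩
  obtain ⟨c, hc⟩ := hP.exists_sub_smul_mem hr hr' hr₂
  have h1 : W.mkQ (r₂ - c • r) = 0 :=
    (Submodule.Quotient.mk_eq_zero W).2 hc
  rw [map_sub, map_smul, sub_eq_zero] at h1
  rw [LinearMap.comp_apply, h1, map_smul, smul_eq_mul, mul_eq_zero, or_iff_left hf] at h0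
  simpa [h0] using hc

lemma exists_jet (hP : IsUnramifiedPoint P z) (j : ℕ) :
    ∃ l : R →ₗ[k] (Fin j → k), ∀ r, l r = 0 → r ∈ vanishingIdeal P z j := by
  choose l hl using hP.exists_functional
  refine ⟨LinearMap.pi fun i => l i, fun r hr => ?_⟩
  have key : ∀ i ≤ j, r ∈ vanishingIdeal P z i := by
    intro i
    induction i with
    | zero => exact fun _ => mem_vanishingIdeal_zero P z r
    | succ i ih =>
      intro hi
      exact hl i r (ih (by omega)) (congrFun hr ⟨i, hi⟩)
  exact key j le_rfl

variable [IsDomain R]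

lemma mem_of_mul_pow_mem (hP : IsUnramifiedPoint P z) {j q : ℕ} {r a : R}
    (h : r ∈ vanishingIdeal P z j) (h' : r ∉ vanishingIdeal P z (j + 1))
    (ha : a * r ^ q ∈ vanishingIdeal P z (q * (j + 1))) : a ∈ vanishingIdeal P z q := by
  obtain ⟨t, r', ht, hr', e⟩ := hP.exists_eq h h'
  obtain ⟨u, hu, w, hw⟩ := ha
  refine ⟨u * r' ^ q, by simp [hu, hr'], w * t ^ q, ?_⟩
  have hz : (z ^ j) ^ q ≠ 0 := pow_ne_zero _ (pow_ne_zero _ hP.ne_zero)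
  apply mul_left_cancel₀ hz
  have e' : t ^ q * r ^ q = (z ^ j) ^ q * r' ^ q := by rw [← mul_pow, e, mul_pow]
  have : z ^ (q * (j + 1)) = (z ^ j) ^ q * z ^ q := by rw [← pow_mul, ← pow_add]; ring
  rw [this] at hw
  linear_combination t ^ q * hw - u * a * e'

lemma pow_dvd_of_aeval_mem (hP : IsUnramifiedPoint P z) {s : R} {c : k}
    (hz : z = s - algebraMap k R c) {j : ℕ} {ν : k[X]} (hν : ν ≠ 0)
    (h : aeval s ν ∈ vanishingIdeal P z j) : (X - C c) ^ j ∣ ν := by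
  obtain ⟨t, ht, w, hw⟩ := h
  obtain ⟨μ, hμ, hμc⟩ := exists_eq_pow_rootMultiplicity_mul_and_not_dvd ν hν c
  set m := ν.rootMultiplicity c
  by_cases hmj : j ≤ m
  · rw [hμ]; exact (pow_dvd_pow _ hmj).mul_right _
  exfalso
  have hs : aeval s (X - C c) = z := by simp [hz]
  rw [hμ, map_mul, map_pow, hs] at hw
  have h2 : z ^ j = z ^ m * (z * z ^ (j - m - 1)) := by
    rw [← pow_succ', ← pow_add]; congr 1; omega
  rw [h2] at hw
  have h3 : t * aeval s μ = z * z ^ (j - m - 1) * w :=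
    mul_left_cancel₀ (pow_ne_zero m hP.ne_zero) (by linear_combination hw)
  have h4 := congrArg P h3
  have hPs : P s = c := by
    have := hP.map_eq_zero
    rw [hz, map_sub, AlgHom.commutes, sub_eq_zero] at this
    exact this
  rw [map_mul, map_mul, map_mul, hP.map_eq_zero, zero_mul, zero_mul, mul_eq_zero, or_iff_right ht,
    ← aeval_algHom_apply, hPs] at h4
  exact hμc (dvd_iff_isRoot.2 h4)

/-- Artin–Whaples-type independence: `q`-th powers of `k`-linearly independent elements are
independent over elements which cannot vanish to order `q`. -/
lemma eq_zero_of_sum_mul_pow_eq_zero (hP : IsUnramifiedPoint P z)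
    (hsep : ∀ r : R, r ≠ 0 → ∃ j, r ∉ vanishingIdeal P z j) {q : ℕ} (hq : q ≠ 0)
    (hadd : ∀ a b : R, (a + b) ^ q = a ^ q + b ^ q) (W : Submodule k R)
    (hW : ∀ a ∈ W, a ∈ vanishingIdeal P z q → a = 0) :
    ∀ (m : ℕ) (b a : Fin m → R), LinearIndependent k b → (∀ i, a i ∈ W) →
      ∑ i, a i * b i ^ q = 0 → ∀ i, a i = 0 := by
  intro m
  induction m with
  | zero => intro b a _ _ _ i; exact i.elim0
  | succ m ih =>
    intro b a hb ha hsum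
    classical
    have hex : ∃ j, ∃ i, b i ∉ vanishingIdeal P z (j + 1) := by
      obtain ⟨j, hj⟩ := hsep (b 0) (hb.ne_zero 0)
      exact ⟨j, 0, fun h => hj (vanishingIdeal_antitone P z (Nat.le_succ j) h)⟩
    set j := Nat.find hex
    obtain ⟨i₀, hi₀⟩ := Nat.find_spec hex
    have hmem : ∀ i, b i ∈ vanishingIdeal P z j := by
      intro i
      rcases Nat.eq_zero_or_pos j with h0 | h0
      · rw [h0]; exact mem_vanishingIdeal_zero P z _
      · have := Nat.find_min hex (m := j - 1) (by change j - 1 < j; omega)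
        push Not at this
        simpa [Nat.sub_add_cancel h0] using this i
    have hc : ∀ i, ∃ c : k, b i - c • b i₀ ∈ vanishingIdeal P z (j + 1) :=
      fun i => hP.exists_sub_smul_mem (hmem i₀) hi₀ (hmem i)
    choose c hc using hc
    let F : R →+ R := ⟨⟨fun x => x ^ q, zero_pow hq⟩, hadd⟩
    have hF : ∀ x, F x = x ^ q := fun _ => rfl
    set b' : Fin m → R := fun i => b (i₀.succAbove i) - c (i₀.succAbove i) • b i₀ with hb'
    set a₀ : R := a i₀ + ∑ i, (c (i₀.succAbove i)) ^ q • a (i₀.succAbove i) with ha₀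
    have ha₀W : a₀ ∈ W := W.add_mem (ha _) (W.sum_mem fun i _ => W.smul_mem _ (ha _))
    have hsplit : a₀ * b i₀ ^ q + ∑ i, a (i₀.succAbove i) * b' i ^ q = 0 := by
      rw [← hsum, Fin.sum_univ_succAbove _ i₀, ha₀, add_mul, add_assoc, Finset.sum_mul,
        ← Finset.sum_add_distrib]
      congr 1
      refine Finset.sum_congr rfl fun i _ => ?_
      have : b (i₀.succAbove i) ^ q =
          b' i ^ q + (c (i₀.succAbove i) • b i₀) ^ q := by
        rw [← hadd, hb']; simp
      rw [this, Algebra.smul_def, Algebra.smul_def, mul_pow, map_pow]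
      ring
    have ha₀0 : a₀ = 0 := by
      apply hW _ ha₀W
      apply hP.mem_of_mul_pow_mem (hmem i₀) hi₀
      rw [eq_neg_of_add_eq_zero_left hsplit]
      refine neg_mem (sum_mem fun i _ => ?_)
      exact Ideal.mul_mem_left _ _ (pow_mem_vanishingIdeal (hc _) q)
    rw [ha₀0, zero_mul, zero_add] at hsplit
    have hb'i : LinearIndependent k b' := by
      rw [Fintype.linearIndependent_iff] at hb ⊢
      intro g hg i
      let g' : Fin (m + 1) → k :=
        i₀.insertNth (-∑ i, g i * c (i₀.succAbove i)) g
      have := hb g' (by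
        rw [Fin.sum_univ_succAbove _ i₀]
        simp only [g', Fin.insertNth_apply_same, Fin.insertNth_apply_succAbove]
        rw [← hg]
        simp only [hb', smul_sub, Finset.sum_sub_distrib, neg_smul, Finset.sum_smul, mul_smul]
        ring) (i₀.succAbove i)
      simpa [g'] using this
    have h1 := ih b' (fun i => a (i₀.succAbove i)) hb'i (fun i => ha _) hsplit
    intro i
    rcases Fin.eq_self_or_eq_succAbove i₀ i with rfl | ⟨i', rfl⟩
    · have : ∑ i', (c (i.succAbove i')) ^ q • a (i.succAbove i') = 0 :=
        Finset.sum_eq_zero fun i' _ => by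
          have := h1 i'
          rw [this, smul_zero]
      rw [ha₀, this, add_zero] at ha₀0
      exact ha₀0
    · exact h1 i'

end IsUnramifiedPoint

end LocalOrder

/-- A domain `R` generated over `k` by a parameter `s` and the `n` roots `x i` of a monic polynomial
`G` over `k[s]`, on which the full symmetric group acts, together with a filtration `V` by order of
the pole at infinity. -/
structure SplittingCover (k : Type*) [Field k] (n : ℕ) (R : Type*) [CommRing R]
    [Algebra k R] where
  s : R
  x : Fin n → R
  G : k[X][X]
  e : ℕ
  V : ℕ → Submodule k R
  act : Equiv.Perm (Fin n) →* (R ≃ₐ[k] R)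
  adjoin_eq_top : Algebra.adjoin k (insert s (Set.range x)) = ⊤
  one_mem : 1 ∈ V 0
  mul_mem : ∀ {a b : ℕ} {r r' : R}, r ∈ V a → r' ∈ V b → r * r' ∈ V (a + b)
  mono : Monotone V
  s_mem : s ∈ V 1
  x_mem : ∀ i, x i ∈ V e
  act_mem : ∀ σ {a : ℕ} {r : R}, r ∈ V a → act σ r ∈ V a
  act_s : ∀ σ, act σ s = s
  act_x : ∀ σ i, act σ (x i) = x (σ i)
  exists_of_invariant : ∀ {d : ℕ} {r : R}, r ∈ V d → (∀ σ, act σ r = r) →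
    ∃ ν : k[X], aeval s ν = r ∧ ν.natDegree ≤ d
  aeval_injective : Function.Injective (aeval s : k[X] → R)
  map_G : G.map (aeval s : k[X] →ₐ[k] R).toRingHom = ∏ i, (X - C (x i))
  natDegree_coeff : ∀ j ≤ n, (G.coeff j).natDegree + j * e ≤ n * e
  expo : Fin n.factorial → Fin n → ℕ
  expo_lt : ∀ α i, expo α i < n
  linearIndependent :
    LinearIndependent k fun p : ℕ × Fin n.factorial => s ^ p.1 * ∏ i, x i ^ expo p.2 i

namespace SplittingCover

variable {k R : Type*} [Field k] [CommRing R] [Algebra k R] {n : ℕ}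
  (S : SplittingCover k n R)

lemma aeval_eval_G (g : k[X]) :
    aeval S.s (S.G.eval g) = ∏ i, (aeval S.s g - S.x i) := by
  have h := congrArg (eval (aeval S.s g)) S.map_G
  rw [eval_prod] at h
  simp only [eval_sub, eval_X, eval_C] at h
  rw [← h]
  exact (eval_map_apply (aeval S.s : k[X] →ₐ[k] R).toRingHom g).symm

lemma eval_eq (r : R) :
    (S.G.map (aeval S.s : k[X] →ₐ[k] R).toRingHom).eval r = ∏ i, (r - S.x i) := by
  rw [S.map_G, eval_prod]; simp

lemma natDegree_map_G [Nontrivial R] :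
    (S.G.map (aeval S.s : k[X] →ₐ[k] R).toRingHom).natDegree = n := by
  rw [S.map_G, natDegree_prod_of_monic _ _ fun i _ => monic_X_sub_C _]; simp

lemma sum_coeff_eq [Nontrivial R] (r : R) :
    ∑ j ∈ Finset.range (n + 1), aeval S.s (S.G.coeff j) * r ^ j = ∏ i, (r - S.x i) := by
  rw [← S.eval_eq, eval_eq_sum_range, S.natDegree_map_G]
  refine Finset.sum_congr rfl fun j _ => ?_
  rw [coeff_map]; rfl

lemma pow_mem {a : ℕ} {r : R} (h : r ∈ S.V a) (m : ℕ) : r ^ m ∈ S.V (m * a) := by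
  induction m with
  | zero => rw [pow_zero, zero_mul]; exact S.one_mem
  | succ m ih => rw [pow_succ, Nat.succ_mul]; exact S.mul_mem ih h

lemma prod_mem {ι : Type*} (T : Finset ι) (d : ι → ℕ) (f : ι → R) (h : ∀ i ∈ T, f i ∈ S.V (d i)) :
    ∏ i ∈ T, f i ∈ S.V (∑ i ∈ T, d i) := by
  classical
  induction T using Finset.induction_on with
  | empty => exact S.one_mem
  | insert i T hi ih =>
    rw [Finset.prod_insert hi, Finset.sum_insert hi]
    exact S.mul_mem (h _ (Finset.mem_insert_self _ _))
      (ih fun j hj => h _ (Finset.mem_insert_of_mem hj))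

lemma exists_mem (r : R) : ∃ d, r ∈ S.V d := by
  have hr : r ∈ Algebra.adjoin k (insert S.s (Set.range S.x)) := by
    rw [S.adjoin_eq_top]; trivial
  induction hr using Algebra.adjoin_induction with
  | mem y hy =>
    rcases hy with rfl | ⟨i, rfl⟩
    · exact ⟨1, S.s_mem⟩
    · exact ⟨S.e, S.x_mem i⟩
  | algebraMap c =>
    refine ⟨0, ?_⟩
    rw [Algebra.algebraMap_eq_smul_one]
    exact (S.V 0).smul_mem _ S.one_mem
  | add a b _ _ ha hb =>
    obtain ⟨i, hi⟩ := ha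
    obtain ⟨j, hj⟩ := hb
    exact ⟨max i j, (S.V _).add_mem (S.mono (le_max_left _ _) hi) (S.mono (le_max_right _ _) hj)⟩
  | mul a b _ _ ha hb =>
    obtain ⟨i, hi⟩ := ha
    obtain ⟨j, hj⟩ := hb
    exact ⟨i + j, S.mul_mem hi hj⟩

lemma s_sub_ne_zero (c : k) : S.s - algebraMap k R c ≠ 0 := by
  intro h
  have : aeval S.s (X - C c : k[X]) = aeval S.s (0 : k[X]) := by simpa using h
  exact X_sub_C_ne_zero c (S.aeval_injective this)

lemma isUnramifiedPoint {P : R →ₐ[k] k} (hP : Function.Injective fun i => P (S.x i)) :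
    IsUnramifiedPoint P (S.s - algebraMap k R (P S.s)) := by
  classical
  refine ⟨by simp, S.s_sub_ne_zero _, ?_⟩
  suffices H : ∀ r, r - algebraMap k R (P r) ∈
      vanishingIdeal P (S.s - algebraMap k R (P S.s)) 1 by
    intro r hr
    simpa [hr] using H r
  intro r
  have hr : r ∈ Algebra.adjoin k (insert S.s (Set.range S.x)) := by
    rw [S.adjoin_eq_top]; trivial
  induction hr using Algebra.adjoin_induction with
  | mem y hy =>
    rcases hy with rfl | ⟨i, rfl⟩
    · exact ⟨1, by simp, by simp⟩
    · refine ⟨∏ l ∈ Finset.univ.erase i, (algebraMap k R (P (S.x i)) - S.x l), ?_, ?_⟩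
      · rw [map_prod, Finset.prod_ne_zero_iff]
        intro l hl
        simp only [map_sub, AlgHom.commutes, Algebra.algebraMap_self, RingHom.id_apply]
        rw [sub_ne_zero]
        exact fun h => (Finset.ne_of_mem_erase hl) (hP h).symm
      · have h1 : aeval S.s (S.G.eval (C (P (S.x i)))) =
            ∏ l, (algebraMap k R (P (S.x i)) - S.x l) := by
          rw [S.aeval_eval_G, aeval_C]
        have h2 : (S.G.eval (C (P (S.x i)))).IsRoot (P S.s) := by
          have := congrArg P h1
          rw [← aeval_algHom_apply, map_prod,
            Finset.prod_eq_zero (Finset.mem_univ i) (by simp)] at this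
          exact this
        obtain ⟨w, hw⟩ := dvd_iff_isRoot.2 h2
        refine ⟨-aeval S.s w, ?_⟩
        rw [← Finset.mul_prod_erase _ _ (Finset.mem_univ i), hw, map_mul] at h1
        simp only [map_sub, aeval_X, aeval_C] at h1
        rw [pow_one]
        linear_combination h1
  | algebraMap c => simp
  | add a b _ _ ha hb =>
    convert add_mem ha hb using 1
    rw [map_add, map_add]; ring
  | mul a b _ _ ha hb =>
    convert add_mem (Ideal.mul_mem_left _ b ha)
      (Ideal.mul_mem_left _ (algebraMap k R (P a)) hb) using 1
    rw [map_mul, map_mul]; ring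

/-- The norm of an element to `k[s]`. -/
lemma exists_norm {d : ℕ} {r : R} (h : r ∈ S.V d) :
    ∃ ν : k[X], aeval S.s ν = ∏ σ, S.act σ r ∧ ν.natDegree ≤ n.factorial * d := by
  refine S.exists_of_invariant ?_ fun σ => ?_
  · have := S.prod_mem Finset.univ (fun _ => d) (fun σ => S.act σ r) fun σ _ => S.act_mem σ h
    simpa [Fintype.card_perm] using this
  · rw [map_prod]
    refine Fintype.prod_equiv (Equiv.mulLeft σ) _ _ fun τ => ?_
    rw [Equiv.coe_mulLeft, map_mul]; rfl

variable [IsDomain R]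

lemma norm_ne_zero {r : R} (h : r ≠ 0) : ∏ σ, S.act σ r ≠ 0 := by
  rw [Finset.prod_ne_zero_iff]
  intro σ _
  simpa using h

lemma le_of_mem_vanishingIdeal {P : R →ₐ[k] k} (hP : Function.Injective fun i => P (S.x i))
    {d j : ℕ} {r : R} (hr : r ∈ S.V d) (h0 : r ≠ 0)
    (hj : r ∈ vanishingIdeal P (S.s - algebraMap k R (P S.s)) j) : j ≤ n.factorial * d := by
  obtain ⟨ν, hν, hd⟩ := S.exists_norm hr
  have hν0 : ν ≠ 0 := by
    rintro rfl
    rw [map_zero] at hν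
    exact S.norm_ne_zero h0 hν.symm
  have hmem : aeval S.s ν ∈ vanishingIdeal P (S.s - algebraMap k R (P S.s)) j := by
    rw [hν, ← Finset.mul_prod_erase _ _ (Finset.mem_univ 1), map_one]
    exact Ideal.mul_mem_right _ _ hj
  have := (S.isUnramifiedPoint hP).pow_dvd_of_aeval_mem rfl hν0 hmem
  have h2 := natDegree_le_of_dvd this hν0
  rw [natDegree_pow, natDegree_X_sub_C, mul_one] at h2
  omega

end SplittingCover

namespace SplittingCover

variable {k R : Type*} [Field k] [CommRing R] [Algebra k R] {n : ℕ}
  (S : SplittingCover k n R)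

/-- `S.FrobPair q σ d u v` says that `v` is an expression in elements of the cover and their images
under the `q`-power map, and that `u` is the element of `S.V d` obtained from `v` by replacing
`s ^ q` by `s` and `x i ^ q` by `x (σ i)`. -/
inductive FrobPair (q : ℕ) (σ : Equiv.Perm (Fin n)) : ℕ → R → R → Prop
  | refl {d : ℕ} {r : R} : r ∈ S.V d → FrobPair q σ d r r
  | s : FrobPair q σ 1 S.s (S.s ^ q)
  | x (i : Fin n) : FrobPair q σ S.e (S.x (σ i)) (S.x i ^ q)
  | add {d : ℕ} {u v u' v' : R} : FrobPair q σ d u v → FrobPair q σ d u' v' →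
      FrobPair q σ d (u + u') (v + v')
  | mul {d d' : ℕ} {u v u' v' : R} : FrobPair q σ d u v → FrobPair q σ d' u' v' →
      FrobPair q σ (d + d') (u * u') (v * v')
  | mono {d d' : ℕ} {u v : R} : d ≤ d' → FrobPair q σ d u v → FrobPair q σ d' u v

variable {S} {q : ℕ} {σ : Equiv.Perm (Fin n)}

namespace FrobPair

lemma mem {d : ℕ} {u v : R} (h : S.FrobPair q σ d u v) : u ∈ S.V d := by
  induction h with
  | refl h => exact h
  | s => exact S.s_mem
  | x i => exact S.x_mem _
  | add _ _ h h' => exact (S.V _).add_mem h h'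
  | mul _ _ h h' => exact S.mul_mem h h'
  | mono hd _ h => exact S.mono hd h

lemma algebraMap (c : k) : S.FrobPair q σ 0 (algebraMap k R c) (algebraMap k R c) := by
  refine refl ?_
  rw [Algebra.algebraMap_eq_smul_one]
  exact (S.V 0).smul_mem _ S.one_mem

lemma neg {d : ℕ} {u v : R} (h : S.FrobPair q σ d u v) : S.FrobPair q σ d (-u) (-v) := by
  have := (algebraMap (S := S) (q := q) (σ := σ) (-1)).mul h
  simpa using this

lemma sub {d : ℕ} {u v u' v' : R} (h : S.FrobPair q σ d u v) (h' : S.FrobPair q σ d u' v') :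
    S.FrobPair q σ d (u - u') (v - v') := by
  rw [sub_eq_add_neg, sub_eq_add_neg]
  exact h.add h'.neg

lemma zero (d : ℕ) : S.FrobPair q σ d 0 0 := refl (S.V d).zero_mem

lemma sum {ι : Type*} (T : Finset ι) {d : ℕ} (u v : ι → R)
    (h : ∀ i ∈ T, S.FrobPair q σ d (u i) (v i)) :
    S.FrobPair q σ d (∑ i ∈ T, u i) (∑ i ∈ T, v i) := by
  classical
  induction T using Finset.induction_on with
  | empty => exact zero d
  | insert i T hi ih =>
    rw [Finset.sum_insert hi, Finset.sum_insert hi]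
    exact (h _ (Finset.mem_insert_self _ _)).add
      (ih fun j hj => h _ (Finset.mem_insert_of_mem hj))

lemma prod {ι : Type*} (T : Finset ι) (d : ι → ℕ) (u v : ι → R)
    (h : ∀ i ∈ T, S.FrobPair q σ (d i) (u i) (v i)) :
    S.FrobPair q σ (∑ i ∈ T, d i) (∏ i ∈ T, u i) (∏ i ∈ T, v i) := by
  classical
  induction T using Finset.induction_on with
  | empty => exact refl S.one_mem
  | insert i T hi ih =>
    rw [Finset.prod_insert hi, Finset.prod_insert hi, Finset.sum_insert hi]
    exact (h _ (Finset.mem_insert_self _ _)).mul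
      (ih fun j hj => h _ (Finset.mem_insert_of_mem hj))

lemma pow {d : ℕ} {u v : R} (h : S.FrobPair q σ d u v) (m : ℕ) :
    S.FrobPair q σ (m * d) (u ^ m) (v ^ m) := by
  simpa using prod (Finset.range m) (fun _ => d) (fun _ => u) (fun _ => v) fun _ _ => h

end FrobPair

variable (S)

lemma exists_frobPair_poly (q : ℕ) (σ : Equiv.Perm (Fin n)) (g : k[X]) (D : ℕ)
    (hD : g.natDegree ≤ D) :
    ∃ u v, S.FrobPair q σ D u v ∧
      aeval (S.s ^ q) g - aeval S.s g = (S.s ^ q - S.s) * v := by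
  have key : ∀ j ≤ D, ∃ u v, S.FrobPair q σ D u v ∧
      (S.s ^ q) ^ j - S.s ^ j = (S.s ^ q - S.s) * v := by
    intro j hj
    refine ⟨_, _, FrobPair.sum (Finset.range j) (fun i => S.s ^ i * S.s ^ (j - 1 - i))
      (fun i => (S.s ^ q) ^ i * S.s ^ (j - 1 - i)) fun i hi => ?_, ?_⟩
    · have h1 := (FrobPair.s (S := S) (q := q) (σ := σ)).pow i
      have h2 := (FrobPair.refl (q := q) (σ := σ) S.s_mem).pow (j - 1 - i)
      refine (h1.mul h2).mono ?_
      have := Finset.mem_range.1 hi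
      omega
    · exact ((Commute.all _ _).mul_geom_sum₂ _).symm
  choose! u v h1 h2 using key
  refine ⟨_, _, FrobPair.sum (Finset.range (D + 1)) (fun j => algebraMap k R (g.coeff j) * u j)
    (fun j => algebraMap k R (g.coeff j) * v j) fun j hj => ?_, ?_⟩
  · simpa using (FrobPair.algebraMap _).mul (h1 j (by have := Finset.mem_range.1 hj; omega))
  · rw [aeval_eq_sum_range' (n := D + 1) (by omega), aeval_eq_sum_range' (n := D + 1) (by omega),
      ← Finset.sum_sub_distrib, Finset.mul_sum]
    refine Finset.sum_congr rfl fun j hj => ?_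
    rw [← smul_sub, h2 j (by have := Finset.mem_range.1 hj; omega), Algebra.smul_def]
    ring

/-- The product of the differences of `x i ^ q` and the roots other than `x (σ i)`. -/
noncomputable def separant (q : ℕ) (σ : Equiv.Perm (Fin n)) : R :=
  ∏ i, ∏ l ∈ Finset.univ.erase (σ i), (S.x i ^ q - S.x l)

lemma frobPair_separant_erase (q : ℕ) (σ : Equiv.Perm (Fin n)) (T : Finset (Fin n)) :
    ∃ u, S.FrobPair q σ (T.card * ((n - 1) * S.e)) u
      (∏ i ∈ T, ∏ l ∈ Finset.univ.erase (σ i), (S.x i ^ q - S.x l)) := by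
  have := FrobPair.prod (S := S) (q := q) (σ := σ) T (fun _ => (n - 1) * S.e)
    (fun i => ∏ l ∈ Finset.univ.erase (σ i), (S.x (σ i) - S.x l))
    (fun i => ∏ l ∈ Finset.univ.erase (σ i), (S.x i ^ q - S.x l)) fun i _ => by
      have := FrobPair.prod (S := S) (q := q) (σ := σ) (Finset.univ.erase (σ i)) (fun _ => S.e)
        (fun l => (S.x (σ i) - S.x l)) (fun l => (S.x i ^ q - S.x l))
        fun l _ => (FrobPair.x i).sub (FrobPair.refl (S.x_mem l))
      simpa using this
  exact ⟨_, by simpa using this⟩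

variable (hadd : ∀ a b : R, (a + b) ^ q = a ^ q + b ^ q) (hq : q ≠ 0)
  (hfrob : ∀ j, aeval S.s (S.G.coeff j) ^ q = aeval (S.s ^ q) (S.G.coeff j))

include hadd hq hfrob in
lemma exists_frobPair_root [Nontrivial R] (σ : Equiv.Perm (Fin n)) (i : Fin n) :
    ∃ u v, S.FrobPair q σ (n * S.e) u v ∧
      ∏ l, (S.x i ^ q - S.x l) = (S.s ^ q - S.s) * v := by
  have h0 : ∑ j ∈ Finset.range (n + 1), aeval (S.s ^ q) (S.G.coeff j) * (S.x i ^ q) ^ j = 0 := by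
    let F : R →+ R := ⟨⟨fun x => x ^ q, zero_pow hq⟩, hadd⟩
    have hF : ∀ x, F x = x ^ q := fun _ => rfl
    have h := congrArg F (S.sum_coeff_eq (S.x i))
    rw [Finset.prod_eq_zero (Finset.mem_univ i) (sub_self _), map_zero, map_sum] at h
    rw [← h]
    refine Finset.sum_congr rfl fun j _ => ?_
    rw [hF, mul_pow, hfrob, pow_right_comm]
  have hp := fun j : ℕ => S.exists_frobPair_poly q σ (S.G.coeff j) (S.G.coeff j).natDegree le_rfl
  choose u v h1 h2 using hp
  refine ⟨_, _, FrobPair.sum (Finset.range (n + 1)) (fun j => -(u j * S.x (σ i) ^ j))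
    (fun j => -(v j * (S.x i ^ q) ^ j)) fun j hj => ?_, ?_⟩
  · exact (((h1 j).mul ((FrobPair.x i).pow j)).neg).mono
      (S.natDegree_coeff j (by have := Finset.mem_range.1 hj; omega))
  · rw [← S.sum_coeff_eq, ← sub_zero (∑ j ∈ _, _), ← h0, ← Finset.sum_sub_distrib, Finset.mul_sum]
    refine Finset.sum_congr rfl fun j _ => ?_
    linear_combination -(S.x i ^ q) ^ j * h2 j

include hadd hq hfrob in
/-- Division by `s ^ q - s` after multiplication by the separant. -/
lemma FrobPair.exists_div [Nontrivial R] {d : ℕ} {u v : R} (h : S.FrobPair q σ d u v) :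
    ∃ u' v', S.FrobPair q σ (d + n * n * S.e) u' v' ∧
      S.separant q σ * (v - u) = (S.s ^ q - S.s) * v' := by
  have hle : ∀ m : ℕ, m * ((m - 1) * S.e) ≤ m * m * S.e := fun m => by
    rw [← mul_assoc]
    exact Nat.mul_le_mul_right _ (Nat.mul_le_mul_left _ (Nat.sub_le _ _))
  induction h with
  | refl h => exact ⟨0, 0, FrobPair.zero _, by simp⟩
  | s =>
    obtain ⟨u, hu⟩ := S.frobPair_separant_erase q σ Finset.univ
    refine ⟨u, S.separant q σ, hu.mono ?_, mul_comm _ _⟩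
    have := hle n
    simp only [Finset.card_univ, Fintype.card_fin]
    omega
  | x i =>
    obtain ⟨u, hu⟩ := S.frobPair_separant_erase q σ (Finset.univ.erase i)
    obtain ⟨u', v', h', e'⟩ := S.exists_frobPair_root hadd hq hfrob σ i
    refine ⟨_, _, (hu.mul h').mono ?_, ?_⟩
    · rw [Finset.card_erase_of_mem (Finset.mem_univ _), Finset.card_univ, Fintype.card_fin]
      obtain ⟨m, rfl⟩ : ∃ m, n = m + 1 := ⟨n - 1, by have := i.pos; omega⟩
      simp only [Nat.add_sub_cancel]
      nlinarith [Nat.zero_le (m * S.e)]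
    · rw [separant, ← Finset.mul_prod_erase _ _ (Finset.mem_univ i), mul_left_comm, ← e',
        ← Finset.mul_prod_erase Finset.univ _ (Finset.mem_univ (σ i))]
      ring
  | add _ _ h h' =>
    obtain ⟨a, b, hab, e⟩ := h
    obtain ⟨a', b', hab', e'⟩ := h'
    exact ⟨_, _, hab.add hab', by linear_combination e + e'⟩
  | @mul d d' u v u' v' h₁ h₂ h h' =>
    obtain ⟨a, b, hab, e⟩ := h
    obtain ⟨a', b', hab', e'⟩ := h'
    refine ⟨_, _, ((hab.mul h₂).mono ?_).add (((FrobPair.refl h₁.mem).mul hab').mono ?_), ?_⟩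
    · omega
    · omega
    · linear_combination v' * e + u * e'
  | mono hd _ h =>
    obtain ⟨a, b, hab, e⟩ := h
    exact ⟨a, b, hab.mono (by omega), e⟩

include hadd hq hfrob in
lemma FrobPair.exists_seq [Nontrivial R] {d : ℕ} {u v : R} (h : S.FrobPair q σ d u v) :
    ∃ a b : ℕ → R, (∀ j, S.FrobPair q σ (d + j * (n * n * S.e)) (a j) (b j)) ∧ b 0 = v ∧
      ∀ j, S.separant q σ * (b j - a j) = (S.s ^ q - S.s) * b (j + 1) := by
  have step : ∀ (j : ℕ) (p : {p : R × R // S.FrobPair q σ (d + j * (n * n * S.e)) p.1 p.2}),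
      ∃ p' : {p : R × R // S.FrobPair q σ (d + (j + 1) * (n * n * S.e)) p.1 p.2},
        S.separant q σ * (p.1.2 - p.1.1) = (S.s ^ q - S.s) * p'.1.2 := by
    rintro j ⟨p, hp⟩
    obtain ⟨a, b, hab, e⟩ := FrobPair.exists_div S hadd hq hfrob hp
    exact ⟨⟨(a, b), by rw [Nat.succ_mul, ← add_assoc]; exact hab⟩, e⟩
  choose f hf using step
  let z : ∀ j, {p : R × R // S.FrobPair q σ (d + j * (n * n * S.e)) p.1 p.2} := fun j =>
    Nat.rec ⟨(u, v), by simpa using h⟩ (fun j p => f j p) j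
  exact ⟨fun j => (z j).1.1, fun j => (z j).1.2, fun j => (z j).2, rfl, fun j => hf j (z j)⟩

end SplittingCover

namespace SplittingCover

variable {k R : Type*} [Field k] [CommRing R] [Algebra k R] {n : ℕ}
  (S : SplittingCover k n R) {q : ℕ} {σ : Equiv.Perm (Fin n)}

/-- The monomials in the roots which, multiplied by powers of `s`, are linearly independent. -/
def monom (α : Fin n.factorial) : R := ∏ i, S.x i ^ S.expo α i

lemma sum_expo_le (α : Fin n.factorial) : ∑ i, S.expo α i * S.e ≤ n * n * S.e := by
  rw [← Finset.sum_mul]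
  refine Nat.mul_le_mul_right _ ?_
  calc ∑ i, S.expo α i ≤ ∑ _i : Fin n, n := Finset.sum_le_sum fun i _ => (S.expo_lt α i).le
    _ = n * n := by simp

lemma monom_mem (α : Fin n.factorial) : S.monom α ∈ S.V (n * n * S.e) :=
  S.mono (S.sum_expo_le α) (S.prod_mem _ _ _ fun i _ => S.pow_mem (S.x_mem i) _)

lemma frobPair_monom (α : Fin n.factorial) :
    S.FrobPair q σ (n * n * S.e) (∏ i, S.x (σ i) ^ S.expo α i) (S.monom α ^ q) := by
  have := FrobPair.prod (S := S) (q := q) (σ := σ) Finset.univ (fun i => S.expo α i * S.e)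
    _ _ fun i _ => (FrobPair.x i).pow (S.expo α i)
  refine FrobPair.mono (S.sum_expo_le α) ?_
  convert this using 1
  rw [monom, ← Finset.prod_pow]
  exact Finset.prod_congr rfl fun i _ => by rw [← pow_mul, ← pow_mul, mul_comm]

/-- The index set of the monomials in the auxiliary function. -/
abbrev AuxIndex (n A B : ℕ) := (Fin B × Fin n.factorial) × (Fin A × Fin n.factorial)

/-- The monomials in the auxiliary function. -/
def auxTerm (q : ℕ) {A B : ℕ} (i : AuxIndex n A B) : R :=
  (S.s ^ (i.2.1 : ℕ) * S.monom i.2.2) * (S.s ^ (i.1.1 : ℕ) * S.monom i.1.2) ^ q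

lemma exists_frobPair_auxTerm {A B : ℕ} (i : AuxIndex n A B) :
    ∃ u, S.FrobPair q σ (A + B + 2 * (n * n * S.e)) u (S.auxTerm q i) := by
  obtain ⟨⟨b, β⟩, ⟨a, α⟩⟩ := i
  have h1 : S.s ^ (a : ℕ) * S.monom α ∈ S.V (a * 1 + n * n * S.e) :=
    S.mul_mem (S.pow_mem S.s_mem _) (S.monom_mem α)
  have h2 := ((FrobPair.refl (q := q) (σ := σ) h1).mul
    (((FrobPair.s (S := S) (q := q) (σ := σ)).pow b).mul (S.frobPair_monom β)))
  have h3 : S.auxTerm q ((b, β), (a, α)) =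
      S.s ^ (a : ℕ) * S.monom α * ((S.s ^ q) ^ (b : ℕ) * S.monom β ^ q) := by
    rw [auxTerm, mul_pow, pow_right_comm]
  rw [h3]
  exact ⟨_, h2.mono (by omega)⟩

lemma auxTerm_mem {A B : ℕ} (i : AuxIndex n A B) :
    S.auxTerm q i ∈ S.V (A + n * n * S.e + q * (B + n * n * S.e)) := by
  obtain ⟨⟨b, β⟩, ⟨a, α⟩⟩ := i
  have h1 : S.s ^ (a : ℕ) * S.monom α ∈ S.V (A + n * n * S.e) :=
    S.mono (by omega) (S.mul_mem (S.pow_mem S.s_mem _) (S.monom_mem α))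
  have h2 : S.s ^ (b : ℕ) * S.monom β ∈ S.V (B + n * n * S.e) :=
    S.mono (by omega) (S.mul_mem (S.pow_mem S.s_mem _) (S.monom_mem β))
  exact S.mul_mem h1 (S.pow_mem h2 q)

variable [IsDomain R] (hadd : ∀ a b : R, (a + b) ^ q = a ^ q + b ^ q) (hq : q ≠ 0)

include hadd hq in
lemma eq_zero_of_sum_auxTerm_eq_zero {P : R →ₐ[k] k}
    (hP : Function.Injective fun i => P (S.x i)) {A B : ℕ}
    (hA : n.factorial * (A + n * n * S.e) < q) (κ : AuxIndex n A B → k)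
    (h : ∑ i, κ i • S.auxTerm q i = 0) : κ = 0 := by
  have hli : ∀ m : ℕ, LinearIndependent k
      fun p : Fin m × Fin n.factorial => S.s ^ (p.1 : ℕ) * S.monom p.2 := fun m =>
    S.linearIndependent.comp (fun p : Fin m × Fin n.factorial => ((p.1 : ℕ), p.2))
      (Fin.val_injective.prodMap Function.injective_id)
  have hU := S.isUnramifiedPoint hP
  have hsep : ∀ r : R, r ≠ 0 →
      ∃ j, r ∉ vanishingIdeal P (S.s - algebraMap k R (P S.s)) j := by
    intro r hr
    obtain ⟨d, hd⟩ := S.exists_mem r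
    exact ⟨n.factorial * d + 1, fun h => by
      have := S.le_of_mem_vanishingIdeal hP hd hr h; omega⟩
  let eqv := Fintype.equivFin (Fin B × Fin n.factorial)
  have key := hU.eq_zero_of_sum_mul_pow_eq_zero hsep hq hadd (S.V (A + n * n * S.e))
    (fun a ha h' => by
      by_contra h0
      have := S.le_of_mem_vanishingIdeal hP ha h0 h'
      omega) _
    (fun m => S.s ^ ((eqv.symm m).1 : ℕ) * S.monom (eqv.symm m).2)
    (fun m => ∑ p : Fin A × Fin n.factorial,
      κ (eqv.symm m, p) • (S.s ^ (p.1 : ℕ) * S.monom p.2))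
    ((hli B).comp _ eqv.symm.injective)
    (fun m => Submodule.sum_mem _ fun p _ => Submodule.smul_mem _ _
      (S.mono (by omega) (S.mul_mem (S.pow_mem S.s_mem _) (S.monom_mem p.2))))
    (by
      rw [← h, Fintype.sum_prod_type]
      refine (Equiv.sum_comp eqv.symm fun p' : Fin B × Fin n.factorial =>
        (∑ p : Fin A × Fin n.factorial,
          κ (p', p) • (S.s ^ (p.1 : ℕ) * S.monom p.2)) *
          (S.s ^ (p'.1 : ℕ) * S.monom p'.2) ^ q).trans ?_
      refine Finset.sum_congr rfl fun p' _ => ?_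
      rw [Finset.sum_mul]
      exact Finset.sum_congr rfl fun p _ => by rw [smul_mul_assoc]; rfl)
  funext ⟨p', p⟩
  have h1 := key (eqv p')
  rw [Equiv.symm_apply_apply] at h1
  exact Fintype.linearIndependent_iff.1 (hli A) _ h1 p

variable (hfrob : ∀ j, aeval S.s (S.G.coeff j) ^ q = aeval (S.s ^ q) (S.G.coeff j))

include hadd hq hfrob in
/-- The auxiliary function. -/
lemma exists_auxiliary (σ : Equiv.Perm (Fin n)) {P : R →ₐ[k] k}
    (hP : Function.Injective fun i => P (S.x i)) {A B M : ℕ}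
    (hA : n.factorial * (A + n * n * S.e) < q)
    (hM : M * (n.factorial * (A + B + (M + 2) * (n * n * S.e)) + 1) <
      B * n.factorial * (A * n.factorial)) :
    ∃ f ∈ S.V (A + n * n * S.e + q * (B + n * n * S.e)), f ≠ 0 ∧
      (S.s ^ q - S.s) ^ M ∣ S.separant q σ ^ M * f := by
  have h1 : ∀ i : AuxIndex n A B, ∃ a b : ℕ → R,
      (∀ j, S.FrobPair q σ (A + B + 2 * (n * n * S.e) + j * (n * n * S.e)) (a j) (b j)) ∧
      b 0 = S.auxTerm q i ∧
      ∀ j, S.separant q σ * (b j - a j) = (S.s ^ q - S.s) * b (j + 1) := by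
    intro i
    obtain ⟨u, hu⟩ := S.exists_frobPair_auxTerm (q := q) (σ := σ) i
    exact FrobPair.exists_seq S hadd hq hfrob hu
  choose a b hab hb0 hb using h1
  set D := A + B + (M + 2) * (n * n * S.e) with hD
  obtain ⟨L, hL⟩ := (S.isUnramifiedPoint hP).exists_jet (n.factorial * D + 1)
  let Φ : (AuxIndex n A B → k) →ₗ[k] (Fin M → Fin (n.factorial * D + 1) → k) :=
    LinearMap.pi fun j => L ∘ₗ Fintype.linearCombination k fun i => a i j
  obtain ⟨κ, hκ, hκ0⟩ := (Submodule.ne_bot_iff _).1 (LinearMap.ker_ne_bot_of_finrank_lt (f := Φ) (by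
    simpa [Module.finrank_pi_fintype] using hM))
  have hu : ∀ j < M, ∑ i, κ i • a i j = 0 := by
    intro j hj
    by_contra h0
    have hmem : ∑ i, κ i • a i j ∈ S.V D := Submodule.sum_mem _ fun i _ =>
      Submodule.smul_mem _ _ (S.mono (by
        have := Nat.mul_le_mul_right (n * n * S.e) hj.le
        rw [hD, add_mul]; omega) (hab i j).mem)
    have := S.le_of_mem_vanishingIdeal hP hmem h0 (hL _ (by
      simpa [Φ, Fintype.linearCombination_apply] using congrFun hκ ⟨j, hj⟩))
    omega
  refine ⟨∑ i, κ i • S.auxTerm q i, Submodule.sum_mem _ fun i _ =>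
    Submodule.smul_mem _ _ (S.auxTerm_mem i),
    fun h => hκ0 (S.eq_zero_of_sum_auxTerm_eq_zero hadd hq hP hA κ h), ?_⟩
  have key : ∀ j ≤ M, S.separant q σ ^ j * ∑ i, κ i • S.auxTerm q i =
      (S.s ^ q - S.s) ^ j * ∑ i, κ i • b i j := by
    intro j
    induction j with
    | zero => simp [hb0]
    | succ j ih =>
      intro hj
      have h2 : S.separant q σ * ∑ i, κ i • b i j =
          (S.s ^ q - S.s) * ∑ i, κ i • b i (j + 1) := by
        rw [← sub_zero (∑ i, κ i • b i j), ← hu j (by omega), ← Finset.sum_sub_distrib,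
          Finset.mul_sum, Finset.mul_sum]
        refine Finset.sum_congr rfl fun i _ => ?_
        rw [← smul_sub, mul_smul_comm, mul_smul_comm, hb]
      rw [pow_succ', mul_assoc, ih (by omega), mul_left_comm, h2, pow_succ]
      ring
  exact ⟨_, key M le_rfl⟩

include hadd hq hfrob in
/-- A Stepanov-type bound for the number of points over `𝔽_q`-rational values of `s` at which the
Frobenius acts by the permutation `σ`. -/
theorem card_frobenius_type_le (σ : Equiv.Perm (Fin n)) {A B M : ℕ}
    (hA : n.factorial * (A + n * n * S.e) < q)
    (hM : M * (n.factorial * (A + B + (M + 2) * (n * n * S.e)) + 1) <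
      B * n.factorial * (A * n.factorial))
    (T : Finset k) (P : k → R →ₐ[k] k) (hPs : ∀ c ∈ T, P c S.s = c) (hT : ∀ c ∈ T, c ^ q = c)
    (hP : ∀ c ∈ T, Function.Injective fun i => P c (S.x i))
    (W : k → Finset (Equiv.Perm (Fin n)))
    (hW : ∀ c ∈ T, ∀ g ∈ W c, ∀ i, P c (S.x (g i)) ^ q = P c (S.x (g (σ i)))) :
    M * ∑ c ∈ T, (W c).card ≤
      n.factorial * (A + n * n * S.e + q * (B + n * n * S.e)) := by
  classical
  rcases T.eq_empty_or_nonempty with rfl | ⟨c₀, hc₀⟩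
  · simp
  obtain ⟨f, hf, hf0, w, hw⟩ := S.exists_auxiliary hadd hq hfrob σ (hP c₀ hc₀) hA hM
  obtain ⟨ν, hν, hd⟩ := S.exists_norm hf
  have hν0 : ν ≠ 0 := by
    rintro rfl
    rw [map_zero] at hν
    exact S.norm_ne_zero hf0 hν.symm
  have hdvd : ∀ c ∈ T, (X - C c) ^ (M * (W c).card) ∣ ν := by
    intro c hc
    have hU := S.isUnramifiedPoint (hP c hc)
    have hz : S.s - algebraMap k R (P c S.s) = S.s - algebraMap k R c := by rw [hPs c hc]
    refine hU.pow_dvd_of_aeval_mem hz hν0 ?_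
    rw [hν, ← Finset.prod_mul_prod_compl (W c)]
    refine Ideal.mul_mem_right _ _ ?_
    have := prod_mem_vanishingIdeal (P := P c) (z := S.s - algebraMap k R (P c S.s)) (W c)
      (fun _ => M) (fun g => S.act g f) fun g hg => ?_
    · simpa [mul_comm] using this
    refine ⟨S.act g (S.separant q σ) ^ M, ?_, ?_⟩
    · rw [map_pow]
      refine pow_ne_zero _ ?_
      simp only [separant, map_prod, map_sub, map_pow, S.act_x]
      refine Finset.prod_ne_zero_iff.2 fun i _ => Finset.prod_ne_zero_iff.2 fun l hl => ?_
      rw [hW c hc g hg i, sub_ne_zero]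
      intro h
      exact Finset.ne_of_mem_erase hl (g.injective (hP c hc h)).symm
    · have h1 := congrArg (S.act g) hw
      rw [map_mul, map_mul, map_pow, map_pow, map_sub, map_pow, S.act_s] at h1
      rw [h1]
      refine Dvd.dvd.mul_right (pow_dvd_pow_of_dvd ?_ _) _
      have h2 : (X - C c) ∣ (X ^ q - X : k[X]) := by
        rw [dvd_iff_isRoot]; simp [hT c hc]
      have h3 := map_dvd (aeval S.s) h2
      rw [hz]
      simpa using h3
  have hprod : ∏ c ∈ T, (X - C c) ^ (M * (W c).card) ∣ ν := by
    refine Finset.prod_dvd_of_coprime ?_ hdvd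
    intro c _ c' _ hcc
    exact ((pairwise_coprime_X_sub_C Function.injective_id) hcc).pow
  have h4 := natDegree_le_of_dvd hprod hν0
  rw [natDegree_prod_of_monic _ _ fun c _ => (monic_X_sub_C c).pow _] at h4
  simp only [natDegree_pow, natDegree_X_sub_C, mul_one] at h4
  rw [Finset.mul_sum]
  exact h4.trans hd

end SplittingCover

lemma exists_pow_finRotate_apply_eq {n : ℕ} (i j : Fin n) : ∃ r : ℕ, (finRotate n ^ r) i = j := by
  match n with
  | 0 => exact i.elim0
  | 1 => exact ⟨0, Subsingleton.elim _ _⟩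
  | n + 2 =>
    have h : ∀ i : Fin (n + 2), finRotate (n + 2) i ≠ i := fun i => by
      rw [← Equiv.Perm.mem_support, support_finRotate]; exact Finset.mem_univ i
    exact isCycle_finRotate.exists_pow_eq (h i) (h j)

/-- The choice of parameters in Stepanov's method. -/
lemma exists_stepanov_parameters {N C q z t : ℕ} (hN : 0 < N) (hC : 0 < C)
    (hq : 20 * N ^ 4 * C ^ 3 ≤ q) (ht : q ≤ t + z) (hz : N ^ 3 * z < q) :
    ∃ A B M : ℕ, N * (A + C) < q ∧
      M * (N * (A + B + (M + 2) * C) + 1) < B * N * (A * N) ∧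
      (N - 1) * (N * (A + C + q * (B + C))) < M * (N * t) := by
  obtain ⟨b, hb⟩ : ∃ b, b = N * (C + 1) := ⟨_, rfl⟩
  obtain ⟨K, hK⟩ : ∃ K, K = b + 1 + (N * b + 2) * C + 1 := ⟨_, rfl⟩
  have hb2 : b ≤ 2 * (N * C) := by rw [hb]; nlinarith
  have hNC : 1 ≤ N * C := Nat.mul_pos hN hC
  have hK2 : K ≤ 8 * (N * C) ^ 2 := by
    have h1 : N * b ≤ 2 * (N * (N * C)) := by nlinarith
    have h2 : (N * b + 2) * C ≤ 2 * (N * C) ^ 2 + 2 * C := by nlinarith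
    have h3 : C ≤ (N * C) ^ 2 := by nlinarith
    have h4 : N * C ≤ (N * C) ^ 2 := by nlinarith
    rw [hK]; nlinarith
  have hbK : b * K ≤ 16 * (N * C) ^ 3 :=
    (Nat.mul_le_mul hb2 hK2).trans (le_of_eq (by ring))
  have h3 : C ≤ (N * C) ^ 3 := by
    calc C ≤ N * C := by nlinarith
      _ ≤ (N * C) ^ 3 := Nat.le_self_pow (by norm_num) _
  have h1 : 1 ≤ (N * C) ^ 3 := Nat.one_le_pow _ _ hNC
  have hbig : N * (C + b * K + 2) ≤ q := by
    calc N * (C + b * K + 2) ≤ N * (20 * (N * C) ^ 3) := Nat.mul_le_mul_left _ (by omega)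
      _ = 20 * N ^ 4 * C ^ 3 := by ring
      _ ≤ q := hq
  obtain ⟨A, hA⟩ : ∃ A, A = (q - 1) / N - C := ⟨_, rfl⟩
  have hdiv : C + b * K + 1 ≤ (q - 1) / N := by
    rw [Nat.le_div_iff_mul_le hN]
    have : N * (C + b * K + 2) = (C + b * K + 1) * N + N := by ring
    omega
  have hA1 : b * K + 1 ≤ A := by omega
  have hA2 : N * (A + C) < q := by
    have : A + C = (q - 1) / N := by omega
    rw [this]
    have := Nat.mul_div_le (q - 1) N
    have : 0 < q := by
      have : 0 < N * (C + b * K + 2) := by positivity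
      omega
    omega
  refine ⟨A, b + 1, N * b, hA2, ?_, ?_⟩
  · have h5 : N * b * (N * (A + (b + 1) + (N * b + 2) * C) + 1) ≤
        N * (N * (b * A + b * K)) := by
      have : N * (A + (b + 1) + (N * b + 2) * C) + 1 ≤ N * (A + K) := by
        rw [hK]; nlinarith
      calc _ ≤ N * b * (N * (A + K)) := Nat.mul_le_mul_left _ this
        _ = _ := by ring
    refine h5.trans_lt ?_
    calc N * (N * (b * A + b * K)) < N * (N * (b * A + A)) := by gcongr; omega
      _ = _ := by ring
  · obtain ⟨N', rfl⟩ : ∃ N', N = N' + 1 := ⟨N - 1, by omega⟩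
    simp only [Nat.add_sub_cancel]
    set N := N' + 1
    have h6 : N' * (N * (A + C + q * (b + 1 + C))) ≤ N' * (q * (1 + N * (b + 1 + C))) := by
      refine Nat.mul_le_mul_left _ ?_
      calc N * (A + C + q * (b + 1 + C)) = N * (A + C) + q * (N * (b + 1 + C)) := by ring
        _ ≤ q + q * (N * (b + 1 + C)) := by omega
        _ = _ := by ring
    refine h6.trans_lt ?_
    have h7 : N * b * (N * q) ≤ N * b * (N * t) + N ^ 3 * z * (C + 1) := by
      calc N * b * (N * q) ≤ N * b * (N * (t + z)) := by gcongr
        _ = _ := by rw [hb]; ring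
    have h8 : N ^ 3 * z * (C + 1) < q * (C + 1) := by gcongr
    have h9 : N' * (q * (1 + N * (b + 1 + C))) + q * (C + 1) ≤ N * b * (N * q) := by
      have : N' * (1 + N * (b + 1 + C)) + (C + 1) ≤ N * b * N := by
        rw [hb]
        simp only [N]
        ring_nf
        nlinarith [Nat.zero_le (N' * C), Nat.zero_le (N' ^ 2 * C), Nat.zero_le (N' ^ 3 * C)]
      calc _ = q * (N' * (1 + N * (b + 1 + C)) + (C + 1)) := by ring
        _ ≤ q * (N * b * N) := Nat.mul_le_mul_left _ this
        _ = _ := by ring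
    omega

namespace SplittingCover

variable {k R : Type*} [Field k] [CommRing R] [Algebra k R] {n : ℕ}
  (S : SplittingCover k n R) {q : ℕ} [IsDomain R]
  (hadd : ∀ a b : R, (a + b) ^ q = a ^ q + b ^ q)
  (hfrob : ∀ j, aeval S.s (S.G.coeff j) ^ q = aeval (S.s ^ q) (S.G.coeff j))

include hadd hfrob in
/-- If `q` is large, then at some `𝔽_q`-rational value of `s` the Frobenius permutes the roots
transitively. -/
theorem exists_transitive_frobenius {z : ℕ} (hC : 0 < n * n * S.e)
    (hq : 20 * n.factorial ^ 4 * (n * n * S.e) ^ 3 ≤ q) (hz : n.factorial ^ 3 * z < q)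
    (T : Finset k) (hTz : q ≤ T.card + z)
    (P : k → R →ₐ[k] k) (hPs : ∀ c ∈ T, P c S.s = c) (hT : ∀ c ∈ T, c ^ q = c)
    (hP : ∀ c ∈ T, Function.Injective fun i => P c (S.x i))
    (τ : k → Equiv.Perm (Fin n)) (hτ : ∀ c ∈ T, ∀ i, P c (S.x i) ^ q = P c (S.x (τ c i))) :
    ∃ c ∈ T, ∀ i j, ∃ r : ℕ, (τ c ^ r) i = j := by
  classical
  by_contra! hno
  obtain ⟨A, B, M, h1, h2, h3⟩ := exists_stepanov_parameters n.factorial_pos hC hq hTz hz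
  let W : Equiv.Perm (Fin n) → k → Finset (Equiv.Perm (Fin n)) := fun σ c =>
    Finset.univ.filter fun g => g⁻¹ * τ c * g = σ
  have hW : ∀ σ, M * ∑ c ∈ T, (W σ c).card ≤
      n.factorial * (A + n * n * S.e + q * (B + n * n * S.e)) := by
    intro σ
    refine S.card_frobenius_type_le hadd (by omega) hfrob σ h1 h2 T P hPs hT hP (W σ) ?_
    intro c hc g hg i
    have : g⁻¹ * τ c * g = σ := (Finset.mem_filter.1 hg).2
    rw [hτ c hc, ← this]
    simp
  have h0 : ∀ c ∈ T, (W (finRotate n) c).card = 0 := by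
    intro c hc
    rw [Finset.card_eq_zero, Finset.filter_eq_empty_iff]
    intro g _ hg
    obtain ⟨i, j, hij⟩ := hno c hc
    obtain ⟨r, hr⟩ := exists_pow_finRotate_apply_eq (g⁻¹ i) (g⁻¹ j)
    refine hij r ?_
    have h4 : τ c = g * finRotate n * g⁻¹ := by rw [← hg]; group
    rw [h4, conj_pow, Equiv.Perm.mul_apply, Equiv.Perm.mul_apply, hr]
    simp
  have hsum : ∀ c, ∑ σ, (W σ c).card = n.factorial := by
    intro c
    rw [← Finset.card_eq_sum_card_fiberwise (f := fun g => g⁻¹ * τ c * g)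
      (fun _ _ => Finset.mem_coe.2 (Finset.mem_univ _)), Finset.card_univ, Fintype.card_perm,
      Fintype.card_fin]
  have h5 : M * (n.factorial * T.card) =
      ∑ σ ∈ Finset.univ.erase (finRotate n), M * ∑ c ∈ T, (W σ c).card := by
    rw [← Finset.mul_sum]
    congr 1
    rw [← zero_add (∑ σ ∈ _, _), ← Finset.sum_eq_zero h0,
      Finset.add_sum_erase _ (fun σ => ∑ c ∈ T, (W σ c).card) (Finset.mem_univ _),
      Finset.sum_comm, Finset.sum_congr rfl fun c _ => hsum c]
    simp [mul_comm]
  have h6 := Finset.sum_le_card_nsmul (Finset.univ.erase (finRotate n)) _ _ fun σ _ => hW σ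
  rw [← h5, Finset.card_erase_of_mem (Finset.mem_univ _), Finset.card_univ, Fintype.card_perm,
    Fintype.card_fin, smul_eq_mul] at h6
  omega

end SplittingCover

section Monomials

variable {K L : Type*} [Field K] [Field L] [Algebra K L] {n : ℕ}

lemma pow_mem_span_pow_lt {g : K[X]} (hg : g.Monic) {y : L} (hy : aeval y g = 0) (m : ℕ) :
    ∃ c : Fin g.natDegree → K, y ^ m = ∑ b, c b • y ^ (b : ℕ) := by
  refine ⟨fun b => (X ^ m %ₘ g).coeff b, ?_⟩
  have h1 : aeval y (X ^ m %ₘ g) = y ^ m := by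
    have := congrArg (aeval y) (modByMonic_add_div (X ^ m) g)
    rw [map_add, map_mul, hy, zero_mul, add_zero] at this
    rw [this]; simp
  rw [← h1]
  rcases eq_or_ne g.natDegree 0 with h0 | h0
  · have : g = 1 := hg.natDegree_eq_zero.1 h0
    subst this
    simp at hy
  · rw [aeval_eq_sum_range' (n := g.natDegree) (natDegree_modByMonic_lt _ hg
      (fun h => h0 (by rw [h]; simp))), Finset.sum_range]

lemma span_monomials_eq_top {g : K[X]} (hg : g.Monic) (x : Fin n → L)
    (hx : ∀ i, aeval (x i) g = 0) (hgen : Algebra.adjoin K (Set.range x) = ⊤) :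
    Submodule.span K (Set.range fun β : Fin n → Fin g.natDegree => ∏ i, x i ^ (β i : ℕ)) = ⊤ := by
  classical
  rw [eq_top_iff]
  intro y _
  have hy : y ∈ Algebra.adjoin K (Set.range x) := by rw [hgen]; trivial
  rw [Algebra.adjoin_range_eq_range_aeval] at hy
  obtain ⟨p, rfl⟩ := hy
  change MvPolynomial.aeval x p ∈ _
  rw [MvPolynomial.aeval_def, MvPolynomial.eval₂_eq']
  refine Submodule.sum_mem _ fun d _ => ?_
  rw [← Algebra.smul_def]
  refine Submodule.smul_mem _ _ ?_
  choose c hc using fun i m => pow_mem_span_pow_lt hg (hx i) m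
  have : ∏ i ∈ (Finset.univ : Finset (Fin n)), x i ^ d i = ∏ i, ∑ b, c i (d i) b • x i ^ (b : ℕ) :=
    Finset.prod_congr rfl fun i _ => hc i _
  rw [this, Finset.prod_univ_sum]
  refine Submodule.sum_mem _ fun β _ => ?_
  rw [Finset.prod_smul]
  exact Submodule.smul_mem _ _ (Submodule.subset_span ⟨β, rfl⟩)

lemma exists_linearIndependent_monomials [FiniteDimensional K L] {g : K[X]} (hg : g.Monic)
    (x : Fin n → L) (hx : ∀ i, aeval (x i) g = 0)
    (hgen : Algebra.adjoin K (Set.range x) = ⊤) {N : ℕ} (hN : Module.finrank K L = N) :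
    ∃ β : Fin N → Fin n → Fin g.natDegree,
      LinearIndependent K fun α => ∏ i, x i ^ (β α i : ℕ) := by
  obtain ⟨b, hb, hspan, hli⟩ := exists_linearIndependent K
    (Set.range fun β : Fin n → Fin g.natDegree => ∏ i, x i ^ (β i : ℕ))
  rw [span_monomials_eq_top hg x hx hgen] at hspan
  let B : Module.Basis b K L := Module.Basis.mk hli (by simp [hspan])
  have : Fintype b := FiniteDimensional.fintypeBasisIndex B
  have hcard : Fintype.card b = N := by rw [← hN, Module.finrank_eq_card_basis B]
  let f : Fin N ≃ b := (finCongr hcard.symm).trans (Fintype.equivFin b).symm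
  choose β hβ using fun α => hb (f α).2
  refine ⟨β, ?_⟩
  have h1 : (fun α => ∏ i, x i ^ (β α i : ℕ)) = Subtype.val ∘ f := funext fun α => hβ α
  rw [h1]
  exact hli.comp _ f.injective

end Monomials

section GaloisRoots

variable {K L : Type*} [Field K] [Field L] [Algebra K L] {n : ℕ} {g : K[X]} {x : Fin n → L}

lemma isSplittingField_of_map_eq (hg : g.map (algebraMap K L) = ∏ i, (X - C (x i)))
    (hgen : Algebra.adjoin K (Set.range x) = ⊤) : g.IsSplittingField K L := by
  have h0 : g.map (algebraMap K L) ≠ 0 := by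
    rw [hg]; exact Finset.prod_ne_zero_iff.2 fun i _ => X_sub_C_ne_zero _
  refine ⟨?_, ?_⟩
  · rw [hg]; exact Splits.prod fun i _ => Splits.X_sub_C _
  · rw [← hgen]
    congr 1
    ext y
    rw [mem_rootSet', and_iff_right h0, aeval_def, ← eval_map, hg, eval_prod,
      Finset.prod_eq_zero_iff]
    simp [sub_eq_zero, eq_comm]

lemma separable_of_map_eq (hg : g.map (algebraMap K L) = ∏ i, (X - C (x i)))
    (hx : Function.Injective x) : g.Separable := by
  rw [← separable_map (algebraMap K L), hg]
  exact separable_prod_X_sub_C_iff.2 hx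

lemma aeval_root_eq_zero (hg : g.map (algebraMap K L) = ∏ i, (X - C (x i))) (i : Fin n) :
    aeval (x i) g = 0 := by
  rw [aeval_def, ← eval_map, hg, eval_prod]
  exact Finset.prod_eq_zero (Finset.mem_univ i) (by simp)

lemma exists_perm_of_algEquiv (hg : g.map (algebraMap K L) = ∏ i, (X - C (x i)))
    (hx : Function.Injective x) (f : L ≃ₐ[K] L) :
    ∃ σ : Equiv.Perm (Fin n), ∀ i, f (x i) = x (σ i) := by
  have h1 : ∀ i, ∃ j, f (x i) = x j := by
    intro i
    have h2 : aeval (f (x i)) g = 0 := by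
      rw [aeval_algHom_apply f, aeval_root_eq_zero hg, map_zero]
    rw [aeval_def, ← eval_map, hg, eval_prod, Finset.prod_eq_zero_iff] at h2
    obtain ⟨j, _, hj⟩ := h2
    exact ⟨j, by simpa [sub_eq_zero] using hj⟩
  choose s hs using h1
  have hinj : Function.Injective s := fun i j hij => hx (f.injective (by rw [hs, hs, hij]))
  exact ⟨Equiv.ofBijective s (Finite.injective_iff_bijective.1 hinj), hs⟩

lemma algEquiv_ext_of_adjoin (hgen : Algebra.adjoin K (Set.range x) = ⊤) {f f' : L ≃ₐ[K] L}
    (h : ∀ i, f (x i) = f' (x i)) : f = f' := by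
  have : (f : L →ₐ[K] L) = f' := AlgHom.ext_of_adjoin_eq_top hgen (by rintro _ ⟨i, rfl⟩; exact h i)
  ext y
  exact DFunLike.congr_fun this y

/-- The symmetric group acting through the Galois group. -/
lemma exists_perm_hom (hgen : Algebra.adjoin K (Set.range x) = ⊤)
    (hgal : ∀ σ : Equiv.Perm (Fin n), ∃ f : L ≃ₐ[K] L, ∀ i, f (x i) = x (σ i)) :
    ∃ ρ : Equiv.Perm (Fin n) →* (L ≃ₐ[K] L), ∀ σ i, ρ σ (x i) = x (σ i) := by
  choose f hf using hgal
  refine ⟨⟨⟨f, ?_⟩, ?_⟩, hf⟩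
  · exact algEquiv_ext_of_adjoin hgen fun i => by simp [hf]
  · intro σ τ
    exact algEquiv_ext_of_adjoin hgen fun i => by simp [hf]

lemma finrank_eq_factorial (hg : g.map (algebraMap K L) = ∏ i, (X - C (x i)))
    (hx : Function.Injective x) (hgen : Algebra.adjoin K (Set.range x) = ⊤)
    {ρ : Equiv.Perm (Fin n) →* (L ≃ₐ[K] L)} (hρ : ∀ σ i, ρ σ (x i) = x (σ i)) :
    Function.Surjective ρ ∧ FiniteDimensional K L ∧ IsGalois K L ∧
      Module.finrank K L = n.factorial := by
  have hspl := isSplittingField_of_map_eq hg hgen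
  have hfin : FiniteDimensional K L := IsSplittingField.finiteDimensional L g
  have hgal : IsGalois K L := IsGalois.of_separable_splitting_field (separable_of_map_eq hg hx)
  have hsurj : Function.Surjective ρ := by
    intro f
    obtain ⟨σ, hσ⟩ := exists_perm_of_algEquiv hg hx f
    exact ⟨σ, algEquiv_ext_of_adjoin hgen fun i => by rw [hρ, hσ]⟩
  have hinj : Function.Injective ρ := by
    intro σ τ h
    ext i
    rw [hx (((hρ σ i).symm.trans (by rw [h])).trans (hρ τ i))]
  refine ⟨hsurj, hfin, hgal, ?_⟩
  rw [← IsGalois.card_aut_eq_finrank, ← Nat.card_congr (Equiv.ofBijective ρ ⟨hinj, hsurj⟩),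
    Nat.card_eq_fintype_card, Fintype.card_perm, Fintype.card_fin]

end GaloisRoots

/-- A local ring of `k(s)` at infinity: an integrally closed subring of `k(s)` in which `g / s ^ d`
lies exactly when `deg g ≤ d`. -/
structure IsRingAtInfinity {k K : Type*} [Field k] [Field K] [Algebra k[X] K] (B : Subring K) :
    Prop where
  mem_of_isIntegral : ∀ y : K, IsIntegral B y → y ∈ B
  div_mem_iff : ∀ (g : k[X]) (d : ℕ),
    algebraMap k[X] K g / algebraMap k[X] K X ^ d ∈ B ↔ g.natDegree ≤ d

section PoleFiltration

variable {k K L : Type*} [Field k] [Field K] [Field L] [Algebra k[X] K] [Algebra K L]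
  [Algebra k[X] L] [IsScalarTower k[X] K L] {B : Subring K}

lemma IsRingAtInfinity.isIntegral (hB : IsRingAtInfinity (k := k) B) {g : k[X]} {d : ℕ}
    (h : g.natDegree ≤ d) :
    IsIntegral B (algebraMap k[X] L g * (algebraMap k[X] L X ^ d)⁻¹) := by
  have h1 := (hB.div_mem_iff g d).2 h
  have h2 : algebraMap k[X] L g * (algebraMap k[X] L X ^ d)⁻¹ =
      algebraMap B L ⟨_, h1⟩ := by
    change _ = algebraMap K L (algebraMap k[X] K g / algebraMap k[X] K X ^ d)
    rw [map_div₀, map_pow, ← IsScalarTower.algebraMap_apply, ← IsScalarTower.algebraMap_apply,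
      div_eq_mul_inv]
  rw [h2]
  exact isIntegral_algebraMap

/-- The elements of `L` with a pole of order at most `d` at infinity. -/
def poleFiltration (hB : IsRingAtInfinity (k := k) B) (L : Type*) [Field L] [Algebra K L]
    [Algebra k[X] L] [IsScalarTower k[X] K L] [Algebra k L] [IsScalarTower k k[X] L] (d : ℕ) :
    Submodule k L where
  carrier := {y | IsIntegral B (y * (algebraMap k[X] L X ^ d)⁻¹)}
  zero_mem' := by simpa using isIntegral_zero
  add_mem' := by
    intro a b ha hb
    change IsIntegral B _
    rw [add_mul]
    exact IsIntegral.add ha hb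
  smul_mem' := by
    intro c a ha
    change IsIntegral B _
    have := (hB.isIntegral (L := L) (g := C c) (d := 0) (by simp)).mul ha
    rw [pow_zero, inv_one, mul_one, ← mul_assoc] at this
    rwa [Algebra.smul_def, IsScalarTower.algebraMap_apply k k[X] L]

variable [Algebra k L] [IsScalarTower k k[X] L] (hB : IsRingAtInfinity (k := k) B)

lemma mem_poleFiltration {d : ℕ} {y : L} :
    y ∈ poleFiltration hB L d ↔ IsIntegral B (y * (algebraMap k[X] L X ^ d)⁻¹) := Iff.rfl

lemma algebraMap_mem_poleFiltration {g : k[X]} {d : ℕ} (h : g.natDegree ≤ d) :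
    algebraMap k[X] L g ∈ poleFiltration hB L d := hB.isIntegral h

lemma mul_mem_poleFiltration {a b : ℕ} {y y' : L} (h : y ∈ poleFiltration hB L a)
    (h' : y' ∈ poleFiltration hB L b) : y * y' ∈ poleFiltration hB L (a + b) := by
  rw [mem_poleFiltration] at *
  have h1 : y * y' * (algebraMap k[X] L X ^ (a + b))⁻¹ =
      y * (algebraMap k[X] L X ^ a)⁻¹ * (y' * (algebraMap k[X] L X ^ b)⁻¹) := by
    rw [pow_add, mul_inv]
    ring
  rw [h1]
  exact h.mul h'

lemma poleFiltration_mono : Monotone (poleFiltration hB L) := by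
  intro a b hab y hy
  rw [mem_poleFiltration] at *
  obtain ⟨c, rfl⟩ := Nat.exists_eq_add_of_le hab
  have h1 : y * (algebraMap k[X] L X ^ (a + c))⁻¹ =
      y * (algebraMap k[X] L X ^ a)⁻¹ * (algebraMap k[X] L 1 * (algebraMap k[X] L X ^ c)⁻¹) := by
    rw [pow_add, mul_inv, map_one]
    ring
  rw [h1]
  exact hy.mul (hB.isIntegral (by simp))

lemma algEquiv_mem_poleFiltration {d : ℕ} {y : L} (h : y ∈ poleFiltration hB L d)
    (f : L ≃ₐ[K] L) : f y ∈ poleFiltration hB L d := by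
  rw [mem_poleFiltration] at *
  have := IsIntegral.map (f.toAlgHom.restrictScalars B) h
  simpa [IsScalarTower.algebraMap_apply k[X] K L] using this

lemma root_mem_poleFiltration [IsFractionRing k[X] K] {G : k[X][X]} (hG : G.Monic) {e : ℕ}
    (hdeg : ∀ j ≤ G.natDegree, (G.coeff j).natDegree + j * e ≤ G.natDegree * e) {y : L}
    (hy : aeval y G = 0) : y ∈ poleFiltration hB L e := by
  set c : K := (algebraMap k[X] K X ^ e)⁻¹ with hc
  set g : K[X] := G.map (algebraMap k[X] K) with hg
  have hgm : g.Monic := hG.map _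
  have hgd : g.natDegree = G.natDegree := hG.natDegree_map _
  have h1 : ((g.scaleRoots c).coeffs : Set K) ⊆ B := by
    intro z hz
    obtain ⟨j, hj, rfl⟩ := mem_coeffs_iff.1 (Finset.mem_coe.1 hz)
    have hj' : j ≤ G.natDegree := by
      rw [← hgd, ← natDegree_scaleRoots g c]
      exact le_natDegree_of_mem_supp _ hj
    rw [coeff_scaleRoots, hgd, hg, coeff_map, hc, inv_pow, ← pow_mul, ← div_eq_mul_inv]
    refine (hB.div_mem_iff _ _).2 ?_
    have := hdeg j hj'
    rw [Nat.mul_sub, mul_comm e, mul_comm e]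
    omega
  have h2 : aeval (algebraMap K L c * y) (g.scaleRoots c) = 0 := by
    refine scaleRoots_aeval_eq_zero ?_
    rw [hg, aeval_map_algebraMap, hy]
  rw [mem_poleFiltration]
  refine ⟨(g.scaleRoots c).toSubring B h1, ?_, ?_⟩
  · rw [monic_toSubring]
    exact (monic_scaleRoots_iff c).2 hgm
  · have h3 : y * (algebraMap k[X] L X ^ e)⁻¹ = algebraMap K L c * y := by
      rw [hc, map_inv₀, map_pow, ← IsScalarTower.algebraMap_apply, mul_comm]
    rw [h3, ← h2, aeval_def]
    conv_rhs => rw [← map_toSubring (g.scaleRoots c) B h1, eval₂_map]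
    rfl

lemma exists_polynomial_of_mem_poleFiltration [IsFractionRing k[X] K] {d : ℕ} {y : L}
    (h : y ∈ poleFiltration hB L d) (hrint : IsIntegral k[X] y)
    (hy : y ∈ Set.range (algebraMap K L)) :
    ∃ ν : k[X], algebraMap k[X] L ν = y ∧ ν.natDegree ≤ d := by
  obtain ⟨w, rfl⟩ := hy
  have h1 : IsIntegral k[X] w := (isIntegral_algebraMap_iff (algebraMap K L).injective).1 hrint
  obtain ⟨ν, rfl⟩ := IsIntegrallyClosed.algebraMap_eq_of_integral h1
  refine ⟨ν, IsScalarTower.algebraMap_apply _ _ _ _, ?_⟩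
  rw [← hB.div_mem_iff]
  refine hB.mem_of_isIntegral _ ?_
  rw [mem_poleFiltration] at h
  have h2 : algebraMap K L (algebraMap k[X] K ν) * (algebraMap k[X] L X ^ d)⁻¹ =
      algebraMap K L (algebraMap k[X] K ν / algebraMap k[X] K X ^ d) := by
    rw [map_div₀, map_pow, ← IsScalarTower.algebraMap_apply, div_eq_mul_inv,
      ← IsScalarTower.algebraMap_apply]
  rw [h2] at h
  exact (isIntegral_algebraMap_iff (algebraMap K L).injective).1 h

end PoleFiltration

section AdjoinAction

variable {k L : Type*} [Field k] [Field L] [Algebra k L] {n : ℕ} (s : L) (x : Fin n → L)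

/-- The subalgebra generated by a parameter and by the roots. -/
abbrev rootAlgebra : Subalgebra k L := Algebra.adjoin k (insert s (Set.range x))

variable {s x}

lemma map_mem_rootAlgebra {f : L →ₐ[k] L} (hs : f s = s) {σ : Fin n → Fin n}
    (hf : ∀ i, f (x i) = x (σ i)) (r : rootAlgebra (k := k) s x) :
    f r ∈ rootAlgebra (k := k) s x := by
  have h : (rootAlgebra (k := k) s x).map f ≤ rootAlgebra (k := k) s x := by
    rw [AlgHom.map_adjoin]
    refine Algebra.adjoin_mono ?_
    rintro _ ⟨y, rfl | ⟨i, rfl⟩, rfl⟩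
    · exact Or.inl hs
    · exact Or.inr ⟨σ i, (hf i).symm⟩
  exact h ⟨r, r.2, rfl⟩

lemma linearIndependent_of_algHom {R : Type*} [CommRing R] [Algebra k R] (v : R →ₐ[k] L) {s : R}
    {x : Fin n → R} {s' : L} {x' : Fin n → L} (hs : v s = s') (hx : ∀ i, v (x i) = x' i)
    {ι : Type*} {p : ι → ℕ} {q : ι → Fin n → ℕ}
    (h : LinearIndependent k fun i => s' ^ p i * ∏ j, x' j ^ q i j) :
    LinearIndependent k fun i => s ^ p i * ∏ j, x j ^ q i j := by
  obtain rfl := hs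
  obtain rfl : (fun i => v (x i)) = x' := funext hx
  refine LinearIndependent.of_comp v.toLinearMap ?_
  convert h using 2 with i
  simp

/-- The restriction to `rootAlgebra s x` of an action of the symmetric group permuting the `x i`. -/
def permAction (φ : Equiv.Perm (Fin n) →* (L ≃ₐ[k] L)) (hs : ∀ σ, φ σ s = s)
    (hx : ∀ σ i, φ σ (x i) = x (σ i)) :
    Equiv.Perm (Fin n) →* (rootAlgebra (k := k) s x ≃ₐ[k] rootAlgebra (k := k) s x) :=
  let f : ∀ σ, rootAlgebra (k := k) s x →ₐ[k] rootAlgebra (k := k) s x := fun σ =>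
    ((φ σ).toAlgHom.comp (rootAlgebra (k := k) s x).val).codRestrict _
      (map_mem_rootAlgebra (f := (φ σ).toAlgHom) (hs σ) (hx σ))
  have hf : ∀ σ τ r, f σ (f τ r) = f (σ * τ) r := fun σ τ r => by
    ext1
    change φ σ (φ τ r) = φ (σ * τ) r
    rw [map_mul]; rfl
  have h1 : ∀ r, f 1 r = r := fun r => by
    ext1
    change φ 1 r = r
    rw [map_one]; rfl
  { toFun := fun σ => AlgEquiv.ofAlgHom (f σ) (f σ⁻¹)
      (by ext1 r; exact (hf _ _ r).trans (by rw [mul_inv_cancel, h1]; rfl))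
      (by ext1 r; exact (hf _ _ r).trans (by rw [inv_mul_cancel, h1]; rfl))
    map_one' := by ext1 r; exact h1 r
    map_mul' := fun σ τ => by ext1 r; exact (hf σ τ r).symm }

end AdjoinAction

section Build

variable {k K L : Type*} [Field k] [Field K] [Field L] [Algebra k[X] K] [IsFractionRing k[X] K]
  [Algebra K L] [Algebra k[X] L] [IsScalarTower k[X] K L] [Algebra k L] [IsScalarTower k k[X] L]
  {B : Subring K} {n : ℕ}

lemma linearIndependent_pow_mul {N : ℕ} {m : Fin N → L} (hm : LinearIndependent K m) :
    LinearIndependent k fun p : ℕ × Fin N => algebraMap k[X] L X ^ p.1 * m p.2 := by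
  let _ : Algebra k K := ((algebraMap k[X] K).comp C).toAlgebra
  have : IsScalarTower k k[X] K := .of_algebraMap_eq' rfl
  have : IsScalarTower k K L := .of_algebraMap_eq fun c => by
    rw [IsScalarTower.algebraMap_apply k k[X] L, IsScalarTower.algebraMap_apply k[X] K L]
    rfl
  have h1 : LinearIndependent k fun j : ℕ => algebraMap k[X] K X ^ j := by
    have h2 : LinearIndependent k fun j : ℕ => (X ^ j : k[X]) := by
      simpa [X_pow_eq_monomial] using (basisMonomials k).linearIndependent
    have h3 := h2.map' (IsScalarTower.toAlgHom k k[X] K).toLinearMap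
      (LinearMap.ker_eq_bot.2 (IsFractionRing.injective k[X] K))
    have h4 : (fun j : ℕ => algebraMap k[X] K X ^ j) =
        (IsScalarTower.toAlgHom k k[X] K).toLinearMap ∘ fun j => X ^ j := by
      ext1 j
      exact (map_pow (algebraMap k[X] K) X j).symm
    rwa [h4]
  have h5 : (fun p : ℕ × Fin N => algebraMap k[X] L X ^ p.1 * m p.2) =
      fun p : ℕ × Fin N => algebraMap k[X] K X ^ p.1 • m p.2 := by
    ext1 p
    rw [Algebra.smul_def, map_pow, ← IsScalarTower.algebraMap_apply]
  rw [h5]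
  exact linearIndependent_smul h1 hm

set_option maxHeartbeats 400000 in
theorem exists_splittingCover (hB : IsRingAtInfinity (k := k) B) {G : k[X][X]} (hG : G.Monic)
    (hn : G.natDegree = n) {e : ℕ}
    (hdeg : ∀ j ≤ n, (G.coeff j).natDegree + j * e ≤ n * e) {x : Fin n → L}
    (hx : G.map (algebraMap k[X] L) = ∏ i, (X - C (x i)))
    (hgen : Algebra.adjoin K (Set.range x) = ⊤)
    (hgal : ∀ σ : Equiv.Perm (Fin n), ∃ f : L ≃ₐ[K] L, ∀ i, f (x i) = x (σ i))
    (hinj : Function.Injective x) :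
    ∃ S : SplittingCover k n (rootAlgebra (k := k) (algebraMap k[X] L X) x),
      S.G = G ∧ S.e = e ∧ Function.Injective S.x := by
  have hgx : (G.map (algebraMap k[X] K)).map (algebraMap K L) = ∏ i, (X - C (x i)) := by
    rw [map_map, ← IsScalarTower.algebraMap_eq, hx]
  obtain ⟨ρ, hρ⟩ := exists_perm_hom hgen hgal
  obtain ⟨hsurj, _, _, hN⟩ := finrank_eq_factorial hgx hinj hgen hρ
  have hroot : ∀ i, aeval (x i) G = 0 := fun i => by
    have := congrArg (eval (x i)) hx
    rwa [eval_prod, Finset.prod_eq_zero (Finset.mem_univ i) (by simp), eval_map_algebraMap] at this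
  have hgd : (G.map (algebraMap k[X] K)).natDegree = n := by rw [hG.natDegree_map, hn]
  obtain ⟨β, hβ⟩ := exists_linearIndependent_monomials (hG.map (algebraMap k[X] K)) x
    (fun i => by rw [aeval_map_algebraMap, hroot]) hgen hN
  have hs : ∀ (f : L ≃ₐ[K] L) (g : k[X]), f (algebraMap k[X] L g) = algebraMap k[X] L g :=
    fun f g => by rw [IsScalarTower.algebraMap_apply k[X] K L, AlgEquiv.commutes]
  let φ : Equiv.Perm (Fin n) →* (L ≃ₐ[k] L) :=
    { toFun := fun σ => AlgEquiv.ofRingEquiv (f := (ρ σ).toRingEquiv) fun c => by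
        rw [IsScalarTower.algebraMap_apply k k[X] L]
        exact hs _ _
      map_one' := by ext y; change ρ 1 y = y; rw [map_one]; rfl
      map_mul' := fun σ τ => by ext y; change ρ (σ * τ) y = ρ σ (ρ τ y); rw [map_mul]; rfl }
  have hφ : ∀ σ y, φ σ y = ρ σ y := fun _ _ => rfl
  let R := rootAlgebra (k := k) (algebraMap k[X] L X) x
  have hsm : algebraMap k[X] L X ∈ R := Algebra.subset_adjoin (Set.mem_insert _ _)
  have hxm : ∀ i, x i ∈ R := fun i => Algebra.subset_adjoin (Set.mem_insert_of_mem _ ⟨i, rfl⟩)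
  have hae : ∀ g : k[X], ((aeval (⟨_, hsm⟩ : R) g : R) : L) = algebraMap k[X] L g := fun g => by
    change R.val _ = _
    rw [← aeval_algHom_apply]
    change aeval (algebraMap k[X] L X) g = _
    rw [aeval_algebraMap_apply, aeval_X_left_apply]
  have hrint : ∀ r : R, IsIntegral k[X] (r : L) := by
    intro r
    have : R ≤ (integralClosure k[X] L).restrictScalars k := by
      refine Algebra.adjoin_le ?_
      rintro y (rfl | ⟨i, rfl⟩)
      · exact isIntegral_algebraMap
      · exact ⟨G, hG, hroot i⟩
    exact this r.2
  refine ⟨{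
    s := ⟨_, hsm⟩
    x := fun i => ⟨x i, hxm i⟩
    G := G
    e := e
    V := fun d => (poleFiltration hB L d).comap R.val.toLinearMap
    act := permAction φ (fun σ => hs _ _) hρ
    adjoin_eq_top := ?_
    one_mem := ?_
    mul_mem := fun h h' => mul_mem_poleFiltration hB h h'
    mono := fun a b h => Submodule.comap_mono (poleFiltration_mono hB h)
    s_mem := algebraMap_mem_poleFiltration hB natDegree_X_le
    x_mem := fun i => root_mem_poleFiltration hB hG (by rwa [hn]) (hroot i)
    act_mem := fun σ _ _ h => algEquiv_mem_poleFiltration hB h (ρ σ)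
    act_s := fun σ => Subtype.ext (hs _ _)
    act_x := fun σ i => Subtype.ext (hρ σ i)
    exists_of_invariant := ?_
    aeval_injective := ?_
    map_G := ?_
    natDegree_coeff := hdeg
    expo := fun α i => β α i
    expo_lt := fun α i => (β α i).2.trans_eq hgd
    linearIndependent := ?_ }, rfl, rfl, fun i j h => hinj (congrArg Subtype.val h)⟩
  · have := Algebra.adjoin_adjoin_coe_preimage (R := k)
      (s := insert (algebraMap k[X] L X) (Set.range x))
    rw [← this]
    congr 1
    ext y
    simp [Subtype.ext_iff, eq_comm]
  · have := algebraMap_mem_poleFiltration (L := L) hB (g := 1) (d := 0) (by simp)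
    rwa [map_one] at this
  · intro d r hr hinv
    obtain ⟨ν, h1, h2⟩ := exists_polynomial_of_mem_poleFiltration hB hr (hrint r) (by
      refine (IsGalois.mem_range_algebraMap_iff_fixed _).2 fun f => ?_
      obtain ⟨σ, rfl⟩ := hsurj f
      exact congrArg Subtype.val (hinv σ))
    exact ⟨ν, Subtype.ext ((hae ν).trans h1), h2⟩
  · intro a b h
    have := congrArg Subtype.val h
    rw [hae, hae, IsScalarTower.algebraMap_apply k[X] K L,
      IsScalarTower.algebraMap_apply k[X] K L] at this
    exact IsFractionRing.injective k[X] K ((algebraMap K L).injective this)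
  · refine map_injective R.val.toRingHom Subtype.val_injective ?_
    rw [map_map, Polynomial.map_prod]
    simp only [Polynomial.map_sub, map_X, map_C]
    refine Eq.trans ?_ hx
    congr 1
    exact RingHom.ext hae
  · have h1 := linearIndependent_pow_mul (k := k) hβ
    have h2 : R.val ⟨_, hsm⟩ = algebraMap k[X] L X := rfl
    have h3 : ∀ i, R.val ⟨x i, hxm i⟩ = x i := fun _ => rfl
    exact linearIndependent_of_algHom R.val h2 h3 h1

end Build

open scoped Classical in
lemma isRingAtInfinity_ratFunc (k : Type*) [Field k] :
    IsRingAtInfinity (k := k) (RatFunc.inftyValuation k).integer where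
  mem_of_isIntegral _ h :=
    (Valuation.integer.integers (RatFunc.inftyValuation k)).mem_of_integral h
  div_mem_iff g d := by
    change RatFunc.inftyValuation k _ ≤ 1 ↔ _
    rcases eq_or_ne g 0 with rfl | hg
    · simp
    have hv : ∀ y, RatFunc.inftyValuation k y = RatFunc.inftyValuationDef k y := fun _ => rfl
    rw [map_div₀, map_pow, hv, hv, RatFunc.inftyValuation.polynomial k hg,
      RatFunc.inftyValuation.polynomial k X_ne_zero, natDegree_X, ← WithZero.exp_nsmul,
      div_le_one₀ (by simp), WithZero.exp_le_exp]
    simp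

namespace SplittingCover

variable {k R : Type*} [Field k] [CommRing R] [Algebra k R] {n : ℕ}
  (S : SplittingCover k n R)

lemma not_isUnit_s_sub (c : k) : ¬ IsUnit (S.s - algebraMap k R c) := by
  intro h
  obtain ⟨y, hy⟩ := h.exists_right_inv
  obtain ⟨d, hd⟩ := S.exists_mem y
  obtain ⟨ν, hν, -⟩ := S.exists_norm hd
  have h1 : aeval S.s ((X - C c) ^ n.factorial * ν) = 1 := by
    have h2 : ∏ σ, S.act σ (S.s - algebraMap k R c) = (S.s - algebraMap k R c) ^ n.factorial := by
      simp [S.act_s, Fintype.card_perm]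
    rw [map_mul, hν, map_pow, map_sub, aeval_X, aeval_C, ← h2, ← Finset.prod_mul_distrib]
    simp only [← map_mul, hy, map_one, Finset.prod_const_one]
  rw [← map_one (aeval S.s : k[X] →ₐ[k] R)] at h1
  have h3 := IsUnit.of_mul_eq_one _ (S.aeval_injective h1)
  rw [isUnit_pow_iff (Nat.factorial_ne_zero n)] at h3
  exact not_isUnit_X_sub_C c h3

lemma finiteType (S : SplittingCover k n R) : Algebra.FiniteType k R := by
  refine ⟨⟨(Set.toFinite (insert S.s (Set.range S.x))).toFinset, ?_⟩⟩
  rw [Set.Finite.coe_toFinset, S.adjoin_eq_top]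

lemma exists_point [IsAlgClosed k] (c : k) : ∃ P : R →ₐ[k] k, P S.s = c := by
  obtain ⟨M, hM, hc⟩ := exists_max_ideal_of_mem_nonunits (S.not_isUnit_s_sub c)
  have := S.finiteType
  let _ := Ideal.Quotient.field M
  have : Module.Finite k (R ⧸ M) := finite_of_finite_type_of_isJacobsonRing k (R ⧸ M)
  have hb := IsAlgClosed.algebraMap_bijective_of_isIntegral (k := k) (K := R ⧸ M)
  let f : k ≃ₐ[k] R ⧸ M := AlgEquiv.ofBijective (Algebra.ofId k (R ⧸ M)) hb
  refine ⟨f.symm.toAlgHom.comp (Ideal.Quotient.mkₐ k M), ?_⟩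
  change f.symm (Ideal.Quotient.mk M S.s) = c
  rw [AlgEquiv.symm_apply_eq]
  change _ = algebraMap k (R ⧸ M) c
  rw [← sub_eq_zero]
  exact Ideal.Quotient.eq_zero_iff_mem.2 hc

/-- Away from the zeros of the discriminant the conjugates stay distinct at every point. -/
lemma exists_discriminant [IsDomain R] (hx : Function.Injective S.x) : ∃ ν : k[X], ν ≠ 0 ∧
    ν.natDegree ≤ n * n * (2 * S.e) ∧
    ∀ P : R →ₐ[k] k, ν.eval (P S.s) ≠ 0 → Function.Injective fun i => P (S.x i) := by
  set T : Finset (Fin n × Fin n) := Finset.univ.offDiag with hT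
  have hV : ∏ p ∈ T, (S.x p.1 - S.x p.2) ∈ S.V (T.card * S.e) := by
    have := S.prod_mem T (fun _ => S.e) (fun p => S.x p.1 - S.x p.2)
      fun p _ => (S.V _).sub_mem (S.x_mem _) (S.x_mem _)
    simpa using this
  obtain ⟨ν, hν, hd⟩ := S.exists_of_invariant hV fun σ => by
    rw [map_prod]
    refine Finset.prod_equiv (σ.prodCongr σ) (fun p => ?_) fun p _ => ?_
    · simp [hT]
    · simp [S.act_x]
  refine ⟨ν, ?_, hd.trans ?_, fun P hP i j hij => ?_⟩
  · rintro rfl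
    rw [map_zero, eq_comm, Finset.prod_eq_zero_iff] at hν
    obtain ⟨p, hp, h⟩ := hν
    exact (Finset.mem_offDiag.1 hp).2.2 (hx (sub_eq_zero.1 h))
  · have : T.card ≤ n * n := by
      rw [hT, Finset.offDiag_card]; simp
    nlinarith [Nat.mul_le_mul_right S.e this]
  · by_contra h
    refine hP ?_
    have h1 := congrArg P hν
    rw [← aeval_algHom_apply, map_prod, Finset.prod_eq_zero (i := (i, j))] at h1
    · exact h1
    · simp [hT, h]
    · simp only at hij
      simp [hij]

end SplittingCover

section Frobenius

variable {Fq : Type*} [Field Fq] [Fintype Fq]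

lemma FiniteField.add_pow_card {R : Type*} [CommRing R] [Nontrivial R] [Algebra Fq R] (a b : R) :
    (a + b) ^ Fintype.card Fq = a ^ Fintype.card Fq + b ^ Fintype.card Fq := by
  obtain ⟨p, _⟩ := CharP.exists Fq
  obtain ⟨m, hp, hm⟩ := FiniteField.card Fq p
  have := Fact.mk hp
  have := charP_of_injective_algebraMap (algebraMap Fq R).injective p
  rw [hm, add_pow_char_pow]

lemma FiniteField.aeval_pow_card {R : Type*} [CommRing R] [Nontrivial R] [Algebra Fq R] (a : R)
    (g : Fq[X]) : aeval a g ^ Fintype.card Fq = aeval (a ^ Fintype.card Fq) g := by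
  induction g using Polynomial.induction_on' with
  | add f g hf hg => rw [map_add, map_add, FiniteField.add_pow_card, hf, hg]
  | monomial i c =>
    rw [aeval_monomial, aeval_monomial, mul_pow, ← map_pow, FiniteField.pow_card, ← pow_mul,
      ← pow_mul, mul_comm i]

variable {k : Type*} [Field k] [Algebra Fq k]

lemma FiniteField.aeval_pow_card_pow (a : k) (g : Fq[X]) (r : ℕ) :
    aeval (a ^ Fintype.card Fq ^ r) g = aeval a g ^ Fintype.card Fq ^ r := by
  induction r with
  | zero => simp
  | succ r ih => rw [pow_succ, pow_mul, pow_mul, ← ih, FiniteField.aeval_pow_card]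

/-- A polynomial whose roots are distinct and permuted transitively by Frobenius is irreducible. -/
lemma irreducible_of_transitive_frobenius [IsAlgClosed k] {n : ℕ} (hn : 0 < n) {f : Fq[X]}
    {ρ : Fin n → k} (hf : f.map (algebraMap Fq k) = ∏ i, (X - C (ρ i)))
    (hρ : Function.Injective ρ) (htr : ∀ i j, ∃ r : ℕ, ρ i ^ Fintype.card Fq ^ r = ρ j) :
    Irreducible f := by
  have hfd : f.natDegree = n := by
    rw [← natDegree_map (algebraMap Fq k), hf, natDegree_prod_of_monic _ _
      fun i _ => monic_X_sub_C _]
    simp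
  have hf0 : f ≠ 0 := by rintro rfl; simp at hfd; omega
  obtain ⟨g, hg, hgf⟩ := WfDvdMonoid.exists_irreducible_factor
    (not_isUnit_of_natDegree_pos f (by omega)) hf0
  obtain ⟨a, ha⟩ := IsAlgClosed.exists_aeval_eq_zero k g (degree_ne_of_natDegree_ne
    (natDegree_pos_iff_degree_pos.2 (degree_pos_of_irreducible hg)).ne')
  obtain ⟨i, hi⟩ : ∃ i, a = ρ i := by
    have h1 := congrArg (eval a) hf
    obtain ⟨w, rfl⟩ := hgf
    rw [eval_map_algebraMap, map_mul, ha, zero_mul, eval_prod, eq_comm,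
      Finset.prod_eq_zero_iff] at h1
    obtain ⟨i, -, hi⟩ := h1
    exact ⟨i, by simpa [sub_eq_zero] using hi⟩
  have hdvd : f.map (algebraMap Fq k) ∣ g.map (algebraMap Fq k) := by
    rw [hf]
    refine Finset.prod_dvd_of_coprime (fun a _ b _ hab => ?_) fun j _ => ?_
    · exact isCoprime_X_sub_C_of_isUnit_sub (sub_ne_zero.2 fun h => hab (hρ h)).isUnit
    · obtain ⟨r, hr⟩ := htr i j
      rw [dvd_iff_isRoot, IsRoot.def, eval_map_algebraMap, ← hr,
        FiniteField.aeval_pow_card_pow, ← hi, ha, zero_pow (pow_ne_zero _ Fintype.card_ne_zero)]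
  have hdvd' : f ∣ g := (map_dvd_map' (algebraMap Fq k)).1 hdvd
  exact (associated_of_dvd_dvd hdvd' hgf).irreducible_iff.2 hg

end Frobenius

namespace SplittingCover

variable {Fq : Type*} [Field Fq] [Fintype Fq] {k R : Type*} [Field k]
  [Algebra Fq k] [CommRing R] [Algebra k R] {n : ℕ} (S : SplittingCover k n R)

lemma exists_frobenius_perm {G : Fq[X][X]} (hG : S.G = G.map (mapRingHom (algebraMap Fq k)))
    {P : R →ₐ[k] k} {c : Fq} (hc : P S.s = algebraMap Fq k c)
    (hP : Function.Injective fun i => P (S.x i)) :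
    (G.map (evalRingHom c)).map (algebraMap Fq k) = ∏ i, (X - C (P (S.x i))) ∧
    ∃ τ : Equiv.Perm (Fin n), ∀ i, P (S.x i) ^ Fintype.card Fq = P (S.x (τ i)) := by
  have h1 : (G.map (evalRingHom c)).map (algebraMap Fq k) = ∏ i, (X - C (P (S.x i))) := by
    have h2 := congrArg (map P.toRingHom) S.map_G
    rw [map_map, Polynomial.map_prod, hG, map_map] at h2
    simp only [Polynomial.map_sub, map_X, map_C] at h2
    rw [map_map]
    refine Eq.trans ?_ h2
    congr 1
    refine Polynomial.ringHom_ext (fun a => ?_) ?_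
    · simp
    · simp [hc]
  refine ⟨h1, ?_⟩
  have h2 : ∀ i, ∃ j, P (S.x i) ^ Fintype.card Fq = P (S.x j) := by
    intro i
    have h3 : aeval (P (S.x i)) (G.map (evalRingHom c)) = 0 := by
      rw [← eval_map_algebraMap, h1, eval_prod, Finset.prod_eq_zero (Finset.mem_univ i) (by simp)]
    have h4 := FiniteField.aeval_pow_card (P (S.x i)) (G.map (evalRingHom c))
    rw [h3, zero_pow Fintype.card_ne_zero, ← eval_map_algebraMap, h1, eval_prod, eq_comm,
      Finset.prod_eq_zero_iff] at h4
    obtain ⟨j, -, hj⟩ := h4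
    exact ⟨j, by simpa [sub_eq_zero] using hj⟩
  choose τ hτ using h2
  have hinj : Function.Injective τ := by
    intro i j h
    refine hP ?_
    have h3 := hτ i
    rw [h, ← hτ j] at h3
    have h4 := FiniteField.add_pow_card (Fq := Fq) (P (S.x i) - P (S.x j)) (P (S.x j))
    rw [sub_add_cancel, h3, right_eq_add] at h4
    exact sub_eq_zero.1 (eq_zero_of_pow_eq_zero h4)
  exact ⟨Equiv.ofBijective τ (Finite.injective_iff_bijective.1 hinj), hτ⟩

/-- A polynomial with symmetric monodromy over `Fq` has an irreducible specialization outside any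
small set, once `q` is large. -/
theorem exists_irreducible_specialization [IsAlgClosed k] [IsDomain R] {G : Fq[X][X]}
    (hG : S.G = G.map (mapRingHom (algebraMap Fq k))) (hx : Function.Injective S.x)
    (hn : 0 < n) (he : 0 < S.e) (Z : Finset Fq)
    (hq : 20 * n.factorial ^ 4 * (n * n * S.e) ^ 3 ≤ Fintype.card Fq)
    (hz : n.factorial ^ 3 * (Z.card + n * n * (2 * S.e)) < Fintype.card Fq) :
    ∃ c ∉ Z, Irreducible (G.map (evalRingHom c)) := by
  classical
  obtain ⟨ν, hν0, hνd, hν⟩ := S.exists_discriminant hx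
  set j : Fq ↪ k := ⟨algebraMap Fq k, (algebraMap Fq k).injective⟩ with hj
  have hj' : ∀ a, j a = algebraMap Fq k a := fun _ => rfl
  set T : Finset k := (Finset.univ.map j \ Z.map j) \ ν.roots.toFinset with hT
  have hTc : Fintype.card Fq ≤ T.card + (Z.card + n * n * (2 * S.e)) := by
    have h1 := Finset.le_card_sdiff ν.roots.toFinset (Finset.univ.map j \ Z.map j)
    have h2 := Finset.le_card_sdiff (Z.map j) (Finset.univ.map j)
    have h3 := (Multiset.toFinset_card_le ν.roots).trans (card_roots' ν)
    rw [Finset.card_map, Finset.card_map, Finset.card_univ] at h2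
    rw [← hT] at h1
    omega
  have hTm : ∀ c ∈ T, ∃ a ∉ Z, c = algebraMap Fq k a := by
    intro c hc
    rw [hT, Finset.mem_sdiff, Finset.mem_sdiff] at hc
    obtain ⟨a, -, rfl⟩ := Finset.mem_map.1 hc.1.1
    exact ⟨a, fun h => hc.1.2 (Finset.mem_map_of_mem _ h), rfl⟩
  choose P hP using S.exists_point
  have hinj : ∀ c ∈ T, Function.Injective fun i => P c (S.x i) := by
    intro c hc
    refine hν _ fun h => (Finset.mem_sdiff.1 hc).2 ?_
    rw [Multiset.mem_toFinset, mem_roots hν0]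
    rwa [hP] at h
  have hτ : ∀ c, ∃ τ : Equiv.Perm (Fin n), c ∈ T →
      ∀ i, P c (S.x i) ^ Fintype.card Fq = P c (S.x (τ i)) := by
    intro c
    by_cases hc : c ∈ T
    · obtain ⟨a, -, rfl⟩ := hTm c hc
      obtain ⟨-, τ, hτ⟩ := S.exists_frobenius_perm hG (hP _) (hinj _ hc)
      exact ⟨τ, fun _ => hτ⟩
    · exact ⟨1, fun h => absurd h hc⟩
  choose τ hτ using hτ
  let _ : Algebra Fq R := ((algebraMap k R).comp (algebraMap Fq k)).toAlgebra
  have : IsScalarTower Fq k R := .of_algebraMap_eq' rfl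
  obtain ⟨c, hc, htr⟩ := S.exists_transitive_frobenius FiniteField.add_pow_card (fun j => by
      rw [hG, coeff_map, coe_mapRingHom, aeval_map_algebraMap, aeval_map_algebraMap,
        FiniteField.aeval_pow_card])
    (by positivity) hq hz T hTc P (fun c _ => hP c) (fun c hc => by
      obtain ⟨a, -, rfl⟩ := hTm c hc
      rw [← map_pow, FiniteField.pow_card]) hinj τ hτ
  obtain ⟨a, ha, rfl⟩ := hTm c hc
  refine ⟨a, ha, irreducible_of_transitive_frobenius hn
    (S.exists_frobenius_perm hG (hP _) (hinj _ hc)).1 (hinj _ hc) fun i l => ?_⟩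
  obtain ⟨r, rfl⟩ := htr i l
  refine ⟨r, ?_⟩
  clear htr
  induction r with
  | zero => simp
  | succ r ih => rw [pow_succ (Fintype.card Fq), pow_mul, ih, hτ _ hc, pow_succ' (τ _)]; rfl

end SplittingCover

/-- Hensel's lemma in an adically complete ring for a polynomial that need not be monic. -/
lemma IsAdicComplete.exists_isRoot {R : Type*} [CommRing R] (I : Ideal R) [IsAdicComplete I R]
    (f : R[X]) {a₀ : R} (h₁ : f.eval a₀ ∈ I)
    (h₂ : IsUnit (Ideal.Quotient.mk I ((derivative f).eval a₀))) :
    ∃ a, f.IsRoot a ∧ a - a₀ ∈ I := by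
  classical
  let f' := derivative f
  let c : ℕ → R := fun n => Nat.recOn n a₀ fun _ b => b - f.eval b * Ring.inverse (f'.eval b)
  have hc : ∀ n, c (n + 1) = c n - f.eval (c n) * Ring.inverse (f'.eval (c n)) := by
    intro n
    simp only [c]
  have hc_mod : ∀ n, c n ≡ a₀ [SMOD I] := by
    intro n
    induction n with
    | zero => rfl
    | succ n ih => ?_
    rw [hc, sub_eq_add_neg, ← add_zero a₀]
    refine ih.add ?_
    rw [SModEq.zero, Ideal.neg_mem_iff]
    refine I.mul_mem_right _ ?_
    rw [← SModEq.zero] at h₁ ⊢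
    exact (ih.eval f).trans h₁
  have hf'c : ∀ n, IsUnit (f'.eval (c n)) := by
    intro n
    have := isLocalHom_of_le_jacobson_bot I (IsAdicComplete.le_jacobson_bot I)
    apply IsUnit.of_map (Ideal.Quotient.mk I)
    convert! h₂ using 1
    exact SModEq.def.mp ((hc_mod n).eval _)
  have hfcI : ∀ n, f.eval (c n) ∈ I ^ (n + 1) := by
    intro n
    induction n with
    | zero => simpa only [Nat.rec_zero, zero_add, pow_one] using! h₁
    | succ n ih => ?_
    rw [← taylor_eval_sub (c n), hc, sub_eq_add_neg, sub_eq_add_neg,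
      add_neg_cancel_comm]
    rw [eval_eq_sum, sum_over_range' _ _ _ (lt_add_of_pos_right _ zero_lt_two), ←
      Finset.sum_range_add_sum_Ico _ (Nat.le_add_left _ _)]
    swap
    · intro i
      rw [zero_mul]
    refine Ideal.add_mem _ ?_ ?_
    · rw [← one_add_one_eq_two, Finset.sum_range_succ, Finset.range_one, Finset.sum_singleton,
        taylor_coeff_zero, taylor_coeff_one, pow_zero, pow_one, mul_one, mul_neg,
        mul_left_comm, Ring.mul_inverse_cancel _ (hf'c n), mul_one, add_neg_cancel]
      exact Ideal.zero_mem _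
    · refine Submodule.sum_mem _ ?_
      simp only [Finset.mem_Ico]
      rintro i ⟨h2i, _⟩
      have aux : n + 2 ≤ i * (n + 1) := by trans 2 * (n + 1) <;> nlinarith only [h2i]
      refine Ideal.mul_mem_left _ _ (Ideal.pow_le_pow_right aux ?_)
      rw [pow_mul']
      exact Ideal.pow_mem_pow ((Ideal.neg_mem_iff _).2 <| Ideal.mul_mem_right _ _ ih) _
  have aux : ∀ m n, m ≤ n → c m ≡ c n [SMOD (I ^ m • ⊤ : Ideal R)] := by
    intro m n hmn
    rw [← Ideal.one_eq_top, Ideal.smul_eq_mul, mul_one]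
    obtain ⟨k, rfl⟩ := Nat.exists_eq_add_of_le hmn
    clear hmn
    induction k with
    | zero => rw [add_zero]
    | succ k ih => ?_
    rw [← add_assoc, hc, ← add_zero (c m), sub_eq_add_neg]
    refine ih.add ?_
    symm
    rw [SModEq.zero, Ideal.neg_mem_iff]
    refine Ideal.mul_mem_right _ _ (Ideal.pow_le_pow_right ?_ (hfcI _))
    rw [add_assoc]
    exact le_self_add
  obtain ⟨a, ha⟩ := IsPrecomplete.prec' c (aux _ _)
  refine ⟨a, ?_, ?_⟩
  · show f.IsRoot a
    suffices ∀ n, f.eval a ≡ 0 [SMOD (I ^ n • ⊤ : Ideal R)] by exact IsHausdorff.haus' _ this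
    intro n
    specialize ha n
    rw [← Ideal.one_eq_top, Ideal.smul_eq_mul, mul_one] at ha ⊢
    refine (ha.symm.eval f).trans ?_
    rw [SModEq.zero]
    exact Ideal.pow_le_pow_right le_self_add (hfcI _)
  · show a - a₀ ∈ I
    specialize ha (0 + 1)
    rw [hc, pow_one, ← Ideal.one_eq_top, Ideal.smul_eq_mul, mul_one, sub_eq_add_neg] at ha
    rw [← SModEq.sub_mem, ← add_zero a₀]
    refine ha.symm.trans (SModEq.rfl.add ?_)
    rw [SModEq.zero, Ideal.neg_mem_iff]
    exact Ideal.mul_mem_right _ _ h₁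

section LocalFactorization

variable {k : Type*} [Field k]


lemma PowerSeries.exists_isRoot (f : (PowerSeries k)[X]) {a : k}
    (h₁ : (f.map (PowerSeries.constantCoeff (R := k))).eval a = 0)
    (h₂ : (f.map (PowerSeries.constantCoeff (R := k))).derivative.eval a ≠ 0) :
    ∃ r : PowerSeries k, f.IsRoot r ∧ PowerSeries.constantCoeff r = a := by
  have hev : ∀ (g : (PowerSeries k)[X]), PowerSeries.constantCoeff (g.eval (PowerSeries.C a)) =
      (g.map PowerSeries.constantCoeff).eval a := fun g => by
    rw [← eval_map_apply, PowerSeries.constantCoeff_C]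
  obtain ⟨r, hr, hr'⟩ := IsAdicComplete.exists_isRoot (Ideal.span {PowerSeries.X}) f
    (a₀ := PowerSeries.C a) (by
      rw [Ideal.mem_span_singleton, PowerSeries.X_dvd_iff, hev, h₁])
    (by
      refine IsUnit.map _ ?_
      rw [PowerSeries.isUnit_iff_constantCoeff, hev, ← derivative_map]
      exact h₂.isUnit)
  refine ⟨r, hr, ?_⟩
  rw [Ideal.mem_span_singleton, PowerSeries.X_dvd_iff, map_sub, PowerSeries.constantCoeff_C] at hr'
  exact sub_eq_zero.1 hr'

/-- Factorization over `k⟦X⟧` of a polynomial whose Newton polygon has, besides `#A` roots of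
valuation at least one, a single segment of slope `1 / (n - #A)`. -/
lemma exists_irreducible_factor_powerSeries [Infinite k] {ι : Type*} {n : ℕ}
    {G p : (PowerSeries k)[X]} {A : Finset ι} (hG : G.Monic) (hn : G.natDegree = n)
    (hA : A.card + 2 ≤ n) {ϖ : PowerSeries k} (hϖ : Associated ϖ PowerSeries.X)
    (hp : ∀ t, G.eval (ϖ * t) = ϖ ^ (A.card + 1) * p.eval t) {c : k} (hc : c ≠ 0) {y : ι → k}
    (hy : Set.InjOn y A) (hpy : p.map PowerSeries.constantCoeff = C c * ∏ i ∈ A, (X - C (y i)))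
    (hGX : G.map PowerSeries.constantCoeff = X ^ n) :
    ∃ (r : ι → PowerSeries k) (h : (PowerSeries k)[X]), Set.InjOn r A ∧
      G = (∏ i ∈ A, (X - C (r i))) * h ∧
      Irreducible h ∧ h.Monic ∧ h.natDegree + A.card = n := by
  classical
  have hϖ0 : ϖ ≠ 0 := fun h => PowerSeries.X_ne_zero (hϖ.eq_zero_iff.1 h)
  have hϖc : PowerSeries.constantCoeff ϖ = 0 := PowerSeries.X_dvd_iff.1 hϖ.symm.dvd
  have hρ : ∀ i, ∃ r : PowerSeries k, i ∈ A → p.IsRoot r ∧ PowerSeries.constantCoeff r = y i := by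
    intro i
    by_cases hi : i ∈ A
    · obtain ⟨r, hr⟩ := PowerSeries.exists_isRoot p (a := y i)
        (by rw [hpy, eval_mul, eval_prod, Finset.prod_eq_zero hi (by simp), mul_zero])
        (by
          rw [hpy, derivative_C_mul, eval_mul, eval_C, ← Finset.mul_prod_erase _ _ hi,
            derivative_mul, eval_add, eval_mul, eval_mul, derivative_X_sub_C, eval_one, eval_sub,
            eval_X, eval_C, sub_self, zero_mul, add_zero, one_mul, eval_prod]
          refine mul_ne_zero hc (Finset.prod_ne_zero_iff.2 fun j hj => ?_)
          rw [eval_sub, eval_X, eval_C, sub_ne_zero]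
          exact fun h => Finset.ne_of_mem_erase hj (hy hi (Finset.mem_of_mem_erase hj) h).symm)
      exact ⟨r, fun _ => hr⟩
    · exact ⟨0, fun h => absurd h hi⟩
  choose ρ hρ using hρ
  have hinj : Set.InjOn (fun i => ϖ * ρ i) A := by
    intro i hi j hj h
    have h1 : ρ i = ρ j := mul_left_cancel₀ hϖ0 h
    exact hy hi hj (by rw [← (hρ i hi).2, ← (hρ j hj).2, h1])
  have hdvd : ∏ i ∈ A, (X - C (ϖ * ρ i)) ∣ G := by
    have h1 : ∏ i ∈ A, (X - C (ϖ * ρ i)) =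
        ((A.val.map fun i => ϖ * ρ i).map fun a => X - C a).prod := by
      rw [Multiset.map_map]; rfl
    rw [h1, Multiset.prod_X_sub_C_dvd_iff_le_roots hG.ne_zero,
      Multiset.le_iff_subset (Multiset.Nodup.map_on hinj A.nodup)]
    intro r hr
    obtain ⟨i, hi, rfl⟩ := Multiset.mem_map.1 hr
    rw [mem_roots hG.ne_zero, IsRoot.def, hp, (hρ i hi).1, mul_zero]
  obtain ⟨h, hh⟩ := hdvd
  have hPm : (∏ i ∈ A, (X - C (ϖ * ρ i))).Monic := monic_prod_of_monic _ _ fun i _ =>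
    monic_X_sub_C _
  have hhm : h.Monic := hPm.of_mul_monic_left (hh ▸ hG)
  have hhd : h.natDegree + A.card = n := by
    rw [← hn, hh, hPm.natDegree_mul hhm, natDegree_prod_of_monic _ _ fun i _ => monic_X_sub_C _]
    simp only [natDegree_X_sub_C]
    simp [add_comm]
  have hhX : h.map PowerSeries.constantCoeff = X ^ h.natDegree := by
    have h1 : X ^ A.card * h.map PowerSeries.constantCoeff = X ^ A.card * X ^ h.natDegree := by
      rw [← pow_add, add_comm, hhd, ← hGX, hh, Polynomial.map_mul, Polynomial.map_prod]
      simp [hϖc]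
    exact mul_left_cancel₀ (pow_ne_zero _ X_ne_zero) h1
  refine ⟨fun i => ϖ * ρ i, h, hinj, hh, ?_, hhm, hhd⟩
  have hprime := PowerSeries.span_X_isPrime (R := k)
  refine IsEisensteinAt.irreducible (𝓟 := Ideal.span {PowerSeries.X}) ⟨?_, fun {j} hj => ?_, ?_⟩
    hprime hhm.isPrimitive (by omega)
  · rw [hhm.leadingCoeff, ← Ideal.eq_top_iff_one]
    exact hprime.ne_top
  · rw [Ideal.mem_span_singleton, PowerSeries.X_dvd_iff, ← coeff_map, hhX, coeff_X_pow,
      if_neg hj.ne]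
  rw [Ideal.span_singleton_pow, Ideal.mem_span_singleton]
  intro h0
  obtain ⟨τ, hτ⟩ := Infinite.exists_notMem_finset (A.image y)
  have h1 := hp (PowerSeries.C τ)
  have h2 : ∏ i ∈ A, (ϖ * PowerSeries.C τ - ϖ * ρ i) =
      ϖ ^ A.card * ∏ i ∈ A, (PowerSeries.C τ - ρ i) := by
    rw [← Finset.prod_const, ← Finset.prod_mul_distrib]
    simp only [mul_sub]
  rw [hh, eval_mul, eval_prod] at h1
  simp only [eval_sub, eval_X, eval_C] at h1
  rw [h2, pow_succ, mul_assoc, mul_assoc] at h1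
  have h3 := mul_left_cancel₀ (pow_ne_zero _ hϖ0) h1
  have h4 : PowerSeries.X ^ 2 ∣ h.eval (ϖ * PowerSeries.C τ) := by
    rw [← divX_mul_X_add h, eval_add, eval_mul, eval_X, eval_C]
    refine dvd_add ?_ h0
    rw [pow_two]
    refine mul_dvd_mul ?_ (hϖ.symm.dvd.mul_right _)
    rw [PowerSeries.X_dvd_iff, ← eval_map_apply, map_mul, hϖc, zero_mul, ← coeff_zero_eq_eval_zero,
      coeff_map, coeff_divX, ← coeff_map, hhX, coeff_X_pow, if_neg (by omega)]
  have h5 : PowerSeries.X * PowerSeries.X ∣ PowerSeries.X * p.eval (PowerSeries.C τ) := by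
    rw [← pow_two]
    exact (h4.mul_left _).trans ((dvd_of_eq h3).trans (mul_dvd_mul_right hϖ.dvd _))
  have h6 := (mul_dvd_mul_iff_left PowerSeries.X_ne_zero).1 h5
  rw [PowerSeries.X_dvd_iff, ← eval_map_apply, PowerSeries.constantCoeff_C, hpy, eval_mul, eval_C,
    eval_prod, mul_eq_zero, or_iff_right hc, Finset.prod_eq_zero_iff] at h6
  obtain ⟨i, hi, h7⟩ := h6
  rw [eval_sub, eval_X, eval_C, sub_eq_zero] at h7
  exact hτ (Finset.mem_image.2 ⟨i, hi, h7.symm⟩)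

end LocalFactorization

lemma Subgroup.eq_top_of_two_transitive_of_swap {α : Type*} [Finite α] [DecidableEq α]
    {H : Subgroup (Equiv.Perm α)} (h1 : ∀ i j, ∃ σ ∈ H, σ i = j) {c : α}
    (h2 : ∀ i j, i ≠ c → j ≠ c → ∃ σ ∈ H, σ i = j ∧ σ c = c) {u v : α} (huv : u ≠ v)
    (h3 : Equiv.swap u v ∈ H) : H = ⊤ := by
  have hconj : ∀ σ ∈ H, ∀ a b, Equiv.swap a b ∈ H → Equiv.swap (σ a) (σ b) ∈ H := by
    intro σ hσ a b hab
    have : Equiv.swap (σ a) (σ b) = σ * Equiv.swap a b * σ⁻¹ := by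
      rw [Equiv.mul_swap_eq_swap_mul, mul_inv_cancel_right]
    rw [this]
    exact H.mul_mem (H.mul_mem hσ hab) (H.inv_mem hσ)
  obtain ⟨σ, hσ, rfl⟩ := h1 u c
  have h4 : ∀ w, w ≠ σ u → Equiv.swap (σ u) w ∈ H := by
    intro w hw
    obtain ⟨τ, hτ, rfl, hτ'⟩ := h2 (σ v) w (fun h => huv (σ.injective h).symm) hw
    have := hconj τ hτ _ _ (hconj σ hσ u v h3)
    rwa [hτ'] at this
  rw [eq_top_iff, ← Equiv.Perm.closure_isSwap, Subgroup.closure_le]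
  rintro _ ⟨a, b, hab, rfl⟩
  rcases eq_or_ne a (σ u) with rfl | ha
  · exact h4 b hab.symm
  rcases eq_or_ne b (σ u) with rfl | hb
  · rw [Equiv.swap_comm]; exact h4 a ha
  have := hconj _ (h4 a ha) _ _ (h4 b hb)
  rwa [Equiv.swap_apply_left, Equiv.swap_apply_of_ne_of_ne hb hab.symm] at this

section LocalGalois

variable {K L : Type*} [Field K] [Field L] [Algebra K L] {n : ℕ} {x : Fin n → L} {g : K[X]}

/-- A factorization over an extension of the ground field yields Galois automorphisms permuting
transitively the roots of the irreducible factor and fixing the others. -/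
lemma exists_algEquiv_of_local_factor {M : Type*} [Field M] [Algebra K M]
    (hg : g.map (algebraMap K L) = ∏ i, (X - C (x i))) (hx : Function.Injective x)
    (hgen : Algebra.adjoin K (Set.range x) = ⊤) {ι : Type*} {A : Finset ι} {r : ι → M}
    (hr : Set.InjOn r A) {h : M[X]} (hh : Irreducible h)
    (hgM : g.map (algebraMap K M) = (∏ i ∈ A, (X - C (r i))) * h) :
    ∃ B : Finset (Fin n), B.card = A.card ∧ ∀ i j, i ∉ B → j ∉ B →
      ∃ f : L ≃ₐ[K] L, f (x i) = x j ∧ ∀ b ∈ B, f (x b) = x b := by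
  classical
  have hspl := isSplittingField_of_map_eq hg hgen
  have := IsSplittingField.finiteDimensional L g
  have := Normal.of_isSplittingField (F := K) (E := L) g
  let N := AlgebraicClosure M
  let φ : L →ₐ[K] N := IsAlgClosed.lift
  have hprod : (∏ i, (X - C (φ (x i))) : N[X]) =
      (∏ i ∈ A, (X - C (algebraMap M N (r i)))) * h.map (algebraMap M N) := by
    have h1 := congrArg (map (algebraMap M N)) hgM
    rw [map_map, ← IsScalarTower.algebraMap_eq, Polynomial.map_mul, Polynomial.map_prod] at h1
    have h2 := congrArg (map φ.toRingHom) hg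
    rw [map_map, Polynomial.map_prod] at h2
    have h3 : φ.toRingHom.comp (algebraMap K L) = algebraMap K N := φ.comp_algebraMap
    rw [h3, h1] at h2
    simpa using h2.symm
  have hφ : Function.Injective fun i => φ (x i) := φ.toRingHom.injective.comp hx
  have hr' : Set.InjOn (fun a => algebraMap M N (r a)) A := fun a ha b hb hab =>
    hr ha hb ((algebraMap M N).injective hab)
  set B : Finset (Fin n) := Finset.univ.filter fun i => ∃ a ∈ A, φ (x i) = algebraMap M N (r a)
    with hB
  have hAB : B.image (fun i => φ (x i)) = A.image fun a => algebraMap M N (r a) := by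
    ext w
    simp only [hB, Finset.mem_image, Finset.mem_filter, Finset.mem_univ, true_and]
    constructor
    · rintro ⟨i, ⟨a, ha, hi⟩, rfl⟩
      exact ⟨a, ha, hi.symm⟩
    · rintro ⟨a, ha, rfl⟩
      have h1 := congrArg (eval (algebraMap M N (r a))) hprod
      rw [eval_mul, eval_prod, eval_prod, Finset.prod_eq_zero ha (by simp), zero_mul,
        Finset.prod_eq_zero_iff] at h1
      obtain ⟨i, -, hi⟩ := h1
      rw [eval_sub, eval_X, eval_C, sub_eq_zero] at hi
      exact ⟨i, ⟨a, ha, hi.symm⟩, hi.symm⟩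
  have hroot : ∀ i ∉ B, aeval (φ (x i)) h = 0 := by
    intro i hi
    have h1 := congrArg (eval (φ (x i))) hprod
    rw [eval_mul, eval_prod, Finset.prod_eq_zero (Finset.mem_univ i) (by simp), eq_comm,
      mul_eq_zero, eval_map_algebraMap] at h1
    refine h1.resolve_left fun h2 => hi ?_
    rw [eval_prod, Finset.prod_eq_zero_iff] at h2
    obtain ⟨a, ha, h3⟩ := h2
    rw [eval_sub, eval_X, eval_C, sub_eq_zero] at h3
    exact Finset.mem_filter.2 ⟨Finset.mem_univ _, a, ha, h3⟩
  refine ⟨B, ?_, fun i j hi hj => ?_⟩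
  · rw [← Finset.card_image_of_injective B hφ, hAB, Finset.card_image_of_injOn hr']
  have hconj : IsConjRoot M (φ (x i)) (φ (x j)) := by
    rw [isConjRoot_def, ← minpoly.eq_of_irreducible hh (hroot i hi),
      ← minpoly.eq_of_irreducible hh (hroot j hj)]
  obtain ⟨σ, hσ⟩ := isConjRoot_iff_exists_algEquiv.1 hconj.symm
  let _ : Algebra L N := φ.toRingHom.toAlgebra
  have : IsScalarTower K L N := .of_algHom φ
  have hres : ∀ y, φ ((σ.restrictScalars K).restrictNormal L y) = σ (φ y) := fun y =>
    AlgEquiv.restrictNormal_commutes (σ.restrictScalars K) L y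
  refine ⟨(σ.restrictScalars K).restrictNormal L, φ.toRingHom.injective ?_, fun b hb =>
    φ.toRingHom.injective ?_⟩
  · exact (hres _).trans hσ
  · obtain ⟨a, -, ha⟩ := (Finset.mem_filter.1 hb).2
    exact (hres _).trans (by rw [ha, σ.commutes]; exact ha.symm)

/-- A local criterion for a polynomial to have the full symmetric group as Galois group. -/
theorem exists_algEquiv_of_three_places {M₀ M₁ M₂ : Type*} [Field M₀] [Field M₁] [Field M₂]
    [Algebra K M₀] [Algebra K M₁] [Algebra K M₂]
    (hg : g.map (algebraMap K L) = ∏ i, (X - C (x i))) (hx : Function.Injective x)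
    (hgen : Algebra.adjoin K (Set.range x) = ⊤) (h₀ : Irreducible (g.map (algebraMap K M₀)))
    {r : M₁} {h₁ : M₁[X]} (hh₁ : Irreducible h₁)
    (hg₁ : g.map (algebraMap K M₁) = (X - C r) * h₁)
    {ι : Type*} {A : Finset ι} (hA : A.card + 2 = n) {r' : ι → M₂} (hr' : Set.InjOn r' A)
    {h₂ : M₂[X]} (hh₂ : Irreducible h₂)
    (hg₂ : g.map (algebraMap K M₂) = (∏ i ∈ A, (X - C (r' i))) * h₂) (σ : Equiv.Perm (Fin n)) :
    ∃ f : L ≃ₐ[K] L, ∀ i, f (x i) = x (σ i) := by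
  classical
  let H : Subgroup (Equiv.Perm (Fin n)) :=
    { carrier := {σ | ∃ f : L ≃ₐ[K] L, ∀ i, f (x i) = x (σ i)}
      mul_mem' := by
        rintro σ τ ⟨f, hf⟩ ⟨f', hf'⟩
        exact ⟨f * f', fun i => by rw [AlgEquiv.mul_apply, hf', hf]; rfl⟩
      one_mem' := ⟨1, fun i => rfl⟩
      inv_mem' := by
        rintro σ ⟨f, hf⟩
        refine ⟨f⁻¹, fun i => f.injective ?_⟩
        rw [hf, ← AlgEquiv.mul_apply, mul_inv_cancel]
        simp }
  have hH : ∀ f : L ≃ₐ[K] L, ∃ σ ∈ H, ∀ i, f (x i) = x (σ i) := fun f => by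
    obtain ⟨σ, hσ⟩ := exists_perm_of_algEquiv hg hx f
    exact ⟨σ, ⟨f, hσ⟩, hσ⟩
  suffices h : H = ⊤ by
    have : σ ∈ H := by rw [h]; trivial
    exact this
  obtain ⟨B₀, hB₀, hf₀⟩ := exists_algEquiv_of_local_factor (A := (∅ : Finset Unit))
    (r := fun _ => 0) hg hx hgen (by simp) h₀ (by simp)
  obtain ⟨B₁, hB₁, hf₁⟩ := exists_algEquiv_of_local_factor (A := {()})
    (r := fun _ => r) hg hx hgen (by simp) hh₁ (by simpa using hg₁)
  obtain ⟨B₂, hB₂, hf₂⟩ := exists_algEquiv_of_local_factor hg hx hgen hr' hh₂ hg₂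
  rw [Finset.card_empty, Finset.card_eq_zero] at hB₀
  rw [Finset.card_singleton] at hB₁
  obtain ⟨c, rfl⟩ := Finset.card_eq_one.1 hB₁
  have hBc : B₂ᶜ.card = 2 := by rw [Finset.card_compl, Fintype.card_fin]; omega
  obtain ⟨u, v, huv, huv'⟩ := Finset.card_eq_two.1 hBc
  have hB : ∀ i, i ∉ B₂ ↔ i = u ∨ i = v := fun i => by
    rw [← Finset.mem_compl, huv', Finset.mem_insert, Finset.mem_singleton]
  refine Subgroup.eq_top_of_two_transitive_of_swap (c := c) (fun i j => ?_)
    (fun i j hi hj => ?_) huv ?_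
  · obtain ⟨f, hf, -⟩ := hf₀ i j (by simp [hB₀]) (by simp [hB₀])
    obtain ⟨σ, hσ, h⟩ := hH f
    exact ⟨σ, hσ, hx (by rw [← h, hf])⟩
  · obtain ⟨f, hf, hf'⟩ := hf₁ i j (by simpa using hi) (by simpa using hj)
    obtain ⟨σ, hσ, h⟩ := hH f
    exact ⟨σ, hσ, hx (by rw [← h, hf]), hx (by rw [← h, hf' c (by simp)])⟩
  · obtain ⟨f, hf, hf'⟩ := hf₂ u v ((hB u).2 (Or.inl rfl)) ((hB v).2 (Or.inr rfl))
    obtain ⟨σ, hσ, h⟩ := hH f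
    have h1 : σ u = v := hx (by rw [← h, hf])
    have h2 : ∀ b ∈ B₂, σ b = b := fun b hb => hx (by rw [← h, hf' b hb])
    have h3 : σ v = u := by
      have h4 : σ v ∉ B₂ := fun h5 => (hB v).2 (Or.inr rfl) (by
        have := σ.injective (h2 _ h5)
        rwa [this] at h5)
      rcases (hB _).1 h4 with h5 | h5
      · exact h5
      · exact absurd (σ.injective (h1.trans h5.symm)) huv
    have h6 : σ = Equiv.swap u v := by
      ext1 i
      by_cases hi : i ∈ B₂
      · have hiu : i ≠ u := fun h => (hB i).2 (Or.inl h) hi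
        have hiv : i ≠ v := fun h => (hB i).2 (Or.inr h) hi
        rw [h2 i hi, Equiv.swap_apply_of_ne_of_ne hiu hiv]
      · rcases (hB i).1 hi with rfl | rfl
        · rw [h1, Equiv.swap_apply_left]
        · rw [h3, Equiv.swap_apply_right]
    exact h6 ▸ hσ

end LocalGalois

section GoldbachFamily

variable {k : Type*} [Field k] {m : ℕ}

/-- The homogenisation `Δ ^ n * (f - ∏ (X - C (Y j / Δ)))(T / Δ)`, as a polynomial in `T`. -/
noncomputable def goldbachFamily {R : Type*} [CommRing R] (f : R[X]) (Δ : R) (Y : Fin m → R) :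
    R[X] :=
  f.scaleRoots Δ - C Δ * ∏ j, (X - C (Y j))

section

variable {R : Type*} [CommRing R] {f : R[X]} {Δ : R} {Y : Fin m → R}

lemma degree_goldbachFamily_aux [Nontrivial R] (hf : f.Monic) (hm : f.natDegree = m + 1) :
    (C Δ * ∏ j, (X - C (Y j))).degree < (f.scaleRoots Δ).degree := by
  rw [degree_scaleRoots, degree_eq_natDegree hf.ne_zero, hm]
  refine (degree_mul_le_of_le degree_C_le le_rfl).trans_lt ?_
  rw [zero_add]
  have h := natDegree_prod_of_monic Finset.univ (fun j => X - C (Y j)) (fun j _ => monic_X_sub_C _)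
  refine degree_le_natDegree.trans_lt ?_
  rw [h]
  simp only [natDegree_X_sub_C, Finset.sum_const, Finset.card_univ, Fintype.card_fin, smul_eq_mul,
    mul_one]
  exact_mod_cast Nat.lt_succ_self m

lemma monic_goldbachFamily [Nontrivial R] (hf : f.Monic) (hm : f.natDegree = m + 1) :
    (goldbachFamily f Δ Y).Monic :=
  Monic.sub_of_left ((monic_scaleRoots_iff Δ).2 hf) (degree_goldbachFamily_aux hf hm)

lemma natDegree_goldbachFamily [Nontrivial R] (hf : f.Monic) (hm : f.natDegree = m + 1) :
    (goldbachFamily f Δ Y).natDegree = m + 1 := by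
  rw [goldbachFamily, natDegree_eq_of_degree_eq
    (degree_sub_eq_left_of_degree_lt (degree_goldbachFamily_aux hf hm)), natDegree_scaleRoots, hm]

lemma map_goldbachFamily {S : Type*} [CommRing S] [Nontrivial S] (hf : f.Monic) (φ : R →+* S) :
    (goldbachFamily f Δ Y).map φ = goldbachFamily (f.map φ) (φ Δ) (fun j => φ (Y j)) := by
  simp only [goldbachFamily, Polynomial.map_sub, Polynomial.map_mul, map_C, Polynomial.map_prod,
    map_X]
  rw [map_scaleRoots]
  simp [hf.leadingCoeff]

lemma eval_mul_goldbachFamily (hm : f.natDegree = m + 1) (t : R) :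
    (goldbachFamily f Δ Y).eval (Δ * t) =
      Δ ^ (m + 1) * f.eval t - Δ * ∏ j, (Δ * t - Y j) := by
  rw [goldbachFamily, eval_sub, eval_mul, eval_C, eval_prod]
  congr 1
  · have := scaleRoots_eval₂_mul (p := f) (RingHom.id R) t Δ
    simpa [hm, eval₂_id] using this
  · simp

end

lemma exists_local_factor_goldbachFamily_powerSeries [Infinite k] {f : (PowerSeries k)[X]}
    (hf : f.Monic) (hm : f.natDegree = m + 1) {ϖ u : PowerSeries k} (hu : IsUnit u)
    (hϖ : ϖ = PowerSeries.X * u) {Y : Fin m → PowerSeries k} {A : Finset (Fin m)}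
    (hA : A.card + 1 ≤ m) {z : Fin m → PowerSeries k} (hz : ∀ j ∈ A, Y j = PowerSeries.X * z j)
    (hzinj : Set.InjOn (fun j => PowerSeries.constantCoeff (z j)) A)
    (hY : ∀ j ∉ A, PowerSeries.constantCoeff (Y j) ≠ 0) :
    ∃ (r : Fin m → PowerSeries k) (h : (PowerSeries k)[X]), Set.InjOn r A ∧
      goldbachFamily f ϖ Y = (∏ i ∈ A, (X - C (r i))) * h ∧
      Irreducible h ∧ h.Monic ∧ h.natDegree + A.card = m + 1 := by
  classical
  obtain ⟨u, rfl⟩ := hu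
  have hu0 : PowerSeries.constantCoeff (u : PowerSeries k) ≠ 0 := fun h => by
    have := (u.isUnit.map (PowerSeries.constantCoeff (R := k)))
    rw [h] at this
    exact not_isUnit_zero this
  have hui : PowerSeries.constantCoeff (↑u⁻¹ : PowerSeries k) ≠ 0 := fun h => by
    have := ((u⁻¹).isUnit.map (PowerSeries.constantCoeff (R := k)))
    rw [h] at this
    exact not_isUnit_zero this
  have hϖ0 : PowerSeries.constantCoeff ϖ = 0 := by rw [hϖ]; simp
  let y : Fin m → PowerSeries k := fun j => ↑u⁻¹ * z j
  have hy : ∀ j ∈ A, Y j = ϖ * y j := by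
    intro j hj
    rw [hz j hj, hϖ]
    simp only [y]
    rw [mul_assoc, Units.mul_inv_cancel_left]
  let p : (PowerSeries k)[X] := C (ϖ ^ (m - A.card)) * f -
    (∏ j ∈ Aᶜ, (C ϖ * X - C (Y j))) *
      ∏ j ∈ A, (X - C (y j))
  have hmA : m - A.card ≠ 0 := by omega
  refine exists_irreducible_factor_powerSeries (p := p) (ϖ := ϖ)
    (c := -∏ j ∈ Aᶜ, -PowerSeries.constantCoeff (Y j))
    (y := fun j => PowerSeries.constantCoeff (y j))
    (monic_goldbachFamily hf hm) (natDegree_goldbachFamily hf hm) (by omega)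
    (hϖ ▸ (associated_mul_unit_left _ _ u.isUnit)) ?_ ?_ ?_ ?_ ?_
  · intro t
    rw [eval_mul_goldbachFamily hm]
    simp only [p, eval_sub, eval_mul, Polynomial.eval_C, eval_prod, eval_X]
    rw [← Finset.prod_mul_prod_compl A]
    rw [Finset.prod_congr rfl (fun j hj => show ϖ * t - Y j = ϖ * (t - y j) by
      rw [hy j hj]; ring), Finset.prod_mul_distrib, Finset.prod_const]
    have : ϖ ^ (m + 1) = ϖ ^ (A.card + 1) * ϖ ^ (m - A.card) := by
      rw [← pow_add]; congr 1; omega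
    rw [this]
    ring
  · rw [neg_ne_zero, Finset.prod_ne_zero_iff]
    intro j hj
    exact neg_ne_zero.2 (hY j (Finset.mem_compl.1 hj))
  · intro i hi j hj hij
    apply hzinj hi hj
    simp only [y, map_mul] at hij
    exact mul_left_cancel₀ hui hij
  · simp [p, Polynomial.map_prod, hϖ0, hmA]
  · rw [map_goldbachFamily hf, hϖ0, goldbachFamily]
    have h1 : (f.map (PowerSeries.constantCoeff (R := k))).natDegree = m + 1 := by
      rw [hf.natDegree_map, hm]
    rw [map_zero, zero_mul, sub_zero]
    ext i
    rw [coeff_scaleRoots, h1, Polynomial.coeff_X_pow]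
    split_ifs with hi
    · subst hi
      rw [Nat.sub_self, pow_zero, mul_one, ← h1]
      exact (hf.map _).coeff_natDegree
    · rcases lt_or_gt_of_ne hi with hi | hi
      · rw [zero_pow (by omega), mul_zero]
      · rw [coeff_eq_zero_of_natDegree_lt (by omega), zero_mul]

end GoldbachFamily

section GoldbachFamily

universe u

variable {k : Type u} [Field k] {m : ℕ}

lemma exists_ringHom_powerSeries (a : k) : ∃ ψ : k[X] →+* PowerSeries k, Function.Injective ψ ∧
    (∀ g, PowerSeries.constantCoeff (ψ g) = g.eval a) ∧ ψ (X - C a) = PowerSeries.X := by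
  let ψ : k[X] →+* PowerSeries k :=
    (coeToPowerSeries.ringHom (R := k)).comp (taylorAlgHom a).toRingHom
  have hψ (g : k[X]) : ψ g = (taylor a g : k[X]) := rfl
  refine ⟨ψ, fun g g' h => ?_, fun g => ?_, ?_⟩
  · rw [hψ, hψ] at h
    exact taylor_injective a (Polynomial.coe_injective k h)
  · rw [hψ, Polynomial.constantCoeff_coe, taylor_coeff_zero]
  · rw [hψ]; simp [taylor_X]

lemma exists_ringHom_extension {R S : Type*} [CommRing R] [CommRing S] (K M : Type*) [Field K]
    [Field M] [Algebra R K] [Algebra S M] [IsFractionRing R K] [IsFractionRing S M]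
    {ψ : R →+* S} (hψ : Function.Injective ψ) :
    ∃ φ : K →+* M, φ.comp (algebraMap R K) = (algebraMap S M).comp ψ := by
  have hinj : Function.Injective ((algebraMap S M).comp ψ) := by
    rw [RingHom.coe_comp]
    exact (IsFractionRing.injective S M).comp hψ
  exact ⟨IsFractionRing.lift hinj, RingHom.ext fun x => IsFractionRing.lift_algebraMap hinj x⟩

lemma exists_local_factor_goldbachFamily [Infinite k] {f : k[X]} (hf : f.Monic)
    (hm : f.natDegree = m + 1) {a : k} {Δ Δ' : k[X]} (hΔ : Δ = (X - C a) * Δ')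
    (hΔ' : Δ'.eval a ≠ 0) {Y Z : Fin m → k[X]} {A : Finset (Fin m)} (hA : A.card + 1 ≤ m)
    (hZ : ∀ j ∈ A, Y j = (X - C a) * Z j) (hZinj : Set.InjOn (fun j => (Z j).eval a) A)
    (hY : ∀ j ∉ A, (Y j).eval a ≠ 0) :
    ∃ (M : Type u) (_ : Field M) (_ : Algebra (RatFunc k) M) (r : Fin m → M) (h : M[X]),
      Set.InjOn r A ∧ ((goldbachFamily (f.map C) Δ Y).map (algebraMap k[X] (RatFunc k))).map
        (algebraMap (RatFunc k) M) = (∏ i ∈ A, (X - C (r i))) * h ∧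
      Irreducible h ∧ h.natDegree + A.card = m + 1 := by
  obtain ⟨ψ, hψinj, hψ0, hψX⟩ := exists_ringHom_powerSeries a
  have hfC : (f.map C).Monic := hf.map _
  have hmC : (f.map C).natDegree = m + 1 := by rw [hf.natDegree_map, hm]
  obtain ⟨r, h, hr, hG, hirr, hmon, hdeg⟩ := exists_local_factor_goldbachFamily_powerSeries
    (f := (f.map C).map ψ) (hfC.map _) (by rw [hfC.natDegree_map, hmC]) (ϖ := ψ Δ) (u := ψ Δ')
    (PowerSeries.isUnit_iff_constantCoeff.2 (by rw [hψ0]; exact hΔ'.isUnit))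
    (by rw [hΔ, map_mul, hψX]) (Y := fun j => ψ (Y j)) hA (z := fun j => ψ (Z j))
    (fun j hj => by rw [hZ j hj, map_mul, hψX]) (by simpa only [hψ0] using hZinj)
    (by simpa only [hψ0] using hY)
  obtain ⟨φ, hφ⟩ := exists_ringHom_extension (RatFunc k) (FractionRing (PowerSeries k)) hψinj
  refine ⟨FractionRing (PowerSeries k), inferInstance, φ.toAlgebra,
    algebraMap _ (FractionRing (PowerSeries k)) ∘ r,
    h.map (algebraMap _ (FractionRing (PowerSeries k))), ?_, ?_, ?_, ?_⟩
  · exact (IsFractionRing.injective (PowerSeries k) _).comp_injOn hr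
  · rw [RingHom.algebraMap_toAlgebra, Polynomial.map_map, hφ, ← Polynomial.map_map,
      map_goldbachFamily hfC, hG]
    simp [Polynomial.map_prod]
  · exact (hmon.irreducible_iff_irreducible_map_fraction_map).1 hirr
  · rw [hmon.natDegree_map, hdeg]

end GoldbachFamily

section

variable {K : Type*} [Field K]

lemma SplittingField.exists_roots {n : ℕ} {g : K[X]} (hg : g.Monic) (hn : g.natDegree = n) :
    ∃ x : Fin n → g.SplittingField,
      g.map (algebraMap K g.SplittingField) = ∏ i, (X - C (x i)) ∧
      Algebra.adjoin K (Set.range x) = ⊤ := by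
  have hs := SplittingField.splits g
  have h := hs.eq_prod_roots_of_monic (hg.map _)
  have hcard : (g.map (algebraMap K g.SplittingField)).roots.toList.length = n := by
    rw [Multiset.length_toList, ← hs.natDegree_eq_card_roots, hg.natDegree_map, hn]
  subst hcard
  refine ⟨fun i => (g.map (algebraMap K g.SplittingField)).roots.toList[i.1], ?_, ?_⟩
  · rw [Fin.prod_univ_fun_getElem _ (fun a => X - C a)]
    conv_lhs => rw [h, ← Multiset.coe_toList (Polynomial.roots _)]
    rw [Multiset.map_coe, Multiset.prod_coe]
  · classical
    rw [← SplittingField.adjoin_rootSet g, rootSet_def, aroots_def]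
    congr 1
    ext a
    simp [← Multiset.mem_toList, List.mem_iff_getElem, Fin.exists_iff]

lemma separable_of_local_factor {M : Type*} [Field M] [Algebra K M] {g : K[X]}
    (hg : Irreducible g) {ι : Type*} {A : Finset ι} (hA : A.Nonempty) {r : ι → M}
    (hr : Set.InjOn r A) {h : M[X]} (hh : Irreducible h) (hdeg : h.natDegree ≠ 1)
    (hgh : g.map (algebraMap K M) = (∏ i ∈ A, (X - C (r i))) * h) : g.Separable := by
  classical
  rw [separable_iff_derivative_ne_zero hg]
  intro h0
  obtain ⟨i, hi⟩ := hA
  have h1 : derivative (g.map (algebraMap K M)) = 0 := by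
    rw [derivative_map, h0, Polynomial.map_zero]
  rw [hgh, ← Finset.mul_prod_erase A _ hi, mul_assoc, derivative_mul, derivative_X_sub_C,
    one_mul] at h1
  have h2 := congrArg (eval (r i)) h1
  simp only [eval_add, eval_mul, eval_sub, eval_X, eval_C, sub_self, zero_mul, add_zero,
    eval_zero, mul_eq_zero, eval_prod, Finset.prod_eq_zero_iff] at h2
  rcases h2 with ⟨j, hj, hij⟩ | h2
  · exact (Finset.ne_of_mem_erase hj) (hr (Finset.mem_of_mem_erase hj) hi (sub_eq_zero.1 hij).symm)
  · exact hdeg (natDegree_eq_of_degree_eq_some (degree_eq_one_of_irreducible_of_root hh h2))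

end

section

variable {k : Type*} [Field k]

lemma natDegree_coeff_prod_X_sub_C {ι : Type*} (s : Finset ι) {Y : ι → k[X]} {e : ℕ}
    (hY : ∀ i ∈ s, (Y i).natDegree ≤ e) (j : ℕ) (hj : j ≤ s.card) :
    ((∏ i ∈ s, (X - C (Y i))).coeff j).natDegree + j * e ≤ s.card * e := by
  classical
  induction s using Finset.induction_on generalizing j with
  | empty => simp at hj; simp [hj]
  | insert a s ha ih =>
    rw [Finset.card_insert_of_notMem ha] at hj ⊢
    rw [Finset.prod_insert ha]
    have ih' := fun j hj => ih (fun i hi => hY i (Finset.mem_insert_of_mem hi)) j hj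
    have hYa := hY a (Finset.mem_insert_self a s)
    have hmul : j ≤ s.card → (Y a * (∏ i ∈ s, (X - C (Y i))).coeff j).natDegree + j * e ≤
        (s.card + 1) * e := fun hj => by
      have := natDegree_mul_le (p := Y a) (q := (∏ i ∈ s, (X - C (Y i))).coeff j)
      have := ih' j hj
      rw [add_mul]
      omega
    cases j with
    | zero =>
      rw [sub_mul, coeff_sub, coeff_X_mul_zero, coeff_C_mul, zero_sub, natDegree_neg]
      exact hmul (Nat.zero_le _)
    | succ j =>
      rw [sub_mul, coeff_sub, coeff_X_mul, coeff_C_mul]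
      have h1 := ih' j (by omega)
      rcases Nat.lt_or_ge s.card (j + 1) with hlt | hle
      · have h0 : (∏ i ∈ s, (X - C (Y i))).coeff (j + 1) = 0 := by
          apply coeff_eq_zero_of_natDegree_lt
          rw [natDegree_prod_of_monic _ _ (fun i _ => monic_X_sub_C _)]
          simpa using hlt
        rw [h0, mul_zero, sub_zero, add_mul, add_mul]
        omega
      · have h2 := hmul hle
        have h3 : (j + 1) * e = j * e + e := by ring
        have h4 : (s.card + 1) * e = s.card * e + e := by ring
        rw [h3, h4] at h2 ⊢
        have := (natDegree_sub_le ((∏ i ∈ s, (X - C (Y i))).coeff j)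
          (Y a * (∏ i ∈ s, (X - C (Y i))).coeff (j + 1))).trans
          (max_le (c := s.card * e - j * e) (by omega) (by omega))
        omega

lemma natDegree_coeff_goldbachFamily {m e : ℕ} {f : k[X]} (hm : f.natDegree = m + 1)
    {Δ : k[X]} {Y : Fin m → k[X]} (hΔ : Δ.natDegree ≤ e) (hY : ∀ i, (Y i).natDegree ≤ e) (j : ℕ)
    (hj : j ≤ m + 1) :
    ((goldbachFamily (f.map C) Δ Y).coeff j).natDegree + j * e ≤ (m + 1) * e := by
  have hmC : (f.map C).natDegree = m + 1 := by rw [natDegree_map_eq_of_injective C_injective, hm]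
  have h1 : ((f.map C).scaleRoots Δ).coeff j = C (f.coeff j) * Δ ^ (m + 1 - j) := by
    rw [coeff_scaleRoots, coeff_map, hmC]
  have h2 : (C (f.coeff j) * Δ ^ (m + 1 - j)).natDegree ≤ (m + 1 - j) * e :=
    (natDegree_C_mul_le _ _).trans (natDegree_pow_le.trans (Nat.mul_le_mul le_rfl hΔ))
  have h3 : (Δ * (∏ i, (X - C (Y i))).coeff j).natDegree ≤ (m + 1 - j) * e := by
    rcases Nat.lt_or_ge m j with hlt | hle
    · rw [coeff_eq_zero_of_natDegree_lt, mul_zero, natDegree_zero]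
      · exact Nat.zero_le _
      · rw [natDegree_prod_of_monic _ _ (fun i _ => monic_X_sub_C _)]
        simpa using hlt
    · have h := natDegree_coeff_prod_X_sub_C Finset.univ (fun i _ => hY i) j (by simpa using hle)
      have := natDegree_mul_le (p := Δ) (q := (∏ i, (X - C (Y i))).coeff j)
      rw [Finset.card_univ, Fintype.card_fin] at h
      rw [Nat.sub_mul, add_mul, one_mul]
      omega
  have h4 : (goldbachFamily (f.map C) Δ Y).coeff j =
      C (f.coeff j) * Δ ^ (m + 1 - j) - Δ * (∏ i, (X - C (Y i))).coeff j := by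
    rw [← h1, ← coeff_C_mul, ← coeff_sub]
    rfl
  have h5 : j * e ≤ (m + 1) * e := Nat.mul_le_mul hj le_rfl
  have h6 := natDegree_sub_le_of_le h2 h3
  rw [← h4, max_self, Nat.sub_mul] at h6
  omega

end

section

variable {R : Type*} [CommRing R] {m : ℕ}

/-- The common denominator of the rational functions interpolated by `goldbachNumerator`. -/
noncomputable def goldbachDenominator (θ η : Fin m → R) : R[X] :=
  X * Lagrange.nodal Finset.univ θ * Lagrange.nodal Finset.univ η

/-- The numerator of `1 / (X - θ j) + D * (X - η j) / E + 1 / X` over `X * D * E`, where `D` and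
`E` are the monic polynomials with roots `θ` and `η`. -/
noncomputable def goldbachNumerator (θ η : Fin m → R) (j : Fin m) : R[X] :=
  X * Lagrange.nodal Finset.univ η * Lagrange.nodal (Finset.univ.erase j) θ +
    X * Lagrange.nodal Finset.univ θ ^ 2 * (X - C (η j)) +
    Lagrange.nodal Finset.univ θ * Lagrange.nodal Finset.univ η

lemma natDegree_goldbachDenominator_le [Nontrivial R] (θ η : Fin m → R) :
    (goldbachDenominator θ η).natDegree ≤ 2 * m + 2 := by
  refine natDegree_mul_le.trans ?_
  have := natDegree_mul_le (p := X) (q := Lagrange.nodal Finset.univ θ)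
  simp only [Lagrange.natDegree_nodal, Finset.card_univ, Fintype.card_fin, natDegree_X] at this ⊢
  omega

lemma natDegree_goldbachNumerator_le [Nontrivial R] (θ η : Fin m → R) (j : Fin m) :
    (goldbachNumerator θ η j).natDegree ≤ 2 * m + 2 := by
  have hE : (Lagrange.nodal Finset.univ η).natDegree ≤ m := by simp
  have hD : (Lagrange.nodal Finset.univ θ).natDegree ≤ m := by simp
  have hj : (Lagrange.nodal (Finset.univ.erase j) θ).natDegree ≤ m := by simp
  have hX : (X : R[X]).natDegree ≤ 1 := natDegree_X_le
  have hXC : (X - C (η j)).natDegree ≤ 1 := natDegree_X_sub_C_le _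
  refine natDegree_add_le_of_degree_le (natDegree_add_le_of_degree_le ?_ ?_) ?_
  · exact (natDegree_mul_le_of_le (natDegree_mul_le_of_le hX hE) hj).trans (by omega)
  · exact (natDegree_mul_le_of_le (natDegree_mul_le_of_le hX (natDegree_pow_le_of_le 2 hD))
      hXC).trans (by omega)
  · exact (natDegree_mul_le_of_le hD hE).trans (by omega)

end

section

universe u

variable {k : Type u} [Field k] {m : ℕ} {f : k[X]} {θ η : Fin m → k}

private lemma eval_nodal_ne_zero {s : Finset (Fin m)} {v : Fin m → k} {a : k}
    (h : ∀ i ∈ s, a ≠ v i) : (Lagrange.nodal s v).eval a ≠ 0 :=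
  Lagrange.eval_nodal_not_at_node h

variable (hθ : Function.Injective θ) (hη : Function.Injective η) (hθη : ∀ i j, η i ≠ θ j)
  (hθ0 : ∀ i, θ i ≠ 0) (hη0 : ∀ i, η i ≠ 0)

include hθη hη0 hη in
lemma eval_goldbachNumerator_ne_zero {i j : Fin m} (hij : i ≠ j) :
    (goldbachNumerator θ η j).eval (η i) ≠ 0 := by
  have h : (Lagrange.nodal Finset.univ η).eval (η i) = 0 :=
    Lagrange.eval_nodal_at_node (Finset.mem_univ i)
  simp only [goldbachNumerator, eval_add, eval_mul, eval_X, h, mul_zero, zero_mul, zero_add,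
    add_zero, eval_pow, eval_sub, eval_C]
  exact mul_ne_zero (mul_ne_zero (hη0 i) (pow_ne_zero _ (eval_nodal_ne_zero fun _ _ => hθη _ _)))
    (sub_ne_zero.2 (hη.ne hij))

lemma eval_goldbachNumerator_self (j : Fin m) : (goldbachNumerator θ η j).eval (η j) = 0 := by
  have h : (Lagrange.nodal Finset.univ η).eval (η j) = 0 :=
    Lagrange.eval_nodal_at_node (Finset.mem_univ j)
  simp [goldbachNumerator, h]

include hθη hη0 hη in
lemma goldbachNumerator_injective : Function.Injective (goldbachNumerator θ η) := by
  intro i j hij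
  by_contra h
  apply eval_goldbachNumerator_ne_zero hη hθη hη0 h
  rw [← hij, eval_goldbachNumerator_self]

variable (hf : f.Monic) (hm : f.natDegree = m + 1) (hm2 : 2 ≤ m)

include hf hm hm2 hθ0 hη0 in
lemma exists_irreducible_map_goldbachFamily [Infinite k] :
    ∃ (M : Type u) (_ : Field M) (_ : Algebra (RatFunc k) M), Irreducible
      (((goldbachFamily (f.map C) (goldbachDenominator θ η) (goldbachNumerator θ η)).map
        (algebraMap k[X] (RatFunc k))).map (algebraMap (RatFunc k) M)) := by
  have hD : (Lagrange.nodal Finset.univ θ).eval 0 ≠ 0 :=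
    eval_nodal_ne_zero fun i _ => (hθ0 i).symm
  have hE : (Lagrange.nodal Finset.univ η).eval 0 ≠ 0 :=
    eval_nodal_ne_zero fun i _ => (hη0 i).symm
  obtain ⟨M, i1, i2, r, h, -, hG, hh, -⟩ := exists_local_factor_goldbachFamily hf hm (a := 0)
    (Δ := goldbachDenominator θ η)
    (Δ' := Lagrange.nodal Finset.univ θ * Lagrange.nodal Finset.univ η)
    (by simp [goldbachDenominator, mul_assoc]) (by simpa using ⟨hD, hE⟩)
    (Y := goldbachNumerator θ η) (A := ∅) (by simp; omega) (Z := 0) (by simp) (by simp)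
    (fun j _ => by simpa [goldbachNumerator] using ⟨hD, hE⟩)
  refine ⟨M, i1, i2, ?_⟩
  rw [hG, Finset.prod_empty, one_mul]
  exact hh

include hf hm hm2 hθη hη0 hη in
lemma exists_linear_factor_map_goldbachFamily [Infinite k] :
    ∃ (M : Type u) (_ : Field M) (_ : Algebra (RatFunc k) M) (r : M) (h : M[X]), Irreducible h ∧
      ((goldbachFamily (f.map C) (goldbachDenominator θ η) (goldbachNumerator θ η)).map
        (algebraMap k[X] (RatFunc k))).map (algebraMap (RatFunc k) M) = (X - C r) * h := by
  let i : Fin m := ⟨0, by omega⟩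
  have hE := Lagrange.nodal_eq_mul_nodal_erase (v := η) (Finset.mem_univ i)
  have hD : (Lagrange.nodal Finset.univ θ).eval (η i) ≠ 0 :=
    eval_nodal_ne_zero fun j _ => hθη _ _
  have hE' : (Lagrange.nodal (Finset.univ.erase i) η).eval (η i) ≠ 0 :=
    eval_nodal_ne_zero fun j hj => hη.ne (Finset.ne_of_mem_erase hj).symm
  obtain ⟨M, i1, i2, r, h, -, hG, hh, -⟩ := exists_local_factor_goldbachFamily hf hm (a := η i)
    (Δ := goldbachDenominator θ η)
    (Δ' := X * Lagrange.nodal Finset.univ θ * Lagrange.nodal (Finset.univ.erase i) η)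
    (by rw [goldbachDenominator, hE]; ring) (by simpa using ⟨⟨hη0 i, hD⟩, hE'⟩)
    (Y := goldbachNumerator θ η) (A := {i}) (by simpa using hm2)
    (Z := fun j => X * Lagrange.nodal (Finset.univ.erase i) η *
      Lagrange.nodal (Finset.univ.erase j) θ + X * Lagrange.nodal Finset.univ θ ^ 2 +
      Lagrange.nodal Finset.univ θ * Lagrange.nodal (Finset.univ.erase i) η)
    (fun j hj => by
      obtain rfl := Finset.mem_singleton.1 hj
      rw [goldbachNumerator, hE]; ring) (by simp)
    (fun j hj => eval_goldbachNumerator_ne_zero hη hθη hη0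
      (fun h => hj (by rw [h]; exact Finset.mem_singleton_self _)))
  refine ⟨M, i1, i2, r i, h, hh, ?_⟩
  rw [hG, Finset.prod_singleton]

include hf hm hm2 hθη hθ0 hθ in
lemma exists_quadratic_factor_map_goldbachFamily [Infinite k] :
    ∃ (M : Type u) (_ : Field M) (_ : Algebra (RatFunc k) M) (A : Finset (Fin m)) (r : Fin m → M)
      (h : M[X]), A.card + 2 = m + 1 ∧ Set.InjOn r A ∧ Irreducible h ∧ h.natDegree = 2 ∧
      ((goldbachFamily (f.map C) (goldbachDenominator θ η) (goldbachNumerator θ η)).map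
        (algebraMap k[X] (RatFunc k))).map (algebraMap (RatFunc k) M) =
        (∏ i ∈ A, (X - C (r i))) * h := by
  let i : Fin m := ⟨0, by omega⟩
  have hA : (Finset.univ.erase i).card = m - 1 := by simp
  have hD := Lagrange.nodal_eq_mul_nodal_erase (v := θ) (Finset.mem_univ i)
  have hDj (j : Fin m) (hj : j ∈ Finset.univ.erase i) := Lagrange.nodal_eq_mul_nodal_erase (v := θ)
    (s := Finset.univ.erase j) (Finset.mem_erase.2 ⟨(Finset.ne_of_mem_erase hj).symm,
      Finset.mem_univ i⟩)
  have hDi (j : Fin m) (hj : j ∈ Finset.univ.erase i) :=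
    Lagrange.nodal_eq_mul_nodal_erase (v := θ) hj
  have hE : (Lagrange.nodal Finset.univ η).eval (θ i) ≠ 0 :=
    eval_nodal_ne_zero fun j _ => (hθη _ _).symm
  have hD0 : (Lagrange.nodal Finset.univ θ).eval (θ i) = 0 :=
    Lagrange.eval_nodal_at_node (Finset.mem_univ i)
  have hD' : (Lagrange.nodal (Finset.univ.erase i) θ).eval (θ i) ≠ 0 :=
    eval_nodal_ne_zero fun j hj => hθ.ne (Finset.ne_of_mem_erase hj).symm
  obtain ⟨M, i1, i2, r, h, hr, hG, hh, hdeg⟩ := exists_local_factor_goldbachFamily hf hm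
    (a := θ i) (Δ := goldbachDenominator θ η)
    (Δ' := X * Lagrange.nodal (Finset.univ.erase i) θ * Lagrange.nodal Finset.univ η)
    (by rw [goldbachDenominator, hD]; ring) (by simpa using ⟨⟨hθ0 i, hD'⟩, hE⟩)
    (Y := goldbachNumerator θ η) (A := Finset.univ.erase i) (by rw [hA]; omega)
    (Z := fun j => X * Lagrange.nodal Finset.univ η *
        Lagrange.nodal ((Finset.univ.erase j).erase i) θ +
      X * Lagrange.nodal (Finset.univ.erase i) θ * Lagrange.nodal Finset.univ θ *
        (X - C (η j)) + Lagrange.nodal (Finset.univ.erase i) θ * Lagrange.nodal Finset.univ η)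
    (fun j hj => by
      rw [goldbachNumerator, hDj j hj, hD]; ring)
    (fun j hj l hl hjl => by
      simp only [eval_add, eval_mul, eval_X, hD0, mul_zero, zero_mul, add_zero, eval_sub, eval_C,
        add_left_inj] at hjl
      replace hjl := mul_left_cancel₀ (mul_ne_zero (hθ0 i) hE) hjl
      have hj' := congrArg (eval (θ i)) (hDi j hj)
      have hl' := congrArg (eval (θ i)) (hDi l hl)
      rw [Finset.erase_right_comm, eval_mul, hjl] at hj'
      rw [Finset.erase_right_comm, eval_mul, hj'] at hl'
      have hne : eval (θ i) (Lagrange.nodal ((Finset.univ.erase l).erase i) θ) ≠ 0 := fun h0 => by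
        rw [hj', h0, mul_zero] at hD'
        exact hD' rfl
      have := mul_right_cancel₀ hne hl'
      simp only [eval_sub, eval_X, eval_C, sub_right_inj] at this
      exact hθ this)
    (fun j hj => by
      obtain rfl : j = i := by simpa using hj
      simpa [goldbachNumerator, hD0] using ⟨⟨hθ0 _, hE⟩, hD'⟩)
  exact ⟨M, i1, i2, _, r, h, by omega, hr, hh, by omega, hG⟩

include hθ hη hθη hθ0 hη0 hf hm hm2 in
/-- The members of `goldbachFamily` have splitting field with full symmetric Galois group. -/
theorem exists_splittingCover_goldbachFamily [Infinite k] :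
    ∃ (R : Type u) (_ : CommRing R) (_ : IsDomain R) (_ : Algebra k R)
      (S : SplittingCover k (m + 1) R),
      S.G = goldbachFamily (f.map C) (goldbachDenominator θ η) (goldbachNumerator θ η) ∧
      S.e = 2 * m + 2 ∧ Function.Injective S.x := by
  obtain ⟨M₀, _, _, h₀⟩ := exists_irreducible_map_goldbachFamily hθ0 hη0 hf hm hm2
  obtain ⟨M₁, _, _, r₁, h₁, hh₁, hg₁⟩ :=
    exists_linear_factor_map_goldbachFamily hη hθη hη0 hf hm hm2
  obtain ⟨M₂, _, _, A, r₂, h₂, hA, hr₂, hh₂, hdeg₂, hg₂⟩ :=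
    exists_quadratic_factor_map_goldbachFamily hθ hθη hθ0 hf hm hm2
  have hfC : (f.map C).Monic := hf.map _
  have hmC : (f.map C).natDegree = m + 1 := by rw [hf.natDegree_map, hm]
  have hGm := monic_goldbachFamily (Δ := goldbachDenominator θ η) (Y := goldbachNumerator θ η)
    hfC hmC
  have hGd := natDegree_goldbachFamily (Δ := goldbachDenominator θ η)
    (Y := goldbachNumerator θ η) hfC hmC
  have hGdeg := natDegree_coeff_goldbachFamily hm (natDegree_goldbachDenominator_le θ η)
    (natDegree_goldbachNumerator_le θ η)
  generalize goldbachFamily (f.map C) (goldbachDenominator θ η) (goldbachNumerator θ η) = G at *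
  obtain ⟨g, hg⟩ : ∃ g, g = G.map (algebraMap k[X] (RatFunc k)) := ⟨_, rfl⟩
  rw [← hg] at h₀ hg₁ hg₂
  have hgm : g.Monic := hg ▸ hGm.map _
  have hgd : g.natDegree = m + 1 := by rw [hg, hGm.natDegree_map, hGd]
  have hgirr : Irreducible g := hgm.irreducible_of_irreducible_map _ _ h₀
  have hsep : g.Separable := separable_of_local_factor hgirr
    (Finset.card_pos.1 (by omega)) hr₂ hh₂ (by omega) hg₂
  obtain ⟨x, hx, hgen⟩ := SplittingField.exists_roots hgm hgd
  have hinj : Function.Injective x := by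
    rw [← separable_prod_X_sub_C_iff, ← hx]
    exact hsep.map
  have : IsScalarTower k k[X] g.SplittingField := .of_algebraMap_eq fun a => by
    rw [IsScalarTower.algebraMap_apply k (RatFunc k),
      IsScalarTower.algebraMap_apply k[X] (RatFunc k),
      ← IsScalarTower.algebraMap_apply k k[X]]
  obtain ⟨S, hS⟩ := exists_splittingCover (L := g.SplittingField) (isRingAtInfinity_ratFunc k) hGm
    hGd hGdeg (x := x)
    (by rw [IsScalarTower.algebraMap_eq k[X] (RatFunc k), ← Polynomial.map_map, ← hg, hx])
    hgen (exists_algEquiv_of_three_places hx hinj hgen h₀ hh₁ hg₁ hA hr₂ hh₂ hg₂) hinj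
  exact ⟨_, inferInstance, inferInstance, inferInstance, S, hS⟩

end

section Frobenius

variable {Fq : Type*} [Field Fq] [Fintype Fq] {k : Type*} [Field k] [Algebra Fq k]

lemma FiniteField.mem_range_algebraMap_of_pow_card {a : k} (ha : a ^ Fintype.card Fq = a) :
    a ∈ Set.range (algebraMap Fq k) := by
  classical
  have hne : (X ^ Fintype.card Fq - X : k[X]) ≠ 0 :=
    FiniteField.X_pow_card_sub_X_ne_zero k Fintype.one_lt_card
  have hsub : Finset.univ.image (algebraMap Fq k) ⊆
      (X ^ Fintype.card Fq - X : k[X]).roots.toFinset := by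
    intro b hb
    obtain ⟨c, -, rfl⟩ := Finset.mem_image.1 hb
    rw [Multiset.mem_toFinset, mem_roots hne]
    simp [← map_pow, FiniteField.pow_card]
  have heq := Finset.eq_of_subset_of_card_le hsub (by
    rw [Finset.card_image_of_injective _ (algebraMap Fq k).injective, Finset.card_univ]
    refine (Multiset.toFinset_card_le _).trans ((card_roots' _).trans ?_)
    rw [FiniteField.X_pow_card_sub_X_natDegree_eq k Fintype.one_lt_card])
  have : a ∈ Finset.univ.image (algebraMap Fq k) := by
    rw [heq, Multiset.mem_toFinset, mem_roots hne]
    simp [ha]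
  simpa using this

lemma FiniteField.exists_map_eq_of_map_frobenius {p : k[X]}
    (hp : p.map (FiniteField.frobeniusAlgHom Fq k).toRingHom = p) :
    ∃ p₀ : Fq[X], p₀.map (algebraMap Fq k) = p := by
  refine (mem_lifts p).1 ((lifts_iff_coeff_lifts p).2 fun i => ?_)
  apply FiniteField.mem_range_algebraMap_of_pow_card
  conv_rhs => rw [← hp, coeff_map]
  rfl

lemma FiniteField.exists_map_eq_of_map_map_frobenius {p : k[X][X]}
    (hp : p.map (mapRingHom (FiniteField.frobeniusAlgHom Fq k).toRingHom) = p) :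
    ∃ p₀ : Fq[X][X], p₀.map (mapRingHom (algebraMap Fq k)) = p := by
  refine (mem_lifts p).1 ((lifts_iff_coeff_lifts p).2 fun i => ?_)
  have h : (p.coeff i).map (FiniteField.frobeniusAlgHom Fq k).toRingHom = p.coeff i := by
    conv_rhs => rw [← hp, coeff_map]
    rfl
  obtain ⟨q, hq⟩ := FiniteField.exists_map_eq_of_map_frobenius h
  exact ⟨q, hq⟩

lemma FiniteField.exists_pow_card_pow_eq [IsAlgClosed k] {m : ℕ} (hm : 0 < m) :
    ∃ a : k, a ^ Fintype.card Fq ^ m = a ∧ ∀ i, 0 < i → i < m → a ^ Fintype.card Fq ^ i ≠ a := by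
  classical
  let P : ℕ → k[X] := fun i => X ^ Fintype.card Fq ^ i - X
  have hq : 1 < Fintype.card Fq := Fintype.one_lt_card
  have hP (i : ℕ) (hi : i ≠ 0) : P i ≠ 0 := FiniteField.X_pow_card_pow_sub_X_ne_zero k hi hq
  have hdeg (i : ℕ) (hi : i ≠ 0) : (P i).natDegree = Fintype.card Fq ^ i :=
    FiniteField.X_pow_card_pow_sub_X_natDegree_eq k hi hq
  have hcard : (P m).roots.toFinset.card = Fintype.card Fq ^ m := by
    obtain ⟨p, _⟩ := CharP.exists Fq
    have := charP_of_injective_algebraMap (algebraMap Fq k).injective p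
    have hsep : (P m).Separable := galois_poly_separable p _ (by
      refine dvd_pow ?_ hm.ne'
      rw [← CharP.cast_eq_zero_iff Fq p, FiniteField.cast_card_eq_zero])
    rw [Multiset.toFinset_card_of_nodup (nodup_roots hsep),
      ← (IsAlgClosed.splits (P m)).natDegree_eq_card_roots, hdeg m hm.ne']
  have hlt : ((Finset.Ico 1 m).biUnion fun i => (P i).roots.toFinset).card <
      (P m).roots.toFinset.card := by
    rw [hcard]
    refine Finset.card_biUnion_le.trans_lt (lt_of_le_of_lt (Finset.sum_le_sum
      (g := fun i => Fintype.card Fq ^ i) fun i hi => ?_)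
      (Nat.geomSum_lt hq fun i hi => (Finset.mem_Ico.1 hi).2))
    refine (Multiset.toFinset_card_le _).trans ((card_roots' _).trans (hdeg i ?_).le)
    have := (Finset.mem_Ico.1 hi).1
    omega
  obtain ⟨a, ha, ha'⟩ := Finset.exists_mem_notMem_of_card_lt_card hlt
  rw [Multiset.mem_toFinset, mem_roots (hP m hm.ne')] at ha
  refine ⟨a, by simpa [P, sub_eq_zero] using ha, fun i hi him h => ha' ?_⟩
  rw [Finset.mem_biUnion]
  refine ⟨i, Finset.mem_Ico.2 ⟨hi, him⟩, ?_⟩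
  rw [Multiset.mem_toFinset, mem_roots (hP i hi.ne')]
  simp [P, h]

lemma FiniteField.exists_frobenius_orbit [IsAlgClosed k] {m : ℕ} (hm : 0 < m) :
    ∃ (θ : Fin m → k) (σ : Equiv.Perm (Fin m)), Function.Injective θ ∧
      (∀ i, θ i ^ Fintype.card Fq = θ (σ i)) ∧ ∀ i j, ∃ r : ℕ, (σ ^ r) i = j := by
  obtain ⟨a, ha, ha'⟩ := FiniteField.exists_pow_card_pow_eq (Fq := Fq) (k := k) hm
  let φ : k → k := fun b => b ^ Fintype.card Fq
  have hφ (r : ℕ) : φ^[r] = fun b => b ^ Fintype.card Fq ^ r := pow_iterate _ _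
  have hper : Function.IsPeriodicPt φ m a := by
    rw [Function.IsPeriodicPt, Function.IsFixedPt, hφ]; exact ha
  have hmin : Function.minimalPeriod φ a = m := by
    refine le_antisymm (hper.minimalPeriod_le hm) (not_lt.1 fun hlt => ?_)
    refine ha' _ (hper.minimalPeriod_pos hm) hlt ?_
    have := Function.isPeriodicPt_minimalPeriod φ a
    rw [Function.IsPeriodicPt, Function.IsFixedPt, hφ] at this
    exact this
  let θ : Fin m → k := fun i => φ^[i.1] a
  have hθ : Function.Injective θ := fun i j hij => Fin.ext
    (Function.iterate_injOn_Iio_minimalPeriod (f := φ) (x := a)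
      (by rw [hmin]; exact i.2) (by rw [hmin]; exact j.2) hij)
  have hmod (r : ℕ) : φ^[r] a = θ ⟨r % m, Nat.mod_lt _ hm⟩ := by
    simp only [θ]
    exact (hper.iterate_mod_apply r).symm
  let s : Fin m → Fin m := fun i => ⟨(i.1 + 1) % m, Nat.mod_lt _ hm⟩
  have hs (i : Fin m) : φ (θ i) = θ (s i) := by
    rw [← hmod, Function.iterate_succ_apply']
  have hφinj : Function.Injective φ := (FiniteField.frobeniusAlgHom Fq k).toRingHom.injective
  have hsinj : Function.Injective s := fun i j hij => by
    apply hθ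
    apply hφinj
    rw [hs, hs, hij]
  let σ : Equiv.Perm (Fin m) := Equiv.ofBijective s (Finite.injective_iff_bijective.1 hsinj)
  have hσ (r : ℕ) (i : Fin m) : φ^[r] (θ i) = θ ((σ ^ r) i) := by
    induction r with
    | zero => rfl
    | succ r ih =>
      rw [Function.iterate_succ_apply', ih, hs, pow_succ', Equiv.Perm.mul_apply]
      rfl
  refine ⟨θ, σ, hθ, hs, fun i j => ⟨m - i.1 + j.1, hθ ?_⟩⟩
  rw [← hσ]
  simp only [θ]
  rw [← Function.iterate_add_apply, show m - i.1 + j.1 + i.1 = j.1 + m by omega,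
    Function.iterate_add_apply, hper.eq]

end Frobenius

section

variable {R S : Type*} [CommRing R] [CommRing S] {m : ℕ}

lemma map_nodal (φ : R →+* S) {ι : Type*} (s : Finset ι) (θ : ι → R) :
    (Lagrange.nodal s θ).map φ = Lagrange.nodal s (φ ∘ θ) := by
  simp [Lagrange.nodal, Polynomial.map_prod]

lemma map_goldbachDenominator (φ : R →+* S) (θ η : Fin m → R) :
    (goldbachDenominator θ η).map φ = goldbachDenominator (φ ∘ θ) (φ ∘ η) := by
  simp [goldbachDenominator, map_nodal]

lemma map_goldbachNumerator (φ : R →+* S) (θ η : Fin m → R) (j : Fin m) :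
    (goldbachNumerator θ η j).map φ = goldbachNumerator (φ ∘ θ) (φ ∘ η) j := by
  simp [goldbachNumerator, map_nodal]

lemma nodal_univ_comp_perm (σ : Equiv.Perm (Fin m)) (θ : Fin m → R) :
    Lagrange.nodal Finset.univ (θ ∘ σ) = Lagrange.nodal Finset.univ θ :=
  Equiv.prod_comp σ fun i => X - C (θ i)

lemma nodal_erase_comp_perm (σ : Equiv.Perm (Fin m)) (θ : Fin m → R) (j : Fin m) :
    Lagrange.nodal (Finset.univ.erase j) (θ ∘ σ) =
      Lagrange.nodal (Finset.univ.erase (σ j)) θ := by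
  refine Finset.prod_bij (fun i _ => σ i) ?_ ?_ ?_ ?_
  · intro i hi
    simpa using hi
  · intro i _ j _ h
    exact σ.injective h
  · intro i hi
    exact ⟨σ.symm i, by simpa [Equiv.symm_apply_eq] using hi, by simp⟩
  · intro i _
    rfl

lemma goldbachDenominator_comp_perm (σ : Equiv.Perm (Fin m)) (θ η : Fin m → R) :
    goldbachDenominator (θ ∘ σ) (η ∘ σ) = goldbachDenominator θ η := by
  simp only [goldbachDenominator, nodal_univ_comp_perm]

lemma goldbachNumerator_comp_perm (σ : Equiv.Perm (Fin m)) (θ η : Fin m → R) (j : Fin m) :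
    goldbachNumerator (θ ∘ σ) (η ∘ σ) j = goldbachNumerator θ η (σ j) := by
  simp only [goldbachNumerator, nodal_univ_comp_perm, nodal_erase_comp_perm, Function.comp_apply]

lemma goldbachFamily_comp_perm (σ : Equiv.Perm (Fin m)) (f : R[X]) (Δ : R) (Y : Fin m → R) :
    goldbachFamily f Δ (Y ∘ σ) = goldbachFamily f Δ Y := by
  rw [goldbachFamily, goldbachFamily]
  congr 2
  exact Equiv.prod_comp σ fun i => X - C (Y i)

lemma goldbachFamily_comp {f : R[X]} (hm : f.natDegree = m + 1) (δ : R) (y : Fin m → R) :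
    (goldbachFamily f δ fun j => δ * y j).comp (C δ * X) =
      C (δ ^ (m + 1)) * (f - ∏ j, (X - C (y j))) := by
  have h := scaleRoots_eval₂_mul (p := f) C X δ
  rw [eval₂_C_X, hm] at h
  rw [goldbachFamily, sub_comp, comp, h, mul_comp, C_comp, prod_comp]
  simp only [sub_comp, X_comp, C_comp]
  rw [Finset.prod_congr rfl fun j _ => show C δ * X - C (δ * y j) = C δ * (X - C (y j)) by
    rw [C_mul]; ring, Finset.prod_mul_distrib, Finset.prod_const, Finset.card_univ,
    Fintype.card_fin, C_pow]
  ring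

end

section

variable {K : Type*} [Field K]

lemma irreducible_of_comp_C_mul_X {f g : K[X]} {a c : K} (ha : a ≠ 0) (hc : c ≠ 0)
    (hf : Irreducible f) (h : f.comp (C a * X) = C c * g) : Irreducible g := by
  have := invertibleOfNonzero ha
  have h1 : Irreducible (algEquivCMulXAddC a 0 f) := (MulEquiv.irreducible_iff _).2 hf
  have h2 : algEquivCMulXAddC a 0 f = C c * g := by
    rw [algEquivCMulXAddC_apply, C_0, add_zero]
    exact h
  rw [h2] at h1
  exact (irreducible_isUnit_mul (isUnit_C.2 hc.isUnit)).1 h1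

end

lemma exists_shift_ne {Fq : Type*} [Field Fq] [Fintype Fq] {k : Type*} [Field k] [Algebra Fq k]
    {m : ℕ} (θ : Fin m → k) (hq : m * m < Fintype.card Fq) :
    ∃ a : Fq, ∀ i j, θ i + algebraMap Fq k a ≠ θ j := by
  classical
  have h : ((Finset.univ : Finset (Fin m × Fin m)).image fun p => θ p.2 - θ p.1).card <
      (Finset.univ.image (algebraMap Fq k)).card := by
    rw [Finset.card_image_of_injective _ (algebraMap Fq k).injective, Finset.card_univ]
    exact Finset.card_image_le.trans_lt (by simpa using hq)
  obtain ⟨b, hb, hb'⟩ := Finset.exists_mem_notMem_of_card_lt_card h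
  obtain ⟨a, -, rfl⟩ := Finset.mem_image.1 hb
  refine ⟨a, fun i j hij => hb' (Finset.mem_image.2 ⟨(i, j), Finset.mem_univ _, ?_⟩)⟩
  simp [← hij]

lemma map_mapRingHom_goldbachFamily_of_perm {R : Type*} [CommRing R] [Nontrivial R] {m : ℕ}
    {φ : R →+* R} {f : R[X]} (hf : f.Monic) (hfφ : f.map φ = f) {Δ : R[X]} (hΔφ : Δ.map φ = Δ)
    {Y : Fin m → R[X]} {σ : Equiv.Perm (Fin m)} (hYφ : ∀ j, (Y j).map φ = Y (σ j)) :
    (goldbachFamily (f.map C) Δ Y).map (mapRingHom φ) = goldbachFamily (f.map C) Δ Y := by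
  rw [map_goldbachFamily (hf.map _), Polynomial.map_map]
  have h1 : (mapRingHom φ).comp C = C.comp φ := by ext; simp
  rw [h1, ← Polynomial.map_map, hfφ, coe_mapRingHom, hΔφ]
  simp only [hYφ]
  exact goldbachFamily_comp_perm σ _ _ _

lemma map_evalRingHom_of_map_eq_goldbachFamily {R S : Type*} [CommRing R] [CommRing S]
    [Nontrivial S] {ι : R →+* S} {m : ℕ} {G : R[X][X]} {f : S[X]} (hf : f.Monic) {Δ : S[X]}
    {Y : Fin m → S[X]} (hG : G.map (mapRingHom ι) = goldbachFamily (f.map C) Δ Y) (c : R) :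
    (G.map (evalRingHom c)).map ι =
      goldbachFamily f (Δ.eval (ι c)) fun j => (Y j).eval (ι c) := by
  have h2 : ι.comp (evalRingHom c) = (evalRingHom (ι c)).comp (mapRingHom ι) := by
    refine RingHom.ext fun p => ?_
    simp [eval_map, eval₂_at_apply]
  rw [Polynomial.map_map, h2, ← Polynomial.map_map, hG, map_goldbachFamily (hf.map _),
    Polynomial.map_map]
  have h3 : (evalRingHom (ι c)).comp C = RingHom.id S := by ext; simp
  rw [h3, Polynomial.map_id]
  rfl

/-- A polynomial of degree `m + 1 ≥ 3` over a large finite field is the sum of monic irreducible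
polynomials of degrees `m` and `m + 1`. -/
theorem exists_add_irreducible_of_card {Fq : Type} [Field Fq] [Fintype Fq] {m : ℕ} (hm2 : 2 ≤ m)
    {F : Fq[X]} (hF : F.Monic) (hm : F.natDegree = m + 1)
    (hq : 20 * (m + 1).factorial ^ 4 * ((m + 1) * (m + 1) * (2 * m + 2)) ^ 3 ≤ Fintype.card Fq)
    (hz : (m + 1).factorial ^ 3 * ((2 * m + 2) + m * m * (2 * m + 2) +
      (m + 1) * (m + 1) * (2 * (2 * m + 2))) < Fintype.card Fq) :
    ∃ F₁ F₂ : Fq[X], F₁.Monic ∧ Irreducible F₁ ∧ F₁.natDegree = m ∧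
      F₂.Monic ∧ Irreducible F₂ ∧ F₂.natDegree = m + 1 ∧ F = F₁ + F₂ := by
  classical
  obtain ⟨k, _, _, _⟩ : ∃ (k : Type) (_ : Field k) (_ : Algebra Fq k), IsAlgClosed k :=
    ⟨AlgebraicClosure Fq, inferInstance, inferInstance, inferInstance⟩
  obtain ⟨θ, σ, hθ, hσ, htr⟩ := FiniteField.exists_frobenius_orbit (Fq := Fq) (k := k)
    (show 0 < m by omega)
  have hmq : m * m < Fintype.card Fq := by
    refine lt_of_le_of_lt ?_ hz
    have := (m + 1).factorial_pos
    calc m * m ≤ 1 * ((2 * m + 2) + m * m * (2 * m + 2) +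
          (m + 1) * (m + 1) * (2 * (2 * m + 2))) := by nlinarith
      _ ≤ _ := Nat.mul_le_mul (Nat.one_le_pow _ _ this) le_rfl
  obtain ⟨a, ha⟩ := exists_shift_ne θ hmq
  let η : Fin m → k := fun i => θ i + algebraMap Fq k a
  have hη : Function.Injective η := fun i j hij => hθ (add_right_cancel hij)
  have hθFq (i : Fin m) (c : Fq) : θ i ≠ algebraMap Fq k c := fun h => by
    have h1 : θ (σ i) = θ i := by rw [← hσ, h, ← map_pow, FiniteField.pow_card]
    have h2 : σ i = i := hθ h1
    have h3 (j : Fin m) : j = i := by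
      obtain ⟨r, rfl⟩ := htr i j
      exact Equiv.Perm.pow_apply_eq_self_of_apply_eq_self h2 r
    have h4 := (h3 ⟨0, by omega⟩).trans (h3 ⟨1, by omega⟩).symm
    simp at h4
  have hθ0 (i : Fin m) : θ i ≠ 0 := by simpa using hθFq i 0
  have hη0 (i : Fin m) : η i ≠ 0 := fun h => by
    apply hθFq i (-a)
    rw [map_neg]
    exact eq_neg_of_add_eq_zero_left h
  obtain ⟨φ, hφ⟩ : ∃ φ : k →+* k, φ = (FiniteField.frobeniusAlgHom Fq k).toRingHom :=
    ⟨_, rfl⟩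
  have hφpow (b : k) : φ b = b ^ Fintype.card Fq := by rw [hφ]; rfl
  have hφFq (c : Fq) : φ (algebraMap Fq k c) = algebraMap Fq k c := by
    rw [hφpow, ← map_pow, FiniteField.pow_card]
  have hφθ : φ ∘ θ = θ ∘ σ := funext fun i => (hφpow _).trans (hσ i)
  have hφη : φ ∘ η = η ∘ σ := funext fun i => by
    simp only [η, Function.comp_apply, map_add, hφFq]
    rw [hφpow, hσ]
  obtain ⟨f, hfF⟩ : ∃ f : k[X], f = F.map (algebraMap Fq k) := ⟨_, rfl⟩
  have hf : f.Monic := hfF ▸ hF.map _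
  have hfm : f.natDegree = m + 1 := by rw [hfF, hF.natDegree_map, hm]
  obtain ⟨Δ, hΔ⟩ : ∃ Δ, Δ = goldbachDenominator θ η := ⟨_, rfl⟩
  obtain ⟨Y, hY⟩ : ∃ Y, Y = goldbachNumerator θ η := ⟨_, rfl⟩
  have hΔφ : Δ.map φ = Δ := by
    rw [hΔ, map_goldbachDenominator, hφθ, hφη, goldbachDenominator_comp_perm]
  have hYφ (j : Fin m) : (Y j).map φ = Y (σ j) := by
    rw [hY, map_goldbachNumerator, hφθ, hφη, goldbachNumerator_comp_perm]
  have hfφ : f.map φ = f := by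
    rw [hfF, Polynomial.map_map]
    congr 1
    exact RingHom.ext hφFq
  obtain ⟨G, hG⟩ : ∃ G : Fq[X][X],
      G.map (mapRingHom (algebraMap Fq k)) = goldbachFamily (f.map C) Δ Y := by
    apply FiniteField.exists_map_eq_of_map_map_frobenius
    rw [← hφ]
    exact map_mapRingHom_goldbachFamily_of_perm hf hfφ hΔφ hYφ
  obtain ⟨R, _, _, _, S, hSG, hSe, hSx⟩ := exists_splittingCover_goldbachFamily hθ hη
    (fun i j => ha i j) hθ0 hη0 hf hfm hm2
  rw [← hΔ, ← hY] at hSG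
  have hYinj := goldbachNumerator_injective hη (fun i j => ha i j) hη0
  rw [← hY] at hYinj
  obtain ⟨P, hPdef⟩ : ∃ P : k[X],
      P = Δ * ∏ p ∈ (Finset.univ : Finset (Fin m)).offDiag, (Y p.1 - Y p.2) := ⟨_, rfl⟩
  have hP : P ≠ 0 := by
    rw [hPdef, hΔ]
    refine mul_ne_zero (mul_ne_zero (mul_ne_zero X_ne_zero Lagrange.nodal_ne_zero)
      Lagrange.nodal_ne_zero) (Finset.prod_ne_zero_iff.2 fun p hp => ?_)
    exact sub_ne_zero.2 (hYinj.ne (Finset.mem_offDiag.1 hp).2.2)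
  have hPdeg : P.natDegree ≤ (2 * m + 2) + m * m * (2 * m + 2) := by
    rw [hPdef, hΔ, hY]
    refine natDegree_mul_le_of_le (natDegree_goldbachDenominator_le θ η) ?_
    refine (natDegree_prod_le _ _).trans ((Finset.sum_le_card_nsmul _ _ (2 * m + 2)
      fun p _ => ?_).trans ?_)
    · exact (natDegree_sub_le_of_le (natDegree_goldbachNumerator_le θ η _)
        (natDegree_goldbachNumerator_le θ η _)).trans (max_self _).le
    · rw [smul_eq_mul, Finset.offDiag_card, Finset.card_univ, Fintype.card_fin]
      exact Nat.mul_le_mul (Nat.sub_le _ _) le_rfl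
  let Z : Finset Fq := Finset.univ.filter fun c => P.eval (algebraMap Fq k c) = 0
  have hZ : Z.card ≤ (2 * m + 2) + m * m * (2 * m + 2) := by
    rw [← Finset.card_image_of_injective Z (algebraMap Fq k).injective]
    refine (Finset.card_le_card (t := P.roots.toFinset) fun b hb => ?_).trans
      ((Multiset.toFinset_card_le _).trans ((card_roots' _).trans hPdeg))
    obtain ⟨c, hc, rfl⟩ := Finset.mem_image.1 hb
    rw [Multiset.mem_toFinset, mem_roots hP]
    exact (Finset.mem_filter.1 hc).2
  obtain ⟨c, hcZ, hirr⟩ := S.exists_irreducible_specialization (hSG.trans hG.symm) hSx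
    (Nat.succ_pos m) (by omega) Z (by rw [hSe]; exact hq) (by
      rw [hSe]
      exact lt_of_le_of_lt (Nat.mul_le_mul le_rfl (Nat.add_le_add hZ le_rfl)) hz)
  have hPc : P.eval (algebraMap Fq k c) ≠ 0 := fun h => hcZ (by simp [Z, h])
  rw [hPdef, eval_mul, eval_prod] at hPc
  obtain ⟨δ, hδdef⟩ : ∃ δ, δ = Δ.eval (algebraMap Fq k c) := ⟨_, rfl⟩
  rw [← hδdef] at hPc
  have hδ : δ ≠ 0 := left_ne_zero_of_mul hPc
  have hφeval (p : k[X]) : φ (p.eval (algebraMap Fq k c)) =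
      (p.map φ).eval (algebraMap Fq k c) := by
    rw [eval_map, ← hφFq c, eval₂_at_apply, hφFq]
  have hδφ : φ δ = δ := by rw [hδdef, hφeval, hΔφ]
  let y : Fin m → k := fun j => (Y j).eval (algebraMap Fq k c) / δ
  have hyφ (j : Fin m) : φ (y j) = y (σ j) := by
    simp only [y]
    rw [map_div₀, hδφ, hφeval, hYφ]
  have hy : Function.Injective y := fun i j hij => by
    by_contra hne
    have h1 := Finset.prod_ne_zero_iff.1 (right_ne_zero_of_mul hPc) (i, j)
      (Finset.mem_offDiag.2 ⟨Finset.mem_univ _, Finset.mem_univ _, hne⟩)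
    rw [eval_sub, sub_ne_zero] at h1
    exact h1 ((div_left_inj' hδ).1 hij)
  obtain ⟨F₁, hF₁⟩ : ∃ F₁ : Fq[X], F₁.map (algebraMap Fq k) = ∏ j, (X - C (y j)) := by
    apply FiniteField.exists_map_eq_of_map_frobenius
    rw [← hφ]
    simp only [Polynomial.map_prod, Polynomial.map_sub, map_X, map_C, hyφ]
    exact Equiv.prod_comp σ fun j => X - C (y j)
  obtain ⟨d, hd⟩ := FiniteField.mem_range_algebraMap_of_pow_card (Fq := Fq)
    ((hφpow δ).symm.trans hδφ)
  have hinj := (algebraMap Fq k).injective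
  have hF₁m : F₁.Monic := by
    apply monic_of_injective hinj
    rw [hF₁]
    exact monic_prod_of_monic _ _ fun _ _ => monic_X_sub_C _
  have hF₁d : F₁.natDegree = m := by
    rw [← natDegree_map_eq_of_injective hinj, hF₁,
      natDegree_prod_of_monic _ _ fun _ _ => monic_X_sub_C _]
    simp
  have hdeg : F₁.degree < F.degree := by
    rw [degree_eq_natDegree hF.ne_zero, degree_eq_natDegree hF₁m.ne_zero, hF₁d, hm]
    exact_mod_cast Nat.lt_succ_self m
  refine ⟨F₁, F - F₁, hF₁m, ?_, hF₁d, Monic.sub_of_left hF hdeg, ?_, ?_, by ring⟩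
  · refine irreducible_of_transitive_frobenius (by omega) hF₁ hy fun i j => ?_
    obtain ⟨r, rfl⟩ := htr i j
    refine ⟨r, ?_⟩
    induction r with
    | zero => simp
    | succ r ih => rw [pow_succ (Fintype.card Fq), pow_mul, ih, ← hφpow, hyφ, pow_succ' σ,
        Equiv.Perm.mul_apply]
  · have hd0 : d ≠ 0 := fun h => hδ (by rw [← hd, h, map_zero])
    refine irreducible_of_comp_C_mul_X hd0 (pow_ne_zero (m + 1) hd0) hirr ?_
    apply map_injective _ hinj
    have h1 : (G.map (evalRingHom c)).map (algebraMap Fq k) =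
        goldbachFamily f δ fun j => δ * y j := by
      rw [map_evalRingHom_of_map_eq_goldbachFamily hf hG, ← hδdef]
      congr 1
      funext j
      exact (mul_div_cancel₀ _ hδ).symm
    rw [map_comp, h1]
    simp only [Polynomial.map_mul, map_C, map_X, Polynomial.map_sub, hd, hF₁, map_pow]
    rw [← hfF, goldbachFamily_comp hfm, C_pow, Polynomial.map_pow, map_C, hd]
  · rw [natDegree_eq_of_degree_eq (degree_sub_eq_left_of_degree_lt hdeg), hm]

/-- A monic quadratic polynomial over a finite field of odd cardinality is the sum of a monic
linear polynomial and a monic irreducible quadratic polynomial. -/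
theorem exists_add_irreducible_of_natDegree_eq_two {Fq : Type} [Field Fq] [Fintype Fq]
    (hodd : Odd (Fintype.card Fq)) {F : Fq[X]} (hF : F.Monic) (hm : F.natDegree = 2) :
    ∃ F₁ F₂ : Fq[X], F₁.Monic ∧ Irreducible F₁ ∧ F₁.natDegree = 1 ∧
      F₂.Monic ∧ Irreducible F₂ ∧ F₂.natDegree = 2 ∧ F = F₁ + F₂ := by
  have hchar : ringChar Fq ≠ 2 := fun h => by
    rw [Nat.odd_iff, FiniteField.even_card_of_char_two h] at hodd
    exact zero_ne_one hodd
  have h2 : (2 : Fq) ≠ 0 := Ring.two_ne_zero hchar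
  obtain ⟨u, hu⟩ := FiniteField.exists_nonsquare hchar
  obtain ⟨b, hb⟩ : ∃ b, b = F.coeff 1 := ⟨_, rfl⟩
  obtain ⟨c, hc⟩ : ∃ c, c = F.coeff 0 := ⟨_, rfl⟩
  obtain ⟨a, ha⟩ : ∃ a : Fq, 4 * (c - a) = (b - 1) ^ 2 - u :=
    ⟨c - ((b - 1) ^ 2 - u) / (2 * 2), by field_simp; ring⟩
  have hdeg : (X + C a : Fq[X]).degree < F.degree := by
    rw [degree_X_add_C, degree_eq_natDegree hF.ne_zero, hm]
    norm_num
  have hmonic : (F - (X + C a)).Monic := hF.sub_of_left hdeg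
  have hnat : (F - (X + C a)).natDegree = 2 := by
    rw [natDegree_eq_of_degree_eq (degree_sub_eq_left_of_degree_lt hdeg), hm]
  refine ⟨X + C a, F - (X + C a), monic_X_add_C a, ?_, natDegree_X_add_C a, hmonic, ?_, hnat,
    by ring⟩
  · exact irreducible_of_degree_eq_one (degree_X_add_C a)
  · refine (hmonic.irreducible_iff_roots_eq_zero_of_degree_le_three (by omega) (by omega)).2
      (Multiset.eq_zero_of_forall_notMem fun x hx => hu ⟨2 * x + (b - 1), ?_⟩)
    have h1 := isRoot_of_mem_roots hx
    have h3 : F.eval x = c + b * x + x ^ 2 := by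
      have h4 : F.coeff 2 = 1 := by rw [← hm]; exact hF
      rw [eval_eq_sum_range, hm, Finset.sum_range_succ, Finset.sum_range_succ,
        Finset.sum_range_one, h4, ← hb, ← hc]
      ring
    rw [IsRoot, eval_sub, h3, eval_add, eval_X, eval_C] at h1
    linear_combination -4 * h1 + ha

lemma card_bounds_of_lt {m q : ℕ} (hm : 2 ≤ m) (hq : 8 * (m + 7) ^ (2 * (m + 1) ^ 2) < q) :
    20 * (m + 1).factorial ^ 4 * ((m + 1) * (m + 1) * (2 * m + 2)) ^ 3 ≤ q ∧
    (m + 1).factorial ^ 3 * ((2 * m + 2) + m * m * (2 * m + 2) +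
      (m + 1) * (m + 1) * (2 * (2 * m + 2))) < q := by
  have hf : 1 ≤ (m + 1).factorial := Nat.factorial_pos _
  have key : 20 * (m + 1).factorial ^ 4 * ((m + 1) * (m + 1) * (2 * m + 2)) ^ 3 < q := by
    refine lt_of_le_of_lt ?_ hq
    obtain rfl | hm := hm.eq_or_lt
    · norm_num [Nat.factorial]
    · calc 20 * (m + 1).factorial ^ 4 * ((m + 1) * (m + 1) * (2 * m + 2)) ^ 3
          ≤ 20 * ((m + 1) ^ (m + 1)) ^ 4 * ((m + 1) * (m + 1) * (2 * m + 2)) ^ 3 := by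
            gcongr
            exact Nat.factorial_le_pow _
        _ = 8 * (20 * (m + 1) ^ (4 * (m + 1) + 9)) := by ring
        _ ≤ 8 * ((m + 7) ^ 2 * (m + 7) ^ (4 * (m + 1) + 9)) := by
            gcongr
            · nlinarith
            · omega
        _ = 8 * (m + 7) ^ (4 * (m + 1) + 11) := by ring
        _ ≤ 8 * (m + 7) ^ (2 * (m + 1) ^ 2) := by
            gcongr
            · omega
            · nlinarith
  refine ⟨key.le, lt_of_le_of_lt ?_ key⟩
  calc (m + 1).factorial ^ 3 * ((2 * m + 2) + m * m * (2 * m + 2) +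
        (m + 1) * (m + 1) * (2 * (2 * m + 2)))
      ≤ (m + 1).factorial ^ 4 * (6 * (m + 1) ^ 3) := by
        gcongr
        · norm_num
        · nlinarith
    _ ≤ (m + 1).factorial ^ 4 * (160 * (m + 1) ^ 9) := by gcongr <;> omega
    _ = 20 * (m + 1).factorial ^ 4 * ((m + 1) * (m + 1) * (2 * m + 2)) ^ 3 := by ring

/-- **Theorem B.**  Let `F_q` be a finite field of odd cardinality `q`, and let `F` be a monic
polynomial in `F_q[t]` of degree `n ≥ 2`.  If `q > 8(n+6)^(2n²)`, then `F` has a Goldbach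
representation in `F_q[t]`: there are monic irreducible `F₁, F₂ ∈ F_q[t]` with
`deg F₁ = n−1`, `deg F₂ = n` and `F = F₁ + F₂`. -/
theorem goldbach_large_q (Fq : Type) [Field Fq] [Fintype Fq]
    (hodd : Odd (Fintype.card Fq)) (n : ℕ) (hn : 2 ≤ n)
    (F : Polynomial Fq) (hF : F.Monic) (hdeg : F.natDegree = n)
    (hq : 8 * (n + 6) ^ (2 * n ^ 2) < Fintype.card Fq) :
    ∃ F₁ F₂ : Polynomial Fq,
      F₁.Monic ∧ Irreducible F₁ ∧ F₁.natDegree = n - 1 ∧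
      F₂.Monic ∧ Irreducible F₂ ∧ F₂.natDegree = n ∧
      F = F₁ + F₂ := by
  obtain rfl | hn := hn.eq_or_lt
  · exact exists_add_irreducible_of_natDegree_eq_two hodd hF hdeg
  · obtain ⟨m, rfl⟩ : ∃ m, n = m + 1 := ⟨n - 1, by omega⟩
    obtain ⟨h1, h2⟩ := card_bounds_of_lt (by omega) hq
    exact exists_add_irreducible_of_card (by omega) hF hdeg h1 h2
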